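/- (Theorem on the centralizer of the Jones–Temperley–Lieb algebra) Let u ∈ End(H) be any invertible operator implementing translation by two sites on the fermions, i.e. u f_j u⁻¹ = f_{j+2} and u f_j† u⁻¹ = f_{j+2}† for all 1 ≤ j ≤ N (indices modulo N); such u exists. Then the commutant of the unital subalgebra of End(H) generated by {e_1, …, e_N, u, u⁻¹} (the spin-chain representation of the Jones–Temperley–Lieb algebra JTL_N at m = 0) equals the unital subalgebra of End(H) generated by {F_(2k+1), F†_(2k+1) : 0 ≤ k ≤ L−1} together with F_(N), F†_(N) and S^z. -/

import Mathlib

open Complex Matrix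

noncomputable section

namespace SpinChain

/-- The state space of the `N`-site spin chain, `(ℂ²)^{⊗N}` realised as functions on
spin configurations. -/
abbrev V (N : ℕ) := (Fin N → Fin 2) → ℂ

/-- Operators on the spin chain, realised as matrices. -/
abbrev Op (N : ℕ) := Matrix (Fin N → Fin 2) (Fin N → Fin 2) ℂ

def sigmaX : Matrix (Fin 2) (Fin 2) ℂ := !![0, 1; 1, 0]
def sigmaY : Matrix (Fin 2) (Fin 2) ℂ := !![0, -I; I, 0]
def sigmaZ : Matrix (Fin 2) (Fin 2) ℂ := !![1, 0; 0, -1]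
def sigmaPlus : Matrix (Fin 2) (Fin 2) ℂ := ((1 : ℂ)/2) • (sigmaX + I • sigmaY)
def sigmaMinus : Matrix (Fin 2) (Fin 2) ℂ := ((1 : ℂ)/2) • (sigmaX - I • sigmaY)

variable (N : ℕ)

/-- The operator acting as the 2×2 matrix `a` on the `j`-th tensor factor and as the
identity on the others. -/
def site (a : Matrix (Fin 2) (Fin 2) ℂ) (j : Fin N) : Op N :=
  Matrix.of fun x y =>
    a (x j) (y j) * ∏ k ∈ Finset.univ.filter (fun k => k ≠ j), (if x k = y k then (1 : ℂ) else 0)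

/-- Jordan–Wigner string `∏_{k<j} diag(z 0, z 1)_k`. -/
def string (z : Fin 2 → ℂ) (j : Fin N) : Op N :=
  (((List.finRange N).filter (fun k => decide (k < j))).map
    (fun k => site N (Matrix.diagonal z) k)).prod

/-- Jordan–Wigner fermion `c_j := i^{1−j}·(∏_{k<j} diag(−i,i)_k)·σ⁻_j`; here the index
`j : Fin N` labels the physical site `j+1`. -/
def c (j : Fin N) : Op N :=
  (I ^ (-(j : ℤ))) • (string N ![-I, I] j * site N sigmaMinus j)

/-- Jordan–Wigner fermion `c_j† := i^{j−1}·(∏_{k<j} diag(i,−i)_k)·σ⁺_j`. -/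
def cd (j : Fin N) : Op N :=
  (I ^ ((j : ℕ))) • (string N ![I, -I] j * site N sigmaPlus j)

/-- The `gl(1|1)` fermion `f_j := i^j c_j` (physical index `j = j.val + 1`). -/
def f (j : Fin N) : Op N := (I ^ ((j : ℕ) + 1)) • c N j

/-- The `gl(1|1)` fermion `f_j† := i^j c_j†`. -/
def fd (j : Fin N) : Op N := (I ^ ((j : ℕ) + 1)) • cd N j

/-- Cyclic successor on site indices. -/
def fsucc {N : ℕ} (j : Fin N) : Fin N := ⟨(j.val + 1) % N, Nat.mod_lt _ j.pos⟩

/-- Periodic Temperley–Lieb generators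
`e_j = (f_j+f_{j+1})(f_j†+f_{j+1}†)`, with `e_N = (f_N+f_1)(f_N†+f_1†)`. -/
def e (j : Fin N) : Op N := (f N j + f N (fsucc j)) * (fd N j + fd N (fsucc j))

/-- `F_(m) := Σ_{j_1<⋯<j_m} f_{j_1}⋯f_{j_m}`. -/
def Fg (m : ℕ) : Op N :=
  ∑ s ∈ Finset.univ.powersetCard m, ((s.sort (· ≤ ·)).map (f N)).prod

/-- `F†_(m) := Σ_{j_1<⋯<j_m} f†_{j_1}⋯f†_{j_m}`. -/
def Fdg (m : ℕ) : Op N :=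
  ∑ s ∈ Finset.univ.powersetCard m, ((s.sort (· ≤ ·)).map (fd N)).prod

/-- `S^z := (1/2) Σ_j σ^z_j`. -/
def Sz : Op N := ((1 : ℂ)/2) • ∑ j : Fin N, site N sigmaZ j


/-- Cyclic shift of a site index by two. -/
def fshift2 {N : ℕ} (j : Fin N) : Fin N := ⟨(j.val + 2) % N, Nat.mod_lt _ j.pos⟩

/-- The generating set of the centralizer: the odd symmetry generators
`F_(2k+1)`, `F†_(2k+1)` (`0 ≤ k ≤ L−1`), the top products `F_(N)`, `F†_(N)`,
and `S^z`. -/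
def centGens (L : ℕ) : Set (Op (2 * L)) :=
  {T | (∃ k : ℕ, k < L ∧ T = Fg (2 * L) (2 * k + 1)) ∨
       (∃ k : ℕ, k < L ∧ T = Fdg (2 * L) (2 * k + 1)) ∨
       T = Fg (2 * L) (2 * L) ∨ T = Fdg (2 * L) (2 * L) ∨ T = Sz (2 * L)}

/-- `u` implements translation by two sites on the fermions:
`u f_j u⁻¹ = f_{j+2}` and `u f_j† u⁻¹ = f_{j+2}†` (indices modulo `N`). -/
def ImplementsTranslation (L : ℕ) (u : (Op (2 * L))ˣ) : Prop :=
  ∀ j : Fin (2 * L),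
    (u : Op (2 * L)) * f (2 * L) j * ((u⁻¹ : (Op (2 * L))ˣ) : Op (2 * L)) =
      f (2 * L) (fshift2 j) ∧
    (u : Op (2 * L)) * fd (2 * L) j * ((u⁻¹ : (Op (2 * L))ˣ) : Op (2 * L)) =
      fd (2 * L) (fshift2 j)

end SpinChain

/-- Fermionic creation and annihilation operators for a symplectic set of modes `ι` together with
two additional modes, and the spectral projections of the particle number operator. -/
structure Fock (𝔅 : Type*) [Ring 𝔅] [Algebra ℂ 𝔅] (ι : Type*) [Fintype ι] [DecidableEq ι] where
  bar : ι → ι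
  sgn : ι → ℂ
  bar_bar : ∀ i, bar (bar i) = i
  sgn_bar : ∀ i, sgn (bar i) = -sgn i
  sgn_mul_self : ∀ i, sgn i * sgn i = 1
  cr : ι ⊕ Bool → 𝔅
  an : ι ⊕ Bool → 𝔅
  cr_cr : ∀ i j, cr i * cr j = -(cr j * cr i)
  an_an : ∀ i j, an i * an j = -(an j * an i)
  an_cr : ∀ i j, an i * cr j = (if i = j then 1 else 0) - cr j * an i
  proj : ℤ → 𝔅
  proj_mul : ∀ p q, proj p * proj q = if p = q then proj p else 0
  sum_proj : ∑ p ∈ Finset.range (Fintype.card ι + 3), proj p = 1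
  num_eq : ∑ i, cr i * an i = ∑ p ∈ Finset.range (Fintype.card ι + 3), (p : ℂ) • proj p
  vac : ∀ S : 𝔅, ∃ c : ℂ, proj 0 * S * proj 0 = c • proj 0

namespace Fock

variable {𝔅 : Type*} [Ring 𝔅] [Algebra ℂ 𝔅] {ι : Type*} [Fintype ι] [DecidableEq ι]
  (K : Fock 𝔅 ι)

/-- Creation operators of the symplectic modes. -/
def z (i : ι) : 𝔅 := K.cr (.inl i)
/-- Annihilation operators of the symplectic modes. -/
def d (i : ι) : 𝔅 := K.an (.inl i)
def a : 𝔅 := K.cr (.inr false)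
def t : 𝔅 := K.cr (.inr true)
def da : 𝔅 := K.an (.inr false)
def dt : 𝔅 := K.an (.inr true)
/-- The total particle number. -/
def num : 𝔅 := ∑ i, K.cr i * K.an i
/-- The particle number of the symplectic modes. -/
def numM : 𝔅 := ∑ i, K.z i * K.d i
/-- The projection onto states without particles in the two additional modes. -/
def P : 𝔅 := K.da * K.a * (K.dt * K.t)
def E : 𝔅 := (1 / 2 : ℂ) • ∑ i, K.sgn i • (K.z i * K.z (K.bar i))
def F : 𝔅 := (1 / 2 : ℂ) • ∑ i, K.sgn i • (K.d (K.bar i) * K.d i)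
/-- The generators of the symplectic Lie algebra. -/
def gen (i j : ι) : 𝔅 :=
  K.z i * K.d j - (K.sgn i * K.sgn j) • (K.z (K.bar j) * K.d (K.bar i))

/-- The Fock data on the opposite algebra, with creation and annihilation exchanged. -/
def op : Fock 𝔅ᵐᵒᵖ ι where
  bar := K.bar
  sgn := K.sgn
  bar_bar := K.bar_bar
  sgn_bar := K.sgn_bar
  sgn_mul_self := K.sgn_mul_self
  cr μ := MulOpposite.op (K.an (μ.map id not))
  an μ := MulOpposite.op (K.cr (μ.map id not))
  cr_cr i j := by
    rw [← MulOpposite.op_mul, ← MulOpposite.op_mul, ← MulOpposite.op_neg, K.an_an]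
  an_an i j := by
    rw [← MulOpposite.op_mul, ← MulOpposite.op_mul, ← MulOpposite.op_neg, K.cr_cr]
  an_cr i j := by
    have h : (Sum.map id not j = Sum.map id not i) ↔ i = j := by
      rcases i with i | i <;> rcases j with j | j <;> simp [eq_comm]
    rw [← MulOpposite.op_mul, ← MulOpposite.op_mul, K.an_cr]
    simp only [h]
    split_ifs <;> simp
  proj p := MulOpposite.op (K.proj p)
  proj_mul p q := by
    rw [← MulOpposite.op_mul, K.proj_mul]
    by_cases h : p = q
    · simp [h]
    · simp [h, Ne.symm h]
  sum_proj := by rw [← Finset.op_sum, K.sum_proj, MulOpposite.op_one]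
  num_eq := by
    have h : ∑ i : ι ⊕ Bool, K.cr (i.map id not) * K.an (i.map id not) = ∑ i, K.cr i * K.an i := by
      simp [Fintype.sum_sum_type, add_comm]
    simp only [← MulOpposite.op_mul, ← Finset.op_sum, ← MulOpposite.op_smul]
    rw [h, K.num_eq]
  vac S := by
    obtain ⟨c, hc⟩ := K.vac S.unop
    refine ⟨c, ?_⟩
    rw [← MulOpposite.op_smul, ← hc]
    simp [mul_assoc]

/-! ### Elementary relations -/

lemma zz (i j : ι) : K.z i * K.z j = -(K.z j * K.z i) := K.cr_cr _ _
lemma dd (i j : ι) : K.d i * K.d j = -(K.d j * K.d i) := K.an_an _ _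
lemma dz (i j : ι) : K.d i * K.z j = (if i = j then 1 else 0) - K.z j * K.d i := by
  simp [d, z, K.an_cr]

lemma eq_zero_of_eq_neg {x : 𝔅} (h : x = -x) : x = 0 := by
  have h2 : (2 : ℂ) • x = 0 := by rw [two_smul]; nth_rewrite 1 [h]; simp
  simpa using h2

lemma cr_sq (i : ι ⊕ Bool) : K.cr i * K.cr i = 0 := eq_zero_of_eq_neg (K.cr_cr i i)
lemma an_sq (i : ι ⊕ Bool) : K.an i * K.an i = 0 := eq_zero_of_eq_neg (K.an_an i i)

lemma an_cr_of_ne {i j : ι ⊕ Bool} (h : i ≠ j) : K.an i * K.cr j = -(K.cr j * K.an i) := by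
  simp [K.an_cr, h]

lemma cr_an_of_ne {i j : ι ⊕ Bool} (h : i ≠ j) : K.cr j * K.an i = -(K.an i * K.cr j) := by
  simp [K.an_cr, h]

/-- Rewriting rules moving the two additional modes to the left in normal order. -/
lemma rels :
    (K.a * K.a = 0 ∧ K.t * K.t = 0 ∧ K.da * K.da = 0 ∧ K.dt * K.dt = 0 ∧
      K.t * K.a = -(K.a * K.t) ∧ K.dt * K.da = -(K.da * K.dt) ∧
      K.da * K.a = 1 - K.a * K.da ∧ K.dt * K.t = 1 - K.t * K.dt ∧
      K.da * K.t = -(K.t * K.da) ∧ K.dt * K.a = -(K.a * K.dt)) ∧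
    (∀ i, K.z i * K.a = -(K.a * K.z i) ∧ K.z i * K.t = -(K.t * K.z i) ∧
      K.z i * K.da = -(K.da * K.z i) ∧ K.z i * K.dt = -(K.dt * K.z i) ∧
      K.d i * K.a = -(K.a * K.d i) ∧ K.d i * K.t = -(K.t * K.d i) ∧
      K.d i * K.da = -(K.da * K.d i) ∧ K.d i * K.dt = -(K.dt * K.d i)) := by
  refine ⟨⟨K.cr_sq _, K.cr_sq _, K.an_sq _, K.an_sq _, K.cr_cr _ _, K.an_an _ _, ?_, ?_, ?_, ?_⟩,
    fun i => ⟨K.cr_cr _ _, K.cr_cr _ _, ?_, ?_, ?_, ?_, K.an_an _ _, K.an_an _ _⟩⟩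
  · simp [da, a, K.an_cr]
  · simp [dt, t, K.an_cr]
  · exact K.an_cr_of_ne (by simp)
  · exact K.an_cr_of_ne (by simp)
  · exact K.cr_an_of_ne (by simp)
  · exact K.cr_an_of_ne (by simp)
  · exact K.an_cr_of_ne (by simp)
  · exact K.an_cr_of_ne (by simp)

lemma rels_assoc (u : 𝔅) :
    (K.a * (K.a * u) = 0 ∧ K.t * (K.t * u) = 0 ∧ K.da * (K.da * u) = 0 ∧ K.dt * (K.dt * u) = 0 ∧
      K.t * (K.a * u) = -(K.a * (K.t * u)) ∧ K.dt * (K.da * u) = -(K.da * (K.dt * u)) ∧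
      K.da * (K.a * u) = u - K.a * (K.da * u) ∧ K.dt * (K.t * u) = u - K.t * (K.dt * u) ∧
      K.da * (K.t * u) = -(K.t * (K.da * u)) ∧ K.dt * (K.a * u) = -(K.a * (K.dt * u))) ∧
    (∀ i, K.z i * (K.a * u) = -(K.a * (K.z i * u)) ∧ K.z i * (K.t * u) = -(K.t * (K.z i * u)) ∧
      K.z i * (K.da * u) = -(K.da * (K.z i * u)) ∧ K.z i * (K.dt * u) = -(K.dt * (K.z i * u)) ∧
      K.d i * (K.a * u) = -(K.a * (K.d i * u)) ∧ K.d i * (K.t * u) = -(K.t * (K.d i * u)) ∧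
      K.d i * (K.da * u) = -(K.da * (K.d i * u)) ∧
      K.d i * (K.dt * u) = -(K.dt * (K.d i * u))) := by
  obtain ⟨⟨h1, h2, h3, h4, h5, h6, h7, h8, h9, h10⟩, h⟩ := K.rels
  refine ⟨?_, fun i => ?_⟩
  · simp only [← mul_assoc, h1, h2, h3, h4, h5, h6, h7, h8, h9, h10, zero_mul, neg_mul, sub_mul,
      one_mul, and_self]
  · obtain ⟨k1, k2, k3, k4, k5, k6, k7, k8⟩ := h i
    simp only [← mul_assoc, k1, k2, k3, k4, k5, k6, k7, k8, neg_mul, and_self]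

lemma bar_inj {i j : ι} : K.bar i = K.bar j ↔ i = j :=
  ⟨fun h => by rw [← K.bar_bar i, h, K.bar_bar], fun h => h ▸ rfl⟩

lemma eq_bar {i j : ι} : i = K.bar j ↔ K.bar i = j :=
  ⟨fun h => by rw [h, K.bar_bar], fun h => by rw [← h, K.bar_bar]⟩

/-- The involution `bar` as a permutation. -/
def barEquiv : Equiv.Perm ι := ⟨K.bar, K.bar, K.bar_bar, K.bar_bar⟩

lemma sum_bar {M : Type*} [AddCommMonoid M] (g : ι → M) : ∑ i, g (K.bar i) = ∑ i, g i :=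
  Equiv.sum_comp K.barEquiv g

lemma commute_mul_of_anti {x y w : 𝔅} (hx : x * w = -(w * x)) (hy : y * w = -(w * y)) :
    Commute (x * y) w := by
  rw [commute_iff_eq, mul_assoc, hy, mul_neg, ← mul_assoc, hx, neg_mul, neg_neg, mul_assoc]

lemma commute_E {y : 𝔅} (h : ∀ i, K.z i * y = -(y * K.z i)) : Commute K.E y :=
  (Commute.sum_left _ _ _ fun i _ =>
    (commute_mul_of_anti (h i) (h (K.bar i))).smul_left _).smul_left _

lemma commute_F {y : 𝔅} (h : ∀ i, K.d i * y = -(y * K.d i)) : Commute K.F y :=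
  (Commute.sum_left _ _ _ fun i _ =>
    (commute_mul_of_anti (h (K.bar i)) (h i)).smul_left _).smul_left _

lemma E_t : Commute K.E K.t := K.commute_E fun i => by simp [K.rels]
lemma E_da : Commute K.E K.da := K.commute_E fun i => by simp [K.rels]
lemma E_dt : Commute K.E K.dt := K.commute_E fun i => by simp [K.rels]
lemma E_z (i : ι) : Commute K.E (K.z i) := K.commute_E fun j => K.zz j i
lemma F_a : Commute K.F K.a := K.commute_F fun i => by simp [K.rels]
lemma F_t : Commute K.F K.t := K.commute_F fun i => by simp [K.rels]
lemma F_da : Commute K.F K.da := K.commute_F fun i => by simp [K.rels]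
lemma F_dt : Commute K.F K.dt := K.commute_F fun i => by simp [K.rels]
lemma F_d (i : ι) : Commute K.F (K.d i) := K.commute_F fun j => K.dd j i

lemma commute_P {y : 𝔅} (h1 : K.a * y = -(y * K.a)) (h2 : K.da * y = -(y * K.da))
    (h3 : K.t * y = -(y * K.t)) (h4 : K.dt * y = -(y * K.dt)) : Commute K.P y :=
  (commute_mul_of_anti h2 h1).mul_left (commute_mul_of_anti h4 h3)

lemma P_z (i : ι) : Commute K.P (K.z i) := by
  apply K.commute_P <;> simp [K.rels]
lemma P_d (i : ι) : Commute K.P (K.d i) := by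
  apply K.commute_P <;> simp [K.rels]
lemma P_F : Commute K.P K.F :=
  ((K.F_da.mul_right K.F_a).mul_right (K.F_dt.mul_right K.F_t)).symm

lemma P_eq : K.P = 1 - K.a * K.da - K.t * K.dt - K.a * (K.t * (K.da * K.dt)) := by
  simp only [P, mul_assoc, K.rels, K.rels_assoc, mul_sub, sub_mul, one_mul, mul_one, mul_neg]
  abel

lemma P_a : K.P * K.a = 0 := by
  simp [P_eq, mul_assoc, K.rels, K.rels_assoc, mul_sub, sub_mul]
lemma P_t : K.P * K.t = 0 := by
  simp [P_eq, mul_assoc, K.rels, K.rels_assoc, mul_sub, sub_mul, mul_add]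
lemma da_P : K.da * K.P = 0 := by
  simp [P_eq, K.rels, K.rels_assoc, mul_sub]
lemma dt_P : K.dt * K.P = 0 := by
  simp [P_eq, K.rels, K.rels_assoc, mul_sub]

/-! ### Particle numbers -/

lemma num_eq_numM : K.num = K.numM + K.a * K.da + K.t * K.dt := by
  simp only [num, numM, a, da, t, dt, z, d, Fintype.sum_sum_type, Fintype.sum_bool]
  abel

lemma num_cr (μ : ι ⊕ Bool) : K.num * K.cr μ = K.cr μ * K.num + K.cr μ := by
  have h : ∀ ν, K.cr ν * K.an ν * K.cr μ
      = K.cr μ * (K.cr ν * K.an ν) + if ν = μ then K.cr μ else 0 := fun ν => by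
    rw [mul_assoc, K.an_cr, mul_sub, ← mul_assoc, K.cr_cr ν μ, ← mul_assoc]
    split_ifs with h
    · rw [h]; noncomm_ring
    · noncomm_ring
  simp only [num, Finset.sum_mul, Finset.mul_sum, h, Finset.sum_add_distrib, Finset.sum_ite_eq',
    Finset.mem_univ, if_true]

lemma num_an (μ : ι ⊕ Bool) : K.num * K.an μ = K.an μ * K.num - K.an μ := by
  have h : ∀ ν, K.cr ν * K.an ν * K.an μ
      = K.an μ * (K.cr ν * K.an ν) - if μ = ν then K.an μ else 0 := fun ν => by
    rw [mul_assoc, K.an_an ν μ, ← mul_assoc (K.an μ), K.an_cr]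
    split_ifs with h
    · rw [h]; noncomm_ring
    · noncomm_ring
  simp only [num, Finset.sum_mul, Finset.mul_sum, h, Finset.sum_sub_distrib, Finset.sum_ite_eq,
    Finset.mem_univ, if_true]

lemma num_z (i : ι) : K.num * K.z i = K.z i * K.num + K.z i := K.num_cr _

lemma numM_z (i : ι) : K.numM * K.z i = K.z i * K.numM + K.z i := by
  have h := K.num_z i
  simp only [num_eq_numM, add_mul, mul_add, mul_assoc, K.rels, K.rels_assoc, mul_neg, neg_neg] at h
  have := add_right_cancel (b := K.a * (K.da * K.z i) + K.t * (K.dt * K.z i))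
    (a := K.numM * K.z i) (c := K.z i * K.numM + K.z i)
  apply this; rw [← add_assoc, h]; abel

/-- `Y` raises the particle number by `r`. -/
def Deg (r : ℤ) (Y : 𝔅) : Prop := K.num * Y = Y * K.num + (r : ℂ) • Y

variable {K}
lemma Deg.mul {r s : ℤ} {X Y : 𝔅} (hX : K.Deg r X) (hY : K.Deg s Y) : K.Deg (r + s) (X * Y) := by
  unfold Deg at *
  rw [← mul_assoc, hX, add_mul, mul_assoc, hY]
  push_cast
  simp only [mul_add, mul_assoc, smul_mul_assoc, mul_smul_comm, add_smul]
  abel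

lemma Deg.smul {r : ℤ} {X : 𝔅} (hX : K.Deg r X) (c : ℂ) : K.Deg r (c • X) := by
  unfold Deg at *
  rw [mul_smul_comm, hX, smul_mul_assoc, smul_add, smul_comm]

lemma Deg.sum {r : ℤ} {κ : Type*} {s : Finset κ} {X : κ → 𝔅} (hX : ∀ i ∈ s, K.Deg r (X i)) :
    K.Deg r (∑ i ∈ s, X i) := by
  unfold Deg at *
  rw [Finset.mul_sum, Finset.sum_mul, Finset.smul_sum, ← Finset.sum_add_distrib]
  exact Finset.sum_congr rfl hX

lemma Deg.pow {r : ℤ} {X : 𝔅} (hX : K.Deg r X) (k : ℕ) : K.Deg (k * r) (X ^ k) := by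
  induction k with
  | zero => simp [Deg]
  | succ k ih =>
    rw [pow_succ]
    convert ih.mul hX using 1
    push_cast; ring

variable (K)
lemma deg_cr (μ : ι ⊕ Bool) : K.Deg 1 (K.cr μ) := by simp [Deg, K.num_cr]
lemma deg_an (μ : ι ⊕ Bool) : K.Deg (-1) (K.an μ) := by simp [Deg, K.num_an, sub_eq_add_neg]
lemma deg_z (i : ι) : K.Deg 1 (K.z i) := K.deg_cr _
lemma deg_d (i : ι) : K.Deg (-1) (K.d i) := K.deg_an _
lemma deg_a : K.Deg 1 K.a := K.deg_cr _
lemma deg_t : K.Deg 1 K.t := K.deg_cr _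
lemma deg_da : K.Deg (-1) K.da := K.deg_an _
lemma deg_dt : K.Deg (-1) K.dt := K.deg_an _
lemma deg_E : K.Deg 2 K.E :=
  (Deg.sum fun i _ => ((K.deg_z i).mul (K.deg_z _)).smul _).smul _
lemma deg_F : K.Deg (-2) K.F :=
  (Deg.sum fun _ _ => ((K.deg_d _).mul (K.deg_d _)).smul _).smul _
lemma deg_P : K.Deg 0 K.P :=
  (K.deg_da.mul K.deg_a).mul (K.deg_dt.mul K.deg_t)

lemma deg_gen (i j : ι) : K.Deg 0 (K.gen i j) := by
  have h1 := (K.deg_z i).mul (K.deg_d j)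
  have h2 := ((K.deg_z (K.bar j)).mul (K.deg_d (K.bar i))).smul (K.sgn i * K.sgn j)
  simp only [Deg, gen, add_neg_cancel, Int.cast_zero, zero_smul, add_zero] at *
  rw [mul_sub, sub_mul, h1, h2]

/-! ### Spectral projections -/

lemma proj_eq_zero {p : ℤ} (h : p < 0 ∨ (Fintype.card ι + 2 : ℤ) < p) : K.proj p = 0 := by
  rw [← one_mul (K.proj p), ← K.sum_proj, Finset.sum_mul]
  refine Finset.sum_eq_zero fun q hq => ?_
  rw [K.proj_mul, if_neg]
  have := Finset.mem_range.1 hq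
  omega

lemma num_proj (p : ℤ) : K.num * K.proj p = (p : ℂ) • K.proj p := by
  by_cases h : p < 0 ∨ (Fintype.card ι + 2 : ℤ) < p
  · simp [K.proj_eq_zero h]
  · lift p to ℕ using by omega
    rw [num, K.num_eq, Finset.sum_mul, Finset.sum_eq_single p]
    · simp [K.proj_mul]
    · intro q _ hq
      simp [K.proj_mul, hq]
    · intro hp
      simp at hp; omega

lemma proj_num (p : ℤ) : K.proj p * K.num = (p : ℂ) • K.proj p := by
  by_cases h : p < 0 ∨ (Fintype.card ι + 2 : ℤ) < p
  · simp [K.proj_eq_zero h]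
  · lift p to ℕ using by omega
    rw [num, K.num_eq, Finset.mul_sum, Finset.sum_eq_single p]
    · simp [K.proj_mul]
    · intro q _ hq
      simp [K.proj_mul, hq.symm]
    · intro hp
      simp at hp; omega

lemma proj_mul_of_num_mul {q : ℤ} {S : 𝔅} (h : K.num * S = (q : ℂ) • S) (p : ℤ) :
    K.proj p * S = if p = q then S else 0 := by
  have h0 : ∀ p : ℤ, p ≠ q → K.proj p * S = 0 := fun p hp => by
    have h1 : (p : ℂ) • (K.proj p * S) = (q : ℂ) • (K.proj p * S) := by
      rw [← smul_mul_assoc, ← K.proj_num, mul_assoc, h, mul_smul_comm]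
    rw [← sub_eq_zero, ← sub_smul, smul_eq_zero, sub_eq_zero] at h1
    exact h1.resolve_left (by exact_mod_cast hp)
  split_ifs with hp
  · subst hp
    nth_rewrite 2 [← one_mul S]
    rw [← K.sum_proj, Finset.sum_mul]
    by_cases hr : p < 0 ∨ (Fintype.card ι + 2 : ℤ) < p
    · rw [K.proj_eq_zero hr, zero_mul, Finset.sum_eq_zero]
      intro q hq
      exact h0 _ (by have := Finset.mem_range.1 hq; omega)
    · lift p to ℕ using by omega
      rw [Finset.sum_eq_single p]
      · intro q _ hq; exact h0 _ (by exact_mod_cast hq)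
      · intro hp; simp at hp; omega
  · exact h0 p hp

lemma mul_proj_of_mul_num {q : ℤ} {S : 𝔅} (h : S * K.num = (q : ℂ) • S) (p : ℤ) :
    S * K.proj p = if p = q then S else 0 := by
  have hn : K.op.num = MulOpposite.op K.num := by
    simp [num, op, Fintype.sum_sum_type, add_comm]
  have := K.op.proj_mul_of_num_mul (q := q) (S := MulOpposite.op S)
    (by rw [hn, ← MulOpposite.op_mul, h, MulOpposite.op_smul]) p
  apply MulOpposite.op_injective
  rw [MulOpposite.op_mul]
  refine this.trans ?_
  split_ifs <;> simp

lemma eq_zero_of_num_mul {q : ℤ} {S : 𝔅} (h : K.num * S = (q : ℂ) • S)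
    (hq : q < 0 ∨ (Fintype.card ι + 2 : ℤ) < q) : S = 0 := by
  have := K.proj_mul_of_num_mul h q
  rw [if_pos rfl, K.proj_eq_zero hq, zero_mul] at this
  exact this.symm

lemma eq_zero_of_mul_num {q : ℤ} {S : 𝔅} (h : S * K.num = (q : ℂ) • S)
    (hq : q < 0 ∨ (Fintype.card ι + 2 : ℤ) < q) : S = 0 := by
  have := K.mul_proj_of_mul_num h q
  rw [if_pos rfl, K.proj_eq_zero hq, mul_zero] at this
  exact this.symm

variable {K}
lemma Deg.num_mul {r q : ℤ} {Y S : 𝔅} (hY : K.Deg r Y) (h : K.num * S = (q : ℂ) • S) :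
    K.num * (Y * S) = ((r + q : ℤ) : ℂ) • (Y * S) := by
  rw [← mul_assoc, hY, add_mul, mul_assoc, h]
  push_cast
  rw [add_smul, mul_smul_comm, smul_mul_assoc, add_comm]

lemma Deg.mul_num {r q : ℤ} {Y S : 𝔅} (hY : K.Deg r Y) (h : S * K.num = (q : ℂ) • S) :
    S * Y * K.num = ((q - r : ℤ) : ℂ) • (S * Y) := by
  have h1 : Y * K.num = K.num * Y - (r : ℂ) • Y := by rw [hY]; abel
  rw [mul_assoc, h1, mul_sub, ← mul_assoc, h]
  push_cast
  rw [sub_smul, mul_smul_comm, smul_mul_assoc]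

lemma Deg.mul_proj {r : ℤ} {Y : 𝔅} (hY : K.Deg r Y) (p : ℤ) :
    Y * K.proj p = K.proj (p + r) * Y := by
  have h1 := K.proj_mul_of_num_mul (hY.num_mul (K.num_proj p)) (p + r)
  have h2 := K.mul_proj_of_mul_num (hY.mul_num (K.proj_num (p + r))) p
  rw [if_pos (by ring)] at h1 h2
  rw [← h1, ← mul_assoc, h2]

variable (K)

/-! ### The opposite data -/

lemma op_z (i : ι) : K.op.z i = .op (K.d i) := rfl
lemma op_d (i : ι) : K.op.d i = .op (K.z i) := rfl
lemma op_a : K.op.a = .op K.dt := rfl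
lemma op_t : K.op.t = .op K.da := rfl
lemma op_da : K.op.da = .op K.t := rfl
lemma op_dt : K.op.dt = .op K.a := rfl
lemma op_proj (p : ℤ) : K.op.proj p = .op (K.proj p) := rfl
lemma op_bar : K.op.bar = K.bar := rfl
lemma op_sgn : K.op.sgn = K.sgn := rfl
lemma op_num : K.op.num = .op K.num := by
  simp [num, op, Fintype.sum_sum_type, add_comm]
lemma op_E : K.op.E = .op K.F := by
  simp [E, F, op_z, op_bar, op_sgn]
lemma op_F : K.op.F = .op K.E := by
  simp [E, F, op_d, op_bar, op_sgn]
lemma op_P : K.op.P = .op K.P := by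
  simp [P, op_a, op_t, op_da, op_dt, mul_assoc]
lemma op_gen (i j : ι) : K.op.gen i j = .op (K.gen j i) := by
  simp [gen, op_z, op_d, op_sgn, op_bar, mul_comm]

/-! ### Invariant operators -/

/-- A family of operators transforming like the creation operators `z`. -/
def IsVec (φ : ι → 𝔅) : Prop := ∀ k l j, K.gen k l * φ j = φ j * K.gen k l
  + ((if l = j then φ k else 0) - (K.sgn k * K.sgn l) • if K.bar k = j then φ (K.bar l) else 0)

lemma isVec_z : K.IsVec K.z := fun k l j => by
  have h : ∀ i m, K.z i * K.d m * K.z j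
      = K.z j * (K.z i * K.d m) + if m = j then K.z i else 0 := fun i m => by
    rw [mul_assoc, K.dz, mul_sub, ← mul_assoc, K.zz i j]
    split_ifs <;> noncomm_ring
  simp only [gen, sub_mul, smul_mul_assoc, h, mul_sub, mul_smul_comm, smul_add]
  abel

lemma isVec_d : K.IsVec fun i => K.sgn i • K.d (K.bar i) := fun k l j => by
  have h : ∀ i m n, K.z i * K.d m * K.d n
      = K.d n * (K.z i * K.d m) - if n = i then K.d m else 0 := fun i m n => by
    rw [mul_assoc, K.dd, ← mul_assoc (K.d n), K.dz]
    split_ifs <;> noncomm_ring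
  simp only [gen, sub_mul, smul_mul_assoc, h, mul_sub, mul_smul_comm, smul_sub, K.bar_inj,
    K.sgn_bar, K.bar_bar]
  have e1 : K.sgn j • (if K.bar j = k then K.d l else 0)
      = (K.sgn k * K.sgn l) • (if K.bar k = j then -K.sgn l • K.d l else 0) := by
    by_cases hk : K.bar k = j
    · subst hk
      simp only [K.bar_bar, if_true, smul_smul, K.sgn_bar, mul_neg, mul_assoc, K.sgn_mul_self,
        mul_one]
    · have hk' : K.bar j ≠ k := fun h => hk (by rw [← h, K.bar_bar])
      simp [hk, hk']
  have e2 : (if l = j then K.sgn k • K.d (K.bar k) else 0)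
      = K.sgn j • (K.sgn k * K.sgn l) • (if j = l then K.d (K.bar k) else 0) := by
    by_cases hk : l = j
    · subst hk
      simp only [if_true, smul_smul]
      rw [mul_left_comm, K.sgn_mul_self, mul_one]
    · simp [hk, Ne.symm hk]
  rw [e1, e2, smul_comm (K.sgn k * K.sgn l) (K.sgn j)]
  abel

variable {K} in
lemma IsVec.commute_sum {φ ψ : ι → 𝔅} (hφ : K.IsVec φ) (hψ : K.IsVec ψ) {S : 𝔅}
    (hS : ∀ k l, Commute (K.gen k l) S) (k l : ι) :
    Commute (K.gen k l) (∑ j, K.sgn j • (φ j * S * ψ (K.bar j))) := by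
  have h : ∀ j, K.gen k l * (φ j * S * ψ (K.bar j)) = φ j * S * ψ (K.bar j) * K.gen k l
      + (((if l = j then φ k * S * ψ (K.bar j) else 0)
        - (K.sgn k * K.sgn l) • if K.bar k = j then φ (K.bar l) * S * ψ (K.bar j) else 0)
        + ((if K.bar l = j then φ j * S * ψ k else 0)
        - (K.sgn k * K.sgn l) • if k = j then φ j * S * ψ (K.bar l) else 0)) := fun j => by
    rw [← mul_assoc, ← mul_assoc, hφ, add_mul, mul_assoc (φ j), (hS k l).eq, ← mul_assoc, add_mul,
      mul_assoc (φ j * S) _ (ψ _), hψ]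
    simp only [K.bar_inj, K.eq_bar, mul_add, mul_sub, sub_mul, ite_mul, mul_ite, zero_mul, mul_zero, mul_smul_comm,
      smul_mul_assoc, mul_assoc]
    abel
  rw [commute_iff_eq, Finset.mul_sum, Finset.sum_mul]
  simp only [mul_smul_comm, h, smul_add, smul_sub, Finset.sum_add_distrib, smul_mul_assoc,
    Finset.sum_sub_distrib, smul_ite, smul_zero, Finset.sum_ite_eq, Finset.mem_univ, if_true,
    K.bar_bar, K.sgn_bar, smul_smul]
  rw [show -K.sgn k * (K.sgn k * K.sgn l) = -K.sgn l by
      rw [neg_mul, ← mul_assoc, K.sgn_mul_self, one_mul],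
    show K.sgn k * (K.sgn k * K.sgn l) = K.sgn l by rw [← mul_assoc, K.sgn_mul_self, one_mul]]
  simp only [neg_smul]
  abel

/-- `S` is an operator on the symplectic modes, extended by zero, which commutes with the
symplectic Lie algebra and maps `p`-particle states to `q`-particle states. -/
structure Inv (p q : ℤ) (S : 𝔅) : Prop where
  gen_comm : ∀ i j, Commute (K.gen i j) S
  da_mul : K.da * S = 0
  dt_mul : K.dt * S = 0
  mul_a : S * K.a = 0
  mul_t : S * K.t = 0
  num_mul : K.num * S = (q : ℂ) • S
  mul_num : S * K.num = (p : ℂ) • S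

/-- The contraction `∑ d_j S z_j`. -/
def theta (S : 𝔅) : 𝔅 := ∑ j, K.d j * S * K.z j
/-- The contraction `∑ s_i d_i S d_ī`. -/
def psi (S : 𝔅) : 𝔅 := ∑ i, K.sgn i • (K.d i * S * K.d (K.bar i))

lemma theta_eq (S : 𝔅) :
    K.theta S = ∑ j, K.sgn j • ((K.sgn j • K.d (K.bar j)) * S * K.z (K.bar j)) := by
  rw [theta, ← K.sum_bar]
  simp [smul_smul, K.sgn_mul_self]

lemma psi_eq (S : 𝔅) : K.psi S = ∑ j, K.sgn j •
    ((K.sgn j • K.d (K.bar j)) * S * (K.sgn (K.bar j) • K.d (K.bar (K.bar j)))) := by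
  rw [psi, ← K.sum_bar]
  simp [smul_smul, K.sgn_mul_self, K.sgn_bar, K.bar_bar]

lemma E_eq : K.E = (1 / 2 : ℂ) • ∑ i, K.sgn i • (K.z i * 1 * K.z (K.bar i)) := by
  simp [E]

lemma F_eq : K.F = (1 / 2 : ℂ) • -K.psi 1 := by
  rw [F, psi, ← K.sum_bar, ← Finset.sum_neg_distrib]
  simp [K.sgn_bar, K.bar_bar]

lemma gen_E (i j : ι) : Commute (K.gen i j) K.E := by
  rw [E_eq]
  exact (K.isVec_z.commute_sum K.isVec_z (fun k l => Commute.one_right _) i j).smul_right _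

lemma gen_F (i j : ι) : Commute (K.gen i j) K.F := by
  rw [F_eq, psi_eq]
  exact (K.isVec_d.commute_sum K.isVec_d
    (fun k l => Commute.one_right _) i j).neg_right.smul_right _

lemma gen_a (i j : ι) : Commute (K.gen i j) K.a :=
  (commute_mul_of_anti (by simp [K.rels]) (by simp [K.rels])).sub_left
    ((commute_mul_of_anti (by simp [K.rels]) (by simp [K.rels])).smul_left _)
lemma gen_t (i j : ι) : Commute (K.gen i j) K.t :=
  (commute_mul_of_anti (by simp [K.rels]) (by simp [K.rels])).sub_left
    ((commute_mul_of_anti (by simp [K.rels]) (by simp [K.rels])).smul_left _)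
lemma gen_da (i j : ι) : Commute (K.gen i j) K.da :=
  (commute_mul_of_anti (by simp [K.rels]) (by simp [K.rels])).sub_left
    ((commute_mul_of_anti (by simp [K.rels]) (by simp [K.rels])).smul_left _)
lemma gen_dt (i j : ι) : Commute (K.gen i j) K.dt :=
  (commute_mul_of_anti (by simp [K.rels]) (by simp [K.rels])).sub_left
    ((commute_mul_of_anti (by simp [K.rels]) (by simp [K.rels])).smul_left _)
lemma gen_P (i j : ι) : Commute (K.gen i j) K.P :=
  ((K.gen_da i j).mul_right (K.gen_a i j)).mul_right ((K.gen_dt i j).mul_right (K.gen_t i j))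
lemma gen_proj (i j : ι) (p : ℤ) : Commute (K.gen i j) (K.proj p) := by
  have := (K.deg_gen i j).mul_proj p
  rwa [add_zero] at this
lemma P_num : Commute K.P K.num := by
  have := K.deg_P
  simp only [Deg, Int.cast_zero, zero_smul, add_zero] at this
  exact this.symm
lemma P_proj (p : ℤ) : Commute K.P (K.proj p) := by
  have := K.deg_P.mul_proj p
  rwa [add_zero] at this

variable {K}
namespace Inv
variable {p q : ℤ} {S : 𝔅}

protected lemma op (h : K.Inv p q S) : K.op.Inv q p (.op S) where
  gen_comm i j := by
    rw [op_gen, commute_iff_eq, ← MulOpposite.op_mul, ← MulOpposite.op_mul, (h.gen_comm j i).eq]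
  da_mul := by rw [op_da, ← MulOpposite.op_mul, h.mul_t, MulOpposite.op_zero]
  dt_mul := by rw [op_dt, ← MulOpposite.op_mul, h.mul_a, MulOpposite.op_zero]
  mul_a := by rw [op_a, ← MulOpposite.op_mul, h.dt_mul, MulOpposite.op_zero]
  mul_t := by rw [op_t, ← MulOpposite.op_mul, h.da_mul, MulOpposite.op_zero]
  num_mul := by rw [op_num, ← MulOpposite.op_mul, h.mul_num, MulOpposite.op_smul]
  mul_num := by rw [op_num, ← MulOpposite.op_mul, h.num_mul, MulOpposite.op_smul]

lemma numM_mul (h : K.Inv p q S) : K.numM * S = (q : ℂ) • S := by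
  have := h.num_mul
  rwa [num_eq_numM, add_mul, add_mul, mul_assoc, h.da_mul, mul_assoc, h.dt_mul, mul_zero, mul_zero,
    add_zero, add_zero] at this

lemma mul_numM (h : K.Inv p q S) : S * K.numM = (p : ℂ) • S := by
  have := h.mul_num
  rwa [num_eq_numM, mul_add, mul_add, ← mul_assoc, h.mul_a, ← mul_assoc, h.mul_t, zero_mul,
    zero_mul, add_zero, add_zero] at this

lemma eq_zero_of_lt (h : K.Inv p q S) (hq : q < 0 ∨ (Fintype.card ι : ℤ) < q) : S = 0 := by
  rcases hq with hq | hq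
  · exact K.eq_zero_of_num_mul h.num_mul (.inl hq)
  · have h1 := K.eq_zero_of_num_mul (K.deg_a.num_mul (K.deg_t.num_mul h.num_mul))
      (.inr (by omega))
    have h2 : K.dt * (K.da * (K.a * (K.t * S))) = S := by
      simp [K.rels_assoc, h.da_mul, h.dt_mul]
    rw [← h2, h1, mul_zero, mul_zero]

lemma eq_zero_of_right_lt (h : K.Inv p q S) (hp : p < 0) : S = 0 :=
  K.eq_zero_of_mul_num h.mul_num (.inl hp)

lemma sub {T : 𝔅} (h : K.Inv p q S) (h' : K.Inv p q T) : K.Inv p q (S - T) where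
  gen_comm i j := (h.gen_comm i j).sub_right (h'.gen_comm i j)
  da_mul := by rw [mul_sub, h.da_mul, h'.da_mul, sub_zero]
  dt_mul := by rw [mul_sub, h.dt_mul, h'.dt_mul, sub_zero]
  mul_a := by rw [sub_mul, h.mul_a, h'.mul_a, sub_zero]
  mul_t := by rw [sub_mul, h.mul_t, h'.mul_t, sub_zero]
  num_mul := by rw [mul_sub, h.num_mul, h'.num_mul, smul_sub]
  mul_num := by rw [sub_mul, h.mul_num, h'.mul_num, smul_sub]

lemma smul (h : K.Inv p q S) (c : ℂ) : K.Inv p q (c • S) where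
  gen_comm i j := (h.gen_comm i j).smul_right c
  da_mul := by rw [mul_smul_comm, h.da_mul, smul_zero]
  dt_mul := by rw [mul_smul_comm, h.dt_mul, smul_zero]
  mul_a := by rw [smul_mul_assoc, h.mul_a, smul_zero]
  mul_t := by rw [smul_mul_assoc, h.mul_t, smul_zero]
  num_mul := by rw [mul_smul_comm, h.num_mul, smul_comm]
  mul_num := by rw [smul_mul_assoc, h.mul_num, smul_comm]

lemma sum_sandwich (h : K.Inv p q S) {r s : ℤ} {X Y : ι → 𝔅} {c : ι → ℂ}
    (hc : ∀ i j, Commute (K.gen i j) (∑ k, c k • (X k * S * Y k)))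
    (h1 : ∀ k, X k * K.da = -(K.da * X k)) (h2 : ∀ k, X k * K.dt = -(K.dt * X k))
    (h3 : ∀ k, Y k * K.a = -(K.a * Y k)) (h4 : ∀ k, Y k * K.t = -(K.t * Y k))
    (h5 : ∀ k, K.Deg r (X k)) (h6 : ∀ k, K.Deg s (Y k)) :
    K.Inv (p - s) (r + q) (∑ k, c k • (X k * S * Y k)) where
  gen_comm := hc
  da_mul := by
    rw [Finset.mul_sum, Finset.sum_eq_zero fun k _ => ?_]
    rw [mul_smul_comm, ← mul_assoc, ← mul_assoc, ← neg_neg (K.da * X k), ← h1, neg_mul, mul_assoc,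
      h.da_mul, mul_zero, neg_zero, zero_mul, smul_zero]
  dt_mul := by
    rw [Finset.mul_sum, Finset.sum_eq_zero fun k _ => ?_]
    rw [mul_smul_comm, ← mul_assoc, ← mul_assoc, ← neg_neg (K.dt * X k), ← h2, neg_mul, mul_assoc,
      h.dt_mul, mul_zero, neg_zero, zero_mul, smul_zero]
  mul_a := by
    rw [Finset.sum_mul, Finset.sum_eq_zero fun k _ => ?_]
    rw [smul_mul_assoc, mul_assoc, h3, mul_neg, mul_assoc, ← mul_assoc S, h.mul_a, zero_mul,
      mul_zero, neg_zero, smul_zero]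
  mul_t := by
    rw [Finset.sum_mul, Finset.sum_eq_zero fun k _ => ?_]
    rw [smul_mul_assoc, mul_assoc, h4, mul_neg, mul_assoc, ← mul_assoc S, h.mul_t, zero_mul,
      mul_zero, neg_zero, smul_zero]
  num_mul := by
    rw [Finset.mul_sum, Finset.smul_sum]
    refine Finset.sum_congr rfl fun k _ => ?_
    rw [mul_smul_comm, ← mul_assoc, (h5 k).num_mul h.num_mul, smul_comm, smul_mul_assoc]
  mul_num := by
    rw [Finset.sum_mul, Finset.smul_sum]
    refine Finset.sum_congr rfl fun k _ => ?_
    rw [smul_mul_assoc, mul_assoc, mul_assoc, ← mul_assoc S, (h6 k).mul_num h.mul_num,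
      mul_smul_comm, smul_comm, mul_assoc]

lemma theta (h : K.Inv p q S) : K.Inv (p - 1) (q - 1) (K.theta S) := by
  rw [sub_eq_neg_add q, theta_eq]
  refine h.sum_sandwich (K.isVec_d.commute_sum K.isVec_z h.gen_comm) ?_ ?_ ?_ ?_
    (fun k => (K.deg_d _).smul _) fun k => K.deg_z _ <;> simp [K.rels]

lemma psi (h : K.Inv p q S) : K.Inv (p + 1) (q - 1) (K.psi S) := by
  rw [sub_eq_neg_add q, psi_eq, ← sub_neg_eq_add]
  refine h.sum_sandwich (K.isVec_d.commute_sum K.isVec_d h.gen_comm) ?_ ?_ ?_ ?_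
    (fun k => (K.deg_d _).smul _) (fun k => (K.deg_d _).smul _) <;> simp [K.rels]

lemma F_mul (h : K.Inv p q S) : K.Inv p (q - 2) (K.F * S) where
  gen_comm i j := (K.gen_F i j).mul_right (h.gen_comm i j)
  da_mul := by rw [← mul_assoc, ← K.F_da.eq, mul_assoc, h.da_mul, mul_zero]
  dt_mul := by rw [← mul_assoc, ← K.F_dt.eq, mul_assoc, h.dt_mul, mul_zero]
  mul_a := by rw [mul_assoc, h.mul_a, mul_zero]
  mul_t := by rw [mul_assoc, h.mul_t, mul_zero]
  num_mul := by rw [K.deg_F.num_mul h.num_mul, sub_eq_neg_add]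
  mul_num := by rw [mul_assoc, h.mul_num, mul_smul_comm]

lemma E_mul (h : K.Inv p q S) : K.Inv p (q + 2) (K.E * S) where
  gen_comm i j := (K.gen_E i j).mul_right (h.gen_comm i j)
  da_mul := by rw [← mul_assoc, ← K.E_da.eq, mul_assoc, h.da_mul, mul_zero]
  dt_mul := by rw [← mul_assoc, ← K.E_dt.eq, mul_assoc, h.dt_mul, mul_zero]
  mul_a := by rw [mul_assoc, h.mul_a, mul_zero]
  mul_t := by rw [mul_assoc, h.mul_t, mul_zero]
  num_mul := by rw [K.deg_E.num_mul h.num_mul, add_comm]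
  mul_num := by rw [mul_assoc, h.mul_num, mul_smul_comm]

variable (K) in
lemma proj_P (p : ℤ) : K.Inv p p (K.proj p * K.P) where
  gen_comm i j := (K.gen_proj i j p).mul_right (K.gen_P i j)
  da_mul := by rw [← (K.P_proj p).eq, ← mul_assoc, K.da_P, zero_mul]
  dt_mul := by rw [← (K.P_proj p).eq, ← mul_assoc, K.dt_P, zero_mul]
  mul_a := by rw [mul_assoc, K.P_a, mul_zero]
  mul_t := by rw [mul_assoc, K.P_t, mul_zero]
  num_mul := by rw [← mul_assoc, K.num_proj, smul_mul_assoc]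
  mul_num := by rw [mul_assoc, K.P_num.eq, ← mul_assoc, K.proj_num, smul_mul_assoc]

variable (K) in
lemma E_pow_proj_P (p : ℤ) (k : ℕ) : K.Inv p (p + 2 * k) (K.E ^ k * (K.proj p * K.P)) := by
  induction k with
  | zero => simpa using proj_P K p
  | succ k ih =>
    rw [pow_succ', mul_assoc]
    convert ih.E_mul using 1
    push_cast; ring

lemma eq_zero_of_mul_z (h : K.Inv p q S) (hp : p ≠ 0) (hz : ∀ i, S * K.z i = 0) : S = 0 := by
  have h1 := h.mul_numM
  simp only [numM, Finset.mul_sum, ← mul_assoc, hz, zero_mul, Finset.sum_const_zero] at h1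
  exact (smul_eq_zero.1 h1.symm).resolve_left (by exact_mod_cast hp)

end Inv

/-! ### The Capelli identity -/

variable (K)
lemma sum_dz : ∑ i, K.d i * K.z i = (Fintype.card ι : ℂ) • 1 - K.numM := by
  simp [K.dz, numM, Finset.sum_sub_distrib, Nat.cast_smul_eq_nsmul]

lemma capelli_left (S : 𝔅) : ∑ j, ∑ i, K.z j * K.d i * (K.z i * K.d j * S)
    = ((Fintype.card ι + 1 : ℂ) • 1 - K.numM) * (K.numM * S) := by
  have h : ∀ j, ∑ i, K.z j * K.d i * (K.z i * K.d j * S)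
      = ((Fintype.card ι + 1 : ℂ) • 1 - K.numM) * (K.z j * K.d j * S) := fun j => by
    have : ∑ i, K.z j * K.d i * (K.z i * K.d j * S)
        = K.z j * (∑ i, K.d i * K.z i) * (K.d j * S) := by
      simp only [Finset.mul_sum, Finset.sum_mul, mul_assoc]
    rw [this, K.sum_dz, mul_sub, mul_smul_comm, mul_one, sub_mul, sub_mul, add_smul, add_mul,
      ← mul_assoc K.numM, ← mul_assoc K.numM, K.numM_z]
    simp only [smul_mul_assoc, one_mul, one_smul, add_mul, mul_assoc]
    abel
  simp only [h, ← Finset.mul_sum, ← Finset.sum_mul, numM]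

lemma capelli_left_bar (S : 𝔅) :
    ∑ j, ∑ i, (K.sgn i * K.sgn j) • (K.z j * K.d i * (K.z (K.bar j) * K.d (K.bar i) * S))
    = -(K.numM * S) + (4 : ℂ) • (K.E * (K.F * S)) := by
  have h : ∀ i j, (K.sgn i * K.sgn j) • (K.z j * K.d i * (K.z (K.bar j) * K.d (K.bar i) * S))
      = (if K.bar j = i then -(K.z j * K.d j * S) else 0)
        - (K.sgn j • (K.z j * K.z (K.bar j))) * (K.sgn i • (K.d i * K.d (K.bar i))) * S := by
    intro i j
    have e : K.z j * K.d i * (K.z (K.bar j) * K.d (K.bar i) * S)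
        = K.z j * (K.d i * K.z (K.bar j)) * (K.d (K.bar i) * S) := by noncomm_ring
    rw [e, K.dz, mul_sub, sub_mul, smul_sub]
    congr 1
    · by_cases hi : K.bar j = i
      · subst hi
        simp [K.sgn_bar, K.bar_bar, K.sgn_mul_self, mul_assoc]
      · simp [hi, Ne.symm hi]
    · simp only [smul_mul_assoc, mul_smul_comm, smul_smul, mul_assoc]
  have hF : ∑ i, K.sgn i • (K.d i * K.d (K.bar i)) = (-2 : ℂ) • K.F := by
    rw [F, smul_smul, ← K.sum_bar]
    simp [K.sgn_bar, K.bar_bar]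
  have hE : ∑ j, K.sgn j • (K.z j * K.z (K.bar j)) = (2 : ℂ) • K.E := by
    rw [E, smul_smul]
    simp
  simp only [h, Finset.sum_sub_distrib, Finset.sum_ite_eq, Finset.mem_univ, if_true,
    ← Finset.sum_mul, ← Finset.mul_sum, Finset.sum_neg_distrib, hF, hE]
  rw [← numM]
  simp only [smul_mul_assoc, mul_smul_comm, smul_smul, mul_assoc, sub_eq_add_neg, ← neg_smul]
  norm_num

lemma capelli_right (S : 𝔅) : ∑ j, ∑ i, K.z j * K.d i * (S * (K.z i * K.d j))
    = ∑ j, K.z j * K.theta S * K.d j := by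
  simp only [theta, Finset.mul_sum, Finset.sum_mul, mul_assoc]

lemma capelli_right_bar (S : 𝔅) :
    ∑ j, ∑ i, (K.sgn i * K.sgn j) • (K.z j * K.d i * (S * (K.z (K.bar j) * K.d (K.bar i))))
    = K.numM * S - ∑ j, K.sgn j • (K.z j * K.psi S * K.z (K.bar j)) := by
  have h : ∀ i j, (K.sgn i * K.sgn j) • (K.z j * K.d i * (S * (K.z (K.bar j) * K.d (K.bar i))))
      = (if j = i then K.z j * K.d j * S else 0)
        - K.sgn j • (K.z j * (K.sgn i • (K.d i * S * K.d (K.bar i))) * K.z (K.bar j)) := by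
    intro i j
    have e : K.z (K.bar j) * K.d (K.bar i) =
        (if j = i then 1 else 0) - K.d (K.bar i) * K.z (K.bar j) := by
      rw [K.dz]
      simp only [K.bar_inj, eq_comm (a := i)]
      abel
    rw [e, mul_sub, mul_sub, smul_sub]
    congr 1
    · by_cases hi : j = i
      · subst hi
        simp [K.sgn_mul_self]
      · simp [hi]
    · simp only [smul_mul_assoc, mul_smul_comm, smul_smul, mul_assoc, mul_comm]
  simp only [h, Finset.sum_sub_distrib, Finset.sum_ite_eq, Finset.mem_univ, if_true,
    ← Finset.sum_mul, ← Finset.mul_sum, ← Finset.smul_sum, psi, numM]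

lemma capelli {S : 𝔅} (hS : ∀ i j, Commute (K.gen i j) S) :
    ((Fintype.card ι + 3 : ℂ) • 1 - K.numM) * (K.numM * S)
      = (4 : ℂ) • (K.E * (K.F * S)) + ∑ j, K.z j * K.theta S * K.d j
        + ∑ j, K.sgn j • (K.z j * K.psi S * K.z (K.bar j)) := by
  have h : ∀ i j, K.z j * K.d i * (K.z i * K.d j * S)
      - (K.sgn i * K.sgn j) • (K.z j * K.d i * (K.z (K.bar j) * K.d (K.bar i) * S))
      = K.z j * K.d i * (S * (K.z i * K.d j))
      - (K.sgn i * K.sgn j) • (K.z j * K.d i * (S * (K.z (K.bar j) * K.d (K.bar i)))) := by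
    intro i j
    have := congrArg (fun x => K.z j * K.d i * x) (hS i j).eq
    simpa only [gen, sub_mul, mul_sub, smul_mul_assoc, mul_smul_comm] using this
  have h2 := Finset.sum_congr rfl fun j (_ : j ∈ Finset.univ) =>
    Finset.sum_congr rfl fun i (_ : i ∈ Finset.univ) => h i j
  simp only [Finset.sum_sub_distrib, K.capelli_left, K.capelli_left_bar, K.capelli_right,
    K.capelli_right_bar] at h2
  rw [show (Fintype.card ι + 3 : ℂ) = (Fintype.card ι + 1) + 2 by ring, add_smul, add_sub_right_comm,
    add_mul, sub_eq_iff_eq_add.1 h2, smul_mul_assoc, one_mul, two_smul]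
  abel

/-! ### Classification of invariant operators -/

lemma proj_zero_P : K.proj 0 * K.P = K.proj 0 := by
  have h1 : K.proj 0 * K.a = 0 := by
    simpa [K.proj_eq_zero (p := -1)] using (K.deg_a.mul_proj (-1)).symm
  have h2 : K.proj 0 * K.t = 0 := by
    simpa [K.proj_eq_zero (p := -1)] using (K.deg_t.mul_proj (-1)).symm
  rw [P_eq, mul_sub, mul_sub, mul_sub, ← mul_assoc, ← mul_assoc, ← mul_assoc, h1, h2]
  simp

lemma sum_sgn_psi_of_mul_z {S : 𝔅} (h : ∀ i, S * K.z i = 0) :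
    ∑ j, K.sgn j • (K.z j * K.psi S * K.z (K.bar j)) = K.numM * S := by
  have : ∀ j, K.psi S * K.z (K.bar j) = K.sgn j • (K.d j * S) := fun j => by
    have e : ∀ i, K.sgn i • (K.d i * S * K.d (K.bar i)) * K.z (K.bar j)
        = if i = j then K.sgn i • (K.d i * S) else 0 := fun i => by
      rw [smul_mul_assoc, mul_assoc (K.d i * S), K.dz, mul_sub, ← mul_assoc (K.d i * S),
        mul_assoc (K.d i) S (K.z _), h]
      simp only [K.bar_inj]
      split_ifs <;> simp
    simp [psi, Finset.sum_mul, e]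
  simp [mul_assoc, this, smul_smul, K.sgn_mul_self, numM, Finset.sum_mul]

variable {K}
namespace Inv
variable {p q : ℤ} {S : 𝔅}

lemma eq_of_zero (hS : K.Inv 0 q S) :
    S = 0 ∨ ∃ (k : ℕ) (c : ℂ), q = 2 * k ∧ S = c • (K.E ^ k * (K.proj 0 * K.P)) := by
  by_cases hq : q < 0 ∨ (Fintype.card ι : ℤ) < q
  · exact .inl (hS.eq_zero_of_lt hq)
  lift q to ℕ using by omega
  induction q using Nat.strong_induction_on generalizing S with
  | _ q ih =>
  by_cases hq0 : q = 0
  · subst hq0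
    obtain ⟨c, hc⟩ := K.vac S
    refine .inr ⟨0, c, by simp, ?_⟩
    rw [K.proj_mul_of_num_mul hS.num_mul, if_pos (by simp),
      K.mul_proj_of_mul_num hS.mul_num, if_pos rfl] at hc
    rw [hc, pow_zero, one_mul, proj_zero_P]
  have hz : ∀ i, S * K.z i = 0 := fun i =>
    K.eq_zero_of_mul_num ((K.deg_z i).mul_num hS.mul_num) (by simp)
  have hcap := K.capelli hS.gen_comm
  have hθ : K.theta S = 0 := by simp [Fock.theta, mul_assoc, hz]
  rw [K.sum_sgn_psi_of_mul_z hz, hθ, hS.numM_mul, mul_smul_comm, sub_mul, smul_mul_assoc, one_mul,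
    hS.numM_mul] at hcap
  simp only [mul_zero, zero_mul, Finset.sum_const_zero, add_zero] at hcap
  have hcoef : ((q : ℂ) * (Fintype.card ι + 2 - q)) ≠ 0 := by
    refine mul_ne_zero (by exact_mod_cast hq0) ?_
    have : (Fintype.card ι + 2 - q : ℤ) ≠ 0 := by omega
    exact_mod_cast this
  have hSE : S = (4 / ((q : ℂ) * (Fintype.card ι + 2 - q))) • (K.E * (K.F * S)) := by
    have : ((q : ℂ) * (Fintype.card ι + 2 - q)) • S = (4 : ℂ) • (K.E * (K.F * S)) := by
      rw [← sub_eq_iff_eq_add] at hcap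
      rw [← hcap]
      simp only [smul_sub, smul_smul, mul_sub, sub_smul, mul_add, add_smul, Int.cast_natCast]
      module
    rw [div_eq_inv_mul, mul_smul, ← this, smul_smul, inv_mul_cancel₀ hcoef, one_smul]
  by_cases hq2 : q < 2
  · have : K.F * S = 0 := hS.F_mul.eq_zero_of_lt (by omega)
    rw [this, mul_zero, smul_zero] at hSE
    exact .inl hSE
  · have hFS := hS.F_mul
    rw [show (q : ℤ) - 2 = ((q - 2 : ℕ) : ℤ) by omega] at hFS
    rcases ih (q - 2) (by omega) hFS (by omega) with h0 | ⟨k, c, hk, hc⟩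
    · rw [h0, mul_zero, smul_zero] at hSE
      exact .inl hSE
    · refine .inr ⟨k + 1, (4 / ((q : ℂ) * (Fintype.card ι + 2 - q))) * c, by push_cast; omega, ?_⟩
      rw [hSE, hc, pow_succ', mul_smul_comm, smul_smul, mul_assoc]

lemma eq_of_anti_z (hS : K.Inv p q S) (hz : ∀ i j, K.z i * S * K.z j = -(K.z j * S * K.z i)) :
    S = 0 ∨ ∃ (k : ℕ) (c : ℂ), q = p + 2 * k ∧ S = c • (K.E ^ k * (K.proj p * K.P)) := by
  by_cases hp : p < 0
  · exact .inl (hS.eq_zero_of_right_lt hp)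
  lift p to ℕ using by omega
  induction p generalizing S q with
  | zero => simpa using hS.eq_of_zero
  | succ p ih =>
  by_cases hq : q < 0 ∨ (Fintype.card ι : ℤ) < q
  · exact .inl (hS.eq_zero_of_lt hq)
  have hcoef : (Fintype.card ι + 1 - q : ℂ) ≠ 0 := by
    have : (Fintype.card ι + 1 - q : ℤ) ≠ 0 := by omega
    exact_mod_cast this
  have key : ∀ w, (Fintype.card ι + 1 - q : ℂ) • (S * K.z w) = K.z w * K.theta S := fun w => by
    have h1 : (∑ i, K.d i * K.z i) * (S * K.z w) = -∑ i, K.d i * K.z w * (S * K.z i) := by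
      rw [Finset.sum_mul, ← Finset.sum_neg_distrib]
      refine Finset.sum_congr rfl fun i _ => ?_
      have := congrArg (K.d i * ·) (hz i w)
      simpa only [mul_neg, mul_assoc] using this
    have h2 : ∑ i, K.d i * K.z w * (S * K.z i) = S * K.z w - K.z w * K.theta S := by
      simp only [K.dz, sub_mul, Finset.sum_sub_distrib, ite_mul, one_mul, zero_mul,
        Finset.sum_ite_eq', Finset.mem_univ, if_true, Fock.theta, Finset.mul_sum, mul_assoc]
    rw [K.sum_dz, sub_mul, smul_mul_assoc, one_mul, ← mul_assoc, hS.numM_mul, h2,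
      smul_mul_assoc] at h1
    rw [sub_smul, add_smul, one_smul, add_sub_right_comm, h1]
    abel
  have hθ := hS.theta
  rw [show ((p + 1 : ℕ) : ℤ) - 1 = p by push_cast; ring] at hθ
  have hθz : ∀ i j, K.z i * K.theta S * K.z j = -(K.z j * K.theta S * K.z i) := fun i j => by
    rw [← key, ← key, smul_mul_assoc, smul_mul_assoc, mul_assoc, mul_assoc, K.zz i j, mul_neg,
      smul_neg]
  have hz0 : K.theta S = 0 → S = 0 := fun h0 => by
    refine hS.eq_zero_of_mul_z (by omega) fun w => ?_
    have := key w
    rw [h0, mul_zero] at this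
    exact (smul_eq_zero.1 this).resolve_left hcoef
  rcases ih hθz hθ (by omega) with h0 | ⟨k, c, hk, hc⟩
  · exact .inl (hz0 h0)
  · refine .inr ⟨k, (Fintype.card ι + 1 - q : ℂ)⁻¹ * c, by push_cast; omega, ?_⟩
    have hI := (E_pow_proj_P K (p + 1 : ℕ) k).smul ((Fintype.card ι + 1 - q : ℂ)⁻¹ * c)
    rw [show ((p + 1 : ℕ) : ℤ) + 2 * k = q by push_cast; omega] at hI
    rw [← sub_eq_zero]
    refine (hS.sub hI).eq_zero_of_mul_z (by omega) fun w => ?_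
    have h1 : K.E ^ k * (K.proj (p + 1 : ℕ) * K.P) * K.z w
        = K.z w * (K.E ^ k * (K.proj p * K.P)) := by
      have h2 := (K.deg_z w).mul_proj p
      rw [← mul_assoc, ← mul_assoc, ← ((K.E_z w).pow_left k).eq, mul_assoc, (K.P_z w).eq,
        mul_assoc, mul_assoc, ← mul_assoc _ (K.z w), ← mul_assoc (K.z w) _ K.P, h2]
      push_cast; rfl
    rw [sub_mul, smul_mul_assoc, h1, mul_smul, ← mul_smul_comm, ← hc, ← key, smul_smul,
      inv_mul_cancel₀ hcoef, one_smul, sub_self]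

lemma eq_of_anti_d (hS : K.Inv p q S) (hd : ∀ i j, K.d i * S * K.d j = -(K.d j * S * K.d i)) :
    S = 0 ∨ ∃ (k : ℕ) (c : ℂ), p = q + 2 * k ∧ S = c • (K.F ^ k * (K.proj p * K.P)) := by
  have hd' : ∀ i j, K.op.z i * .op S * K.op.z j = -(K.op.z j * .op S * K.op.z i) := fun i j => by
    rw [op_z, op_z, ← MulOpposite.op_mul, ← MulOpposite.op_mul, ← MulOpposite.op_mul,
      ← MulOpposite.op_mul, ← mul_assoc, hd, MulOpposite.op_neg, mul_assoc]
  rcases hS.op.eq_of_anti_z hd' with h | ⟨k, c, hk, hc⟩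
  · exact .inl (MulOpposite.op_injective h)
  · refine .inr ⟨k, c, hk, MulOpposite.op_injective ?_⟩
    rw [hc, op_E, op_proj, op_P, ← MulOpposite.op_mul, ← MulOpposite.op_pow, ← MulOpposite.op_mul,
      ← MulOpposite.op_smul]
    congr 2
    have h1 := (K.deg_F.pow k).mul_proj p
    rw [show p + k * -2 = q by rw [hk]; ring] at h1
    rw [← mul_assoc, h1, (K.P_proj q).eq, mul_assoc, (K.P_F.pow_right k).eq, mul_assoc]

end Inv

/-! ### The first fundamental theorem -/

variable (K)
/-- The span of the operators `E^i F^j` on `p`-particle states of the symplectic modes. -/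
def EFspan (p : ℤ) : Submodule ℂ 𝔅 :=
  Submodule.span ℂ (Set.range fun x : ℕ × ℕ => K.E ^ x.1 * (K.F ^ x.2 * (K.proj p * K.P)))

variable {K} in
lemma mem_EFspan {p : ℤ} (i j : ℕ) : K.E ^ i * (K.F ^ j * (K.proj p * K.P)) ∈ K.EFspan p :=
  Submodule.subset_span ⟨(i, j), rfl⟩

/-- A linear map sends one span of the operators `E^i F^j` to another if it does so on generators. -/
lemma map_mem_EFspan {p p' : ℤ} (Φ : 𝔅 →ₗ[ℂ] 𝔅)
    (h : ∀ i j, Φ (K.E ^ i * (K.F ^ j * (K.proj p * K.P))) ∈ K.EFspan p') {S : 𝔅}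
    (hS : S ∈ K.EFspan p) : Φ S ∈ K.EFspan p' := by
  have : K.EFspan p ≤ (K.EFspan p').comap Φ := by
    rw [EFspan, Submodule.span_le]
    rintro _ ⟨x, rfl⟩
    exact h x.1 x.2
  exact this hS

lemma numM_F_pow (j : ℕ) : K.numM * K.F ^ j = K.F ^ j * K.numM - (2 * j : ℂ) • K.F ^ j := by
  have h1 := K.deg_F.pow j
  simp only [Deg, num_eq_numM] at h1
  have h2 : Commute (K.a * K.da + K.t * K.dt) (K.F ^ j) :=
    (((K.F_a.mul_right K.F_da).add_right (K.F_t.mul_right K.F_dt)).pow_left j).symm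
  rw [add_assoc, add_mul, mul_add, h2.eq] at h1
  push_cast at h1
  have h3 : K.numM * K.F ^ j = K.F ^ j * K.numM + ((j : ℂ) * -2) • K.F ^ j :=
    add_right_cancel (h1.trans (by abel))
  rw [h3, sub_eq_add_neg, ← neg_smul]
  congr 2; ring

lemma numM_proj_P (p : ℤ) : K.numM * (K.proj p * K.P) = (p : ℂ) • (K.proj p * K.P) :=
  (Inv.proj_P K p).numM_mul

lemma numM_F_pow_proj_P (p : ℤ) (j : ℕ) : K.numM * (K.F ^ j * (K.proj p * K.P))
    = (p - 2 * j : ℂ) • (K.F ^ j * (K.proj p * K.P)) := by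
  rw [← mul_assoc, numM_F_pow, sub_mul, mul_assoc, numM_proj_P, mul_smul_comm, sub_smul,
    smul_mul_assoc]

lemma F_z (j : ι) : K.F * K.z (K.bar j) = K.z (K.bar j) * K.F - K.sgn j • K.d j := by
  have h : ∀ i, K.d (K.bar i) * K.d i * K.z (K.bar j) = K.z (K.bar j) * (K.d (K.bar i) * K.d i)
      + ((if i = K.bar j then K.d (K.bar i) else 0) - (if i = j then K.d i else 0)) := fun i => by
    rw [mul_assoc, K.dz, mul_sub, ← mul_assoc, K.dz, sub_mul]
    simp only [K.bar_inj]
    split_ifs <;> simp [mul_assoc] <;> abel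
  simp only [F, smul_mul_assoc, mul_smul_comm, Finset.sum_mul, Finset.mul_sum, h, smul_add,
    Finset.sum_add_distrib, smul_sub, Finset.sum_sub_distrib, smul_ite, smul_zero,
    Finset.sum_ite_eq', Finset.mem_univ, if_true, K.bar_bar, K.sgn_bar]
  module

lemma F_pow_z (j : ι) (m : ℕ) : K.F ^ m * K.z (K.bar j)
    = K.z (K.bar j) * K.F ^ m - (m * K.sgn j) • (K.d j * K.F ^ (m - 1)) := by
  induction m with
  | zero => simp
  | succ m ih =>
    rw [pow_succ', mul_assoc, ih, mul_sub, ← mul_assoc, F_z, sub_mul, mul_assoc, ← pow_succ',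
      mul_smul_comm, ← mul_assoc, (K.F_d j).eq, mul_assoc, ← pow_succ']
    rcases m with _ | m
    · simp
    · simp only [Nat.add_sub_cancel, smul_mul_assoc]
      push_cast
      module

lemma sum_z_mul_d_mem {p : ℤ} {S : 𝔅} (hS : S ∈ K.EFspan (p - 1)) :
    ∑ k, K.z k * S * K.d k ∈ K.EFspan p := by
  let Φ : 𝔅 →ₗ[ℂ] 𝔅 := ∑ k, LinearMap.mulLeft ℂ (K.z k) ∘ₗ LinearMap.mulRight ℂ (K.d k)
  have hΦ : ∀ S, Φ S = ∑ k, K.z k * S * K.d k := fun S => by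
    simp [Φ, LinearMap.sum_apply, mul_assoc]
  rw [← hΦ]
  refine K.map_mem_EFspan Φ (fun i j => ?_) hS
  have h : ∀ k, K.z k * (K.E ^ i * (K.F ^ j * (K.proj (p - 1) * K.P))) * K.d k
      = K.E ^ i * (K.z k * K.d k * (K.F ^ j * (K.proj p * K.P))) := fun k => by
    have h2 := (K.deg_d k).mul_proj p
    rw [← mul_assoc, ← ((K.E_z k).pow_left i).eq]
    simp only [mul_assoc]
    rw [(K.P_d k).eq, ← mul_assoc (K.proj _), ← mul_assoc (K.d k), ← ((K.F_d k).pow_left j).eq,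
      mul_assoc (K.F ^ j), ← mul_assoc (K.d k), h2, sub_eq_add_neg]
  simp only [hΦ, h, ← Finset.mul_sum, ← Finset.sum_mul]
  rw [← numM, numM_F_pow_proj_P, mul_smul_comm]
  exact Submodule.smul_mem _ _ (mem_EFspan i j)

lemma sum_z_mul_z_mem {p : ℤ} {S : 𝔅} (hS : S ∈ K.EFspan (p + 1)) :
    ∑ k, K.sgn k • (K.z k * S * K.z (K.bar k)) ∈ K.EFspan p := by
  let Φ : 𝔅 →ₗ[ℂ] 𝔅 := ∑ k, K.sgn k •
    (LinearMap.mulLeft ℂ (K.z k) ∘ₗ LinearMap.mulRight ℂ (K.z (K.bar k)))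
  have hΦ : ∀ S, Φ S = ∑ k, K.sgn k • (K.z k * S * K.z (K.bar k)) := fun S => by
    simp [Φ, LinearMap.sum_apply, mul_assoc]
  rw [← hΦ]
  refine K.map_mem_EFspan Φ (fun i j => ?_) hS
  have h : ∀ k, K.sgn k • (K.z k * (K.E ^ i * (K.F ^ j * (K.proj (p + 1) * K.P))) * K.z (K.bar k))
      = K.E ^ i * ((K.sgn k • (K.z k * K.z (K.bar k))) * (K.F ^ j * (K.proj p * K.P)))
        - (j : ℂ) • (K.E ^ i * (K.z k * K.d k * (K.F ^ (j - 1) * (K.proj p * K.P)))) := fun k => by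
    have h2 := (K.deg_z (K.bar k)).mul_proj p
    rw [← mul_assoc, ← ((K.E_z k).pow_left i).eq]
    simp only [mul_assoc]
    rw [(K.P_z _).eq, ← mul_assoc (K.proj _), ← h2, mul_assoc, ← mul_assoc (K.F ^ j), F_pow_z]
    simp only [sub_mul, mul_sub, smul_sub, mul_smul_comm, smul_mul_assoc, smul_smul, mul_assoc]
    rw [mul_left_comm (K.sgn k), K.sgn_mul_self, mul_one]
  simp only [hΦ, h, Finset.sum_sub_distrib, ← Finset.mul_sum, ← Finset.sum_mul, ← Finset.smul_sum]
  have hE : ∑ j, K.sgn j • (K.z j * K.z (K.bar j)) = (2 : ℂ) • K.E := by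
    rw [E, smul_smul]
    simp
  rw [← numM, numM_F_pow_proj_P, hE, smul_mul_assoc, mul_smul_comm, ← mul_assoc, ← pow_succ,
    mul_smul_comm]
  exact Submodule.sub_mem _ (Submodule.smul_mem _ _ (mem_EFspan _ j))
    (Submodule.smul_mem _ _ (Submodule.smul_mem _ _ (mem_EFspan _ _)))

variable {K} in
lemma Inv.mem_EFspan {p q : ℤ} {S : 𝔅} (hS : K.Inv p q S) : S ∈ K.EFspan p := by
  by_cases hq : q < 0 ∨ (Fintype.card ι : ℤ) < q
  · rw [hS.eq_zero_of_lt hq]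
    exact Submodule.zero_mem _
  lift q to ℕ using by omega
  induction q using Nat.strong_induction_on generalizing S p with
  | _ q ih =>
  by_cases hq0 : q = 0
  · subst hq0
    have hd : ∀ i, K.d i * S = 0 := fun i =>
      K.eq_zero_of_num_mul ((K.deg_d i).num_mul hS.num_mul) (by simp)
    rcases hS.eq_of_anti_d (by simp [hd]) with h0 | ⟨k, c, -, hc⟩
    · rw [h0]
      exact Submodule.zero_mem _
    · rw [hc]
      refine Submodule.smul_mem _ _ ?_
      simpa using Fock.mem_EFspan (K := K) (p := p) 0 k
  have ih' : ∀ {p q' : ℤ} {S : 𝔅}, K.Inv p q' S → q' < q → S ∈ K.EFspan p := by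
    intro p q' S h hlt
    by_cases hq' : q' < 0
    · rw [h.eq_zero_of_lt (.inl hq')]
      exact Submodule.zero_mem _
    · lift q' to ℕ using by omega
      exact ih q' (by omega) h (by omega)
  have hcoef : ((q : ℂ) * (Fintype.card ι + 3 - q)) ≠ 0 := by
    refine mul_ne_zero (by exact_mod_cast hq0) ?_
    have : (Fintype.card ι + 3 - q : ℤ) ≠ 0 := by omega
    exact_mod_cast this
  rw [← Submodule.smul_mem_iff _ hcoef]
  have hcap := K.capelli hS.gen_comm
  rw [hS.numM_mul, mul_smul_comm, sub_mul, smul_mul_assoc, one_mul, hS.numM_mul, ← sub_smul,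
    smul_smul, Int.cast_natCast] at hcap
  rw [hcap]
  refine Submodule.add_mem _ (Submodule.add_mem _ (Submodule.smul_mem _ _ ?_) ?_) ?_
  · refine K.map_mem_EFspan (LinearMap.mulLeft ℂ K.E) (fun i j => ?_) (ih' hS.F_mul (by omega))
    rw [LinearMap.mulLeft_apply, ← mul_assoc, ← pow_succ']
    exact Fock.mem_EFspan _ _
  · exact K.sum_z_mul_d_mem (ih' hS.theta (by omega))
  · exact K.sum_z_mul_z_mem (ih' hS.psi (by omega))

/-! ### The double commutant argument -/

/-- `X` commutes with the quadratic operators `gen`, `z dt`, `a d`, `a dt`. -/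
structure CommQuad (X : 𝔅) : Prop where
  gen : ∀ i j, Commute (K.gen i j) X
  z_dt : ∀ i, Commute (K.z i * K.dt) X
  a_d : ∀ i, Commute (K.a * K.d i) X
  a_dt : Commute (K.a * K.dt) X

variable {K} in
lemma CommQuad.sub {X Y : 𝔅} (hX : K.CommQuad X) (hY : K.CommQuad Y) : K.CommQuad (X - Y) :=
  ⟨fun i j => (hX.gen i j).sub_right (hY.gen i j), fun i => (hX.z_dt i).sub_right (hY.z_dt i),
    fun i => (hX.a_d i).sub_right (hY.a_d i), hX.a_dt.sub_right hY.a_dt⟩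

variable {K} in
protected lemma CommQuad.op {X : 𝔅} (hX : K.CommQuad X) : K.op.CommQuad (.op X) where
  gen i j := by rw [op_gen]; exact (hX.gen j i).op
  z_dt i := by rw [op_z, op_dt, ← MulOpposite.op_mul]; exact (hX.a_d i).op
  a_d i := by rw [op_d, op_a, ← MulOpposite.op_mul]; exact (hX.z_dt i).op
  a_dt := by rw [op_a, op_dt, ← MulOpposite.op_mul]; exact hX.a_dt.op

/-- A subalgebra of the commutant of the quadratic operators that contains the spectral projections
and the operators `a E^k`, `F^k dt`. -/
structure IsSymm (𝒜 : Subalgebra ℂ 𝔅) : Prop where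
  comm : ∀ X ∈ 𝒜, K.CommQuad X
  proj_mem : ∀ p, K.proj p ∈ 𝒜
  a_E_mem : ∀ k : ℕ, K.a * K.E ^ k ∈ 𝒜
  F_dt_mem : ∀ k : ℕ, K.F ^ k * K.dt ∈ 𝒜

variable {K} in
protected lemma IsSymm.op {𝒜 : Subalgebra ℂ 𝔅} (h : K.IsSymm 𝒜) : K.op.IsSymm 𝒜.op where
  comm X hX := (h.comm X.unop (Subalgebra.mem_op.1 hX)).op
  proj_mem p := Subalgebra.mem_op.2 (h.proj_mem p)
  a_E_mem k := Subalgebra.mem_op.2 (by simpa [op_a, op_E] using h.F_dt_mem k)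
  F_dt_mem k := Subalgebra.mem_op.2 (by simpa [op_dt, op_F] using h.a_E_mem k)

lemma P_eq_one_sub : (1 : 𝔅) = K.P + K.a * K.P * K.da + K.t * K.P * K.dt
    + K.a * K.t * K.P * (K.dt * K.da) := by
  simp only [P_eq, mul_assoc, K.rels, K.rels_assoc, mul_sub, sub_mul, mul_one, mul_neg,
    neg_mul, mul_zero, sub_zero, neg_zero]
  abel

lemma dt_t_P : K.dt * (K.t * K.P) = K.P := by
  rw [(K.rels_assoc _).1.2.2.2.2.2.2.2.1, K.dt_P, mul_zero, sub_zero]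

variable {K}
lemma CommQuad.eq_zero {X : 𝔅} (hX : K.CommQuad X) {m : ℤ} (hm : X * K.num = (m : ℂ) • X)
    (h1 : m ≠ 0) (h2 : m ≠ Fintype.card ι + 2) (h : X * K.t * K.P = 0) : X = 0 := by
  have h' : X * (K.t * K.P) = 0 := by rw [← mul_assoc, h]
  have hz : ∀ i, X * K.P * K.z i = 0 := fun i => by
    rw [mul_assoc, (K.P_z i).eq, ← K.dt_t_P, ← mul_assoc (K.z i), ← mul_assoc, ← (hX.z_dt i).eq,
      mul_assoc, h', mul_zero]
  have ha : X * K.a * K.P = 0 := by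
    rw [← K.dt_t_P, mul_assoc, ← mul_assoc K.a, ← mul_assoc, ← hX.a_dt.eq, mul_assoc, h', mul_zero]
  have hd : ∀ i, X * (K.a * K.t * K.P) * K.d i = 0 := fun i => by
    have e : X * (K.a * K.t * K.P) * K.d i = -(X * (K.a * K.d i) * (K.t * K.P)) := by
      simp only [mul_assoc]
      rw [(K.P_d i).eq, (K.rels_assoc _).2 i |>.2.2.2.2.2.1, mul_neg, mul_neg, neg_neg]
    rw [e, ← (hX.a_d i).eq, mul_assoc, h', mul_zero, neg_zero]
  have hPn : K.P * K.num = K.P * K.numM := by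
    rw [num_eq_numM, mul_add, mul_add, ← mul_assoc, ← mul_assoc, P_a, P_t]; simp
  have hP : X * K.P = 0 := by
    have e : (m : ℂ) • (X * K.P) = 0 := by
      rw [← smul_mul_assoc, ← hm, mul_assoc, ← K.P_num.eq, hPn, numM, ← mul_assoc, Finset.mul_sum]
      exact Finset.sum_eq_zero fun i _ => by rw [← mul_assoc, hz, zero_mul]
    exact (smul_eq_zero.1 e).resolve_left (by exact_mod_cast h1)
  have hatP : X * (K.a * K.t * K.P) = 0 := by
    have e1 : X * (K.a * K.t * K.P) * K.numM = ((m - 2 : ℤ) : ℂ) • (X * (K.a * K.t * K.P)) := by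
      have e := ((K.deg_a.mul K.deg_t).mul K.deg_P).mul_num hm
      rw [← mul_assoc X, mul_assoc, ← hPn, ← mul_assoc, mul_assoc X]
      exact e
    have e2 : X * (K.a * K.t * K.P) * ∑ i, K.d i * K.z i = 0 := by
      rw [Finset.mul_sum]
      exact Finset.sum_eq_zero fun i _ => by rw [← mul_assoc, hd, zero_mul]
    rw [sum_dz, mul_sub, e1, mul_smul_comm, mul_one, ← sub_smul] at e2
    refine (smul_eq_zero.1 e2).resolve_left ?_
    have : (Fintype.card ι - (m - 2) : ℤ) ≠ 0 := by omega
    exact_mod_cast this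
  rw [← mul_one X, K.P_eq_one_sub, mul_add, mul_add, mul_add, hP, ← mul_assoc X (_ * _),
    ← mul_assoc X (K.a), ha, ← mul_assoc X (_ * _), ← mul_assoc X (K.t), h, ← mul_assoc X (_ * _),
    hatP]
  simp

section Components

variable {p q : ℤ} {R : 𝔅}

lemma inv_of_quad {r : ℤ} (Y : 𝔅) (hg : ∀ i j, Commute (K.gen i j) R) (hRa : R * K.a = 0)
    (hRt : R * K.t = 0) (hn : K.num * R = (q : ℂ) • R) (hn' : R * K.num = (p : ℂ) • R)
    (hY : ∀ i j, Commute (K.gen i j) Y) (hda : K.da * Y = 0) (hdt : K.dt * Y = 0)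
    (hr : K.Deg r Y) : K.Inv p (r + q) (Y * R) where
  gen_comm i j := (hY i j).mul_right (hg i j)
  da_mul := by rw [← mul_assoc, hda, zero_mul]
  dt_mul := by rw [← mul_assoc, hdt, zero_mul]
  mul_a := by rw [mul_assoc, hRa, mul_zero]
  mul_t := by rw [mul_assoc, hRt, mul_zero]
  num_mul := hr.num_mul hn
  mul_num := by rw [mul_assoc, hn', mul_smul_comm]

end Components

lemma IsSymm.mem_of_num {𝒜 : Subalgebra ℂ 𝔅} (h𝒜 : K.IsSymm 𝒜) {T : 𝔅} (hT : K.CommQuad T)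
    {m m' : ℤ} (hm' : K.num * T = (m' : ℂ) • T) (hm : T * K.num = (m : ℂ) • T)
    (h1 : m ≠ 0) (h2 : m ≠ Fintype.card ι + 2) : T ∈ 𝒜 := by
  obtain ⟨R, hR⟩ : ∃ R, R = T * K.t * K.P := ⟨_, rfl⟩
  have hR' : R = T * (K.t * K.P) := by rw [hR, mul_assoc]
  have hg : ∀ i j, Commute (K.gen i j) R := fun i j => by
    rw [hR]; exact ((hT.gen i j).mul_right (K.gen_t i j)).mul_right (K.gen_P i j)
  have hRa : R * K.a = 0 := by rw [hR, mul_assoc, P_a, mul_zero]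
  have hRt : R * K.t = 0 := by rw [hR, mul_assoc, P_t, mul_zero]
  have hn : K.num * R = (m' : ℂ) • R := by rw [hR', ← mul_assoc, hm', smul_mul_assoc]
  have hn' : R * K.num = ((m - 1 : ℤ) : ℂ) • R := by
    rw [hR']; exact (K.deg_t.mul K.deg_P).mul_num hm
  have hz : ∀ i j, K.z i * (K.dt * R) * K.z j = -(K.z j * (K.dt * R) * K.z i) := by
    have e : ∀ i j, K.z i * (K.dt * R) * K.z j = T * (K.z i * K.z j) * K.P := fun i j => by
      rw [hR', ← mul_assoc, ← mul_assoc, (hT.z_dt i).eq, mul_assoc, mul_assoc, mul_assoc,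
        ← mul_assoc (K.dt), dt_t_P, (K.P_z j).eq, ← mul_assoc (K.z i), ← mul_assoc]
    intro i j
    rw [e, e, K.zz i j, mul_neg, neg_mul]
  have hd : ∀ i j, K.d i * (K.da * (K.a * R)) * K.d j
      = -(K.d j * (K.da * (K.a * R)) * K.d i) := by
    have e : ∀ i j, K.d i * (K.da * (K.a * R)) * K.d j
        = -(K.da * (T * (K.a * (K.t * (K.d i * K.d j)))) * K.P) := fun i j => by
      have e1 : K.d i * (K.da * (K.a * R)) * K.d j = K.da * (K.a * K.d i * R) * K.d j := by
        simp only [mul_assoc, K.rels_assoc, mul_neg, neg_neg, mul_sub, sub_mul]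
      rw [e1, hR', ← mul_assoc (K.a * K.d i), (hT.a_d i).eq]
      simp only [mul_assoc, (K.P_d j).eq]
      rw [(K.rels_assoc _).2 i |>.2.2.2.2.2.1]
      simp only [mul_neg]
    intro i j
    rw [e, e, K.dd i j]
    simp only [mul_neg, neg_mul]
  -- the components of `R`
  have i1 := inv_of_quad (K.da * (K.a * K.dt)) hg hRa hRt hn hn'
    (fun i j => (K.gen_da i j).mul_right ((K.gen_a i j).mul_right (K.gen_dt i j)))
    (by simp [K.rels_assoc, mul_sub]) (by simp [K.rels, K.rels_assoc, mul_sub])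
    (K.deg_da.mul (K.deg_a.mul K.deg_dt))
  have i2 := inv_of_quad (K.da * K.dt) hg hRa hRt hn hn'
    (fun i j => (K.gen_da i j).mul_right (K.gen_dt i j))
    (by simp [K.rels_assoc]) (by simp [K.rels, K.rels_assoc])
    (K.deg_da.mul K.deg_dt)
  have i3 := inv_of_quad (K.da * (K.a * (K.dt * K.t))) hg hRa hRt hn hn'
    (fun i j => (K.gen_da i j).mul_right ((K.gen_a i j).mul_right
      ((K.gen_dt i j).mul_right (K.gen_t i j))))
    (by simp [K.rels, K.rels_assoc, mul_sub, mul_add])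
    (by simp [K.rels, K.rels_assoc, mul_add, sub_eq_add_neg])
    (K.deg_da.mul (K.deg_a.mul (K.deg_dt.mul K.deg_t)))
  have i4 := inv_of_quad (K.dt * (K.t * K.da)) hg hRa hRt hn hn'
    (fun i j => (K.gen_dt i j).mul_right ((K.gen_t i j).mul_right (K.gen_da i j)))
    (by simp [K.rels, K.rels_assoc, mul_add]) (by simp [K.rels, K.rels_assoc, mul_add])
    (K.deg_dt.mul (K.deg_t.mul K.deg_da))
  have hdec : R = K.da * (K.a * (K.dt * K.t)) * R + K.t * (K.da * (K.a * K.dt) * R)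
      + K.a * (K.dt * (K.t * K.da) * R) - K.a * (K.t * (K.da * K.dt * R)) := by
    simp only [mul_assoc, K.rels, K.rels_assoc, mul_sub, sub_mul, mul_add, add_mul, mul_neg,
            one_mul, mul_one, sub_neg_eq_add]
    abel
  have c1 : ∃ c : ℂ, K.da * (K.a * K.dt) * R = c • (K.proj (m - 1) * K.P) := by
    rcases i1.eq_of_anti_z (fun i j => by
        have := congrArg (fun x => K.da * K.a * x) (hz i j)
        have e : ∀ i j, K.z i * (K.da * (K.a * K.dt) * R) * K.z j
            = K.da * K.a * (K.z i * (K.dt * R) * K.z j) := fun i j => by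
          simp only [mul_assoc, K.rels, K.rels_assoc, mul_sub, sub_mul, add_mul, mul_neg,
            neg_mul, neg_neg, one_mul, sub_neg_eq_add]
          abel
        rw [e, e]; simp only [this, mul_neg]) with h | ⟨k, c, hk, hc⟩
    · exact ⟨0, by simp [h]⟩
    rcases i1.eq_of_anti_d (fun i j => by
        have := congrArg (fun x => K.dt * x) (hd i j)
        have e : ∀ i j, K.d i * (K.da * (K.a * K.dt) * R) * K.d j
            = -(K.dt * (K.d i * (K.da * (K.a * R)) * K.d j)) := fun i j => by
          simp only [mul_assoc, K.rels_assoc, mul_sub, sub_mul, add_mul, mul_neg,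
            neg_mul, neg_neg, sub_neg_eq_add]
          abel
        rw [e, e]; simp only [this, mul_neg]) with h | ⟨k', c', hk', hc'⟩
    · exact ⟨0, by simp [h]⟩
    obtain rfl : k = 0 := by omega
    exact ⟨c, by simpa using hc⟩
  have c2 : ∃ (k : ℕ) (c : ℂ), K.da * K.dt * R = c • (K.E ^ k * (K.proj (m - 1) * K.P)) := by
    rcases i2.eq_of_anti_z (fun i j => by
        have := congrArg (fun x => K.da * x) (hz i j)
        have e : ∀ i j, K.z i * (K.da * K.dt * R) * K.z j
            = -(K.da * (K.z i * (K.dt * R) * K.z j)) := fun i j => by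
          simp only [mul_assoc, K.rels_assoc, mul_neg,
            neg_mul, neg_neg]
        rw [e, e]; simp only [this, mul_neg]) with h | ⟨k, c, hk, hc⟩
    · exact ⟨0, 0, by simp [h]⟩
    · exact ⟨k, c, hc⟩
  have c3 : ∃ (k : ℕ) (c : ℂ), K.da * (K.a * (K.dt * K.t)) * R
      = c • (K.F ^ k * (K.proj (m - 1) * K.P)) := by
    rcases i3.eq_of_anti_d (fun i j => by
        have := congrArg (fun x => K.dt * K.t * x) (hd i j)
        have e : ∀ i j, K.d i * (K.da * (K.a * (K.dt * K.t)) * R) * K.d j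
            = K.dt * K.t * (K.d i * (K.da * (K.a * R)) * K.d j) := fun i j => by
          simp only [mul_assoc, K.rels, K.rels_assoc, mul_sub, sub_mul, mul_add, add_mul, mul_neg,
            neg_neg, one_mul, mul_one, sub_neg_eq_add]
          abel
        rw [e, e]; simp only [this, mul_neg]) with h | ⟨k, c, hk, hc⟩
    · exact ⟨0, 0, by simp [h]⟩
    · exact ⟨k, c, hc⟩
  have ht : K.proj m * (K.t * K.P) = K.t * (K.proj (m - 1) * K.P) := by
    rw [← mul_assoc, ← mul_assoc, K.deg_t.mul_proj, sub_add_cancel]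
  have hdtt : K.dt * (K.t * (K.proj (m - 1) * K.P)) = K.proj (m - 1) * K.P := by
    rw [← (K.P_proj _).eq, ← mul_assoc, ← mul_assoc, mul_assoc K.dt, dt_t_P]
  have hpp : K.proj m * K.proj m = K.proj m := by rw [K.proj_mul, if_pos rfl]
  have c4 : ∃ X ∈ 𝒜, X * K.proj m = X ∧
      X * (K.t * K.P) = K.a * (K.dt * (K.t * K.da) * R) := by
    refine Submodule.span_induction (p := fun S _ => ∃ X ∈ 𝒜, X * K.proj m = X ∧
      X * (K.t * K.P) = K.a * S) ?_ ⟨0, 𝒜.zero_mem, by simp⟩ ?_ ?_ i4.mem_EFspan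
    · rintro _ ⟨⟨i, j⟩, rfl⟩
      refine ⟨K.a * K.E ^ i * (K.F ^ j * K.dt) * K.proj m, 𝒜.mul_mem (𝒜.mul_mem (h𝒜.a_E_mem i)
        (h𝒜.F_dt_mem j)) (h𝒜.proj_mem m), by rw [mul_assoc _ _ (K.proj m), hpp], ?_⟩
      simp only [mul_assoc, ht, hdtt]
    · rintro S S' _ _ ⟨X, hX, h, h'⟩ ⟨Y, hY, k, k'⟩
      exact ⟨X + Y, 𝒜.add_mem hX hY, by rw [add_mul, h, k], by rw [add_mul, h', k', mul_add]⟩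
    · rintro c S _ ⟨X, hX, h, h'⟩
      exact ⟨c • X, 𝒜.smul_mem hX c, by rw [smul_mul_assoc, h],
        by rw [smul_mul_assoc, h', mul_smul_comm]⟩
  obtain ⟨s1, e1⟩ := c1
  obtain ⟨k2, s2, e2⟩ := c2
  obtain ⟨k3, s3, e3⟩ := c3
  obtain ⟨X, hX, hXp, hXt⟩ := c4
  obtain ⟨T', hT'⟩ : ∃ T', T' = s3 • (K.F ^ k3 * K.dt * K.proj m) + s1 • K.proj m + X
    - s2 • (K.a * K.E ^ k2 * K.proj m) := ⟨_, rfl⟩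
  have hmem : T' ∈ 𝒜 := by
    rw [hT']
    exact 𝒜.sub_mem (𝒜.add_mem (𝒜.add_mem (𝒜.smul_mem (𝒜.mul_mem (h𝒜.F_dt_mem _)
      (h𝒜.proj_mem _)) _) (𝒜.smul_mem (h𝒜.proj_mem _) _)) hX)
      (𝒜.smul_mem (𝒜.mul_mem (h𝒜.a_E_mem _) (h𝒜.proj_mem _)) _)
  have hp : T' * K.proj m = T' := by
    rw [hT']
    simp only [sub_mul, add_mul, smul_mul_assoc, mul_assoc, hpp, hXp]
  have hnum : T' * K.num = (m : ℂ) • T' := by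
    nth_rewrite 1 [← hp]
    rw [mul_assoc, K.proj_num, mul_smul_comm, hp]
  have hRT : T' * (K.t * K.P) = R := by
    rw [hdec, e1, e2, e3, hT']
    simp only [sub_mul, add_mul, smul_mul_assoc, mul_assoc, ht, hdtt, hXt, mul_smul_comm]
    simp only [← mul_assoc, ((K.E_t).pow_left k2).eq]
  rw [sub_eq_zero.1 ((hT.sub (h𝒜.comm T' hmem)).eq_zero (m := m) ?_ h1 h2 ?_)]
  · exact hmem
  · rw [sub_mul, hm, hnum, smul_sub]
  · rw [mul_assoc, sub_mul, hRT, hR', sub_self]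

lemma IsSymm.mem_of_num' {𝒜 : Subalgebra ℂ 𝔅} (h𝒜 : K.IsSymm 𝒜) {T : 𝔅} (hT : K.CommQuad T)
    {m m' : ℤ} (hm' : K.num * T = (m' : ℂ) • T) (hm : T * K.num = (m : ℂ) • T)
    (h1 : m' ≠ 0) (h2 : m' ≠ Fintype.card ι + 2) : T ∈ 𝒜 := by
  have := h𝒜.op.mem_of_num hT.op (m := m') (m' := m)
    (by rw [op_num, ← MulOpposite.op_mul, hm, MulOpposite.op_smul])
    (by rw [op_num, ← MulOpposite.op_mul, hm', MulOpposite.op_smul]) h1 h2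
  exact Subalgebra.mem_op.1 this

variable (K)

variable {K}

lemma CommQuad.mul {X Y : 𝔅} (hX : K.CommQuad X) (hY : K.CommQuad Y) : K.CommQuad (X * Y) :=
  ⟨fun i j => (hX.gen i j).mul_right (hY.gen i j), fun i => (hX.z_dt i).mul_right (hY.z_dt i),
    fun i => (hX.a_d i).mul_right (hY.a_d i), hX.a_dt.mul_right hY.a_dt⟩

/-- A symmetry algebra that exchanges the empty and the completely filled state is the whole
commutant of the quadratic operators. -/
theorem IsSymm.mem {𝒜 : Subalgebra ℂ 𝔅} (h𝒜 : K.IsSymm 𝒜) {U U' : 𝔅} (hU : U ∈ 𝒜) (hU' : U' ∈ 𝒜)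
    (h0 : U' * U = K.proj 0) (h1 : U * U' = K.proj (Fintype.card ι + 2)) {T : 𝔅}
    (hT : K.CommQuad T) : T ∈ 𝒜 := by
  have hdec : T = ∑ p ∈ Finset.range (Fintype.card ι + 3), ∑ q ∈ Finset.range (Fintype.card ι + 3),
      K.proj p * T * K.proj q := by
    simp_rw [← Finset.mul_sum, ← Finset.sum_mul, K.sum_proj, one_mul, mul_one]
  have hpp : ∀ p, K.proj p * K.proj p = K.proj p := fun p => by rw [K.proj_mul, if_pos rfl]
  have h2 : K.proj (Fintype.card ι + 2) = U * K.proj 0 * U' := by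
    rw [← hpp, ← h1, ← h0]; simp only [mul_assoc]
  have hp := h𝒜.proj_mem
  rw [hdec]
  refine 𝒜.sum_mem fun p _ => 𝒜.sum_mem fun q _ => ?_
  have hS : K.CommQuad (K.proj p * T * K.proj q) :=
    ((h𝒜.comm _ (hp p)).mul hT).mul (h𝒜.comm _ (hp q))
  have hl : K.num * (K.proj p * T * K.proj q) = ((p : ℤ) : ℂ) • (K.proj p * T * K.proj q) := by
    rw [← mul_assoc, ← mul_assoc, K.num_proj, smul_mul_assoc, smul_mul_assoc]
  have hr : K.proj p * T * K.proj q * K.num = ((q : ℤ) : ℂ) • (K.proj p * T * K.proj q) := by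
    rw [mul_assoc, K.proj_num, mul_smul_comm]
  by_cases hq : (q : ℤ) ≠ 0 ∧ (q : ℤ) ≠ Fintype.card ι + 2
  · exact h𝒜.mem_of_num hS hl hr hq.1 hq.2
  by_cases hp' : (p : ℤ) ≠ 0 ∧ (p : ℤ) ≠ Fintype.card ι + 2
  · exact h𝒜.mem_of_num' hS hl hr hp'.1 hp'.2
  have key : ∀ {A B : 𝔅} (X : 𝔅), A ∈ 𝒜 → B ∈ 𝒜 → A * (K.proj 0 * X * K.proj 0) * B ∈ 𝒜 := by
    intro A B X hA hB
    obtain ⟨c, hc⟩ := K.vac X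
    rw [hc]
    exact 𝒜.mul_mem (𝒜.mul_mem hA (𝒜.smul_mem (hp 0) c)) hB
  have hp0 : (p : ℤ) = 0 ∨ (p : ℤ) = Fintype.card ι + 2 := by tauto
  have hq0 : (q : ℤ) = 0 ∨ (q : ℤ) = Fintype.card ι + 2 := by tauto
  rcases hp0 with e | e <;> rcases hq0 with e' | e' <;> rw [e, e']
  · simpa using key T 𝒜.one_mem 𝒜.one_mem
  · rw [h2]; simpa [mul_assoc] using key (T * U) 𝒜.one_mem hU'
  · rw [h2]; simpa [mul_assoc] using key (U' * T) hU 𝒜.one_mem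
  · rw [h2]; simpa [mul_assoc] using key (U' * (T * U)) hU hU'

end Fock

/-- Two families of fermions on a periodic chain of `2 * L` sites, dual to each other up to an
alternating sign. -/
structure Chain (𝔅 : Type*) [Ring 𝔅] [Algebra ℂ 𝔅] (L : ℕ) where
  g : ℕ → 𝔅
  h : ℕ → 𝔅
  g_add : ∀ k, g (k + 2 * L) = g k
  h_add : ∀ k, h (k + 2 * L) = h k
  gg : ∀ j k, g j * g k = -(g k * g j)
  hh : ∀ j k, h j * h k = -(h k * h j)
  hg : ∀ j k, h j * g k = (if j % (2 * L) = k % (2 * L) then (-1 : ℂ) ^ (j + 1) else 0) • 1 - g k * h j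

namespace Chain

variable {𝔅 : Type*} [Ring 𝔅] [Algebra ℂ 𝔅] {L : ℕ}

section Sums

variable (v : ℕ → 𝔅)

/-- The sum of `v k` over `k < m`. -/
def lin (m : ℕ) : 𝔅 := ∑ k ∈ Finset.range m, v k
/-- The sum of `v i * v j` over `i < j < m`. -/
def quad (m : ℕ) : 𝔅 := ∑ k ∈ Finset.range m, lin v k * v k

@[simp] lemma lin_zero : lin v 0 = 0 := rfl
@[simp] lemma quad_zero : quad v 0 = 0 := rfl
lemma lin_succ (m : ℕ) : lin v (m + 1) = lin v m + v m := Finset.sum_range_succ _ _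
lemma quad_succ (m : ℕ) : quad v (m + 1) = quad v m + lin v m * v m := Finset.sum_range_succ _ _

lemma lin_succ' (m : ℕ) : lin v (m + 1) = v 0 + lin (fun k => v (k + 1)) m := by
  rw [lin, Finset.sum_range_succ', add_comm]; rfl

lemma quad_succ' (m : ℕ) :
    quad v (m + 1) = quad (fun k => v (k + 1)) m + v 0 * lin (fun k => v (k + 1)) m := by
  induction m with
  | zero => simp [quad_succ]
  | succ m ih => rw [quad_succ, ih, quad_succ, lin_succ', lin_succ, mul_add, add_mul]; abel

variable {v}

lemma sq_eq_zero (hv : ∀ j k, v j * v k = -(v k * v j)) (k : ℕ) : v k * v k = 0 :=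
  Fock.eq_zero_of_eq_neg (hv k k)

lemma mul_lin (hv : ∀ j k, v j * v k = -(v k * v j)) (k m : ℕ) : v k * lin v m = -(lin v m * v k) := by
  simp only [lin, Finset.mul_sum, Finset.sum_mul, ← Finset.sum_neg_distrib, hv k]

lemma lin_mul_lin (hv : ∀ j k, v j * v k = -(v k * v j)) (m m' : ℕ) :
    lin v m * lin v m' = -(lin v m' * lin v m) := by
  conv_lhs => rw [lin]
  conv_rhs => rw [lin.eq_def v m]
  simp only [Finset.mul_sum, Finset.sum_mul, ← Finset.sum_neg_distrib, mul_lin hv]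

lemma lin_sq (hv : ∀ j k, v j * v k = -(v k * v j)) (m : ℕ) : lin v m * lin v m = 0 :=
  Fock.eq_zero_of_eq_neg (lin_mul_lin hv m m)

lemma commute_quad {y : 𝔅} (hy : ∀ k, v k * y = -(y * v k)) (m : ℕ) : Commute (quad v m) y :=
  Commute.sum_left _ _ _ fun k _ => Fock.commute_mul_of_anti
    (by simp only [lin, Finset.mul_sum, Finset.sum_mul, ← Finset.sum_neg_distrib, hy]) (hy k)

lemma quad_v (hv : ∀ j k, v j * v k = -(v k * v j)) (m k : ℕ) : Commute (quad v m) (v k) :=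
  commute_quad (fun j => hv j k) m

lemma quad_lin (hv : ∀ j k, v j * v k = -(v k * v j)) (m k : ℕ) : Commute (quad v m) (lin v k) :=
  commute_quad (fun j => mul_lin hv j k) m

/-- The quadratic sum over pairs of consecutive intervals. -/
lemma sum_pairs (hv : ∀ j k, v j * v k = -(v k * v j)) (n : ℕ) :
    ∑ i ∈ Finset.range n, lin v (2 * i + 2) * (lin v (2 * i + 3) - lin v (2 * i + 1))
    = quad v (2 * n + 1) := by
  induction n with
  | zero => simp [quad_succ]
  | succ n ih =>
    rw [Finset.sum_range_succ, ih, show 2 * (n + 1) + 1 = 2 * n + 1 + 1 + 1 by ring]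
    simp only [quad_succ, lin_succ, add_mul, mul_add, mul_sub, sq_eq_zero hv]
    abel

lemma lin_mul_quad_pow_eq {m : ℕ} {Q Q' : 𝔅} (hQ : Commute Q (lin v m))
    (h : lin v m * Q = lin v m * Q') (k : ℕ) : lin v m * Q ^ k = lin v m * Q' ^ k := by
  induction k with
  | zero => simp
  | succ k ih =>
    rw [pow_succ', ← mul_assoc, ← hQ.eq, mul_assoc, ih, ← mul_assoc, hQ.eq, h, mul_assoc, pow_succ']

end Sums

variable (C : Chain 𝔅 L)

/-- The chain with the two families exchanged. -/
def swap : Chain 𝔅 L where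
  g := C.h
  h := C.g
  g_add := C.h_add
  h_add := C.g_add
  gg := C.hh
  hh := C.gg
  hg j k := by
    have h : (-1 : ℂ) ^ (j + 1) = (-1) ^ (k + 1) ∨ ¬ j % (2 * L) = k % (2 * L) := by
      by_cases h : j % (2 * L) = k % (2 * L)
      · left
        have h2 : j % 2 = k % 2 := (Nat.ModEq.of_mul_right L h :)
        rw [neg_one_pow_eq_pow_mod_two, neg_one_pow_eq_pow_mod_two (n := k + 1)]
        congr 1
        omega
      · exact .inr h
    rw [C.hg k j]
    rcases h with h | h
    · simp only [h, eq_comm (a := k % (2 * L)), sub_sub_cancel]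
    · simp [h, Ne.symm h]

lemma hg_of_lt {j k : ℕ} (hj : j < 2 * L) (hk : k < 2 * L) :
    C.h j * C.g k = (if j = k then (-1 : ℂ) ^ (j + 1) else 0) • 1 - C.g k * C.h j := by
  rw [C.hg, Nat.mod_eq_of_lt hj, Nat.mod_eq_of_lt hk]

lemma h_lin {k m : ℕ} (hk : k < 2 * L) (hm : m ≤ 2 * L) :
    C.h k * lin C.g m = (if k < m then (-1 : ℂ) ^ (k + 1) else 0) • 1 - lin C.g m * C.h k := by
  induction m with
  | zero => simp
  | succ m ih =>
    rw [lin_succ, mul_add, ih (by omega), C.hg_of_lt hk (by omega), add_mul]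
    rcases lt_trichotomy k m with h | rfl | h
    · rw [if_pos h, if_neg h.ne, if_pos (by omega), zero_smul]; abel
    · rw [if_neg (lt_irrefl _), if_pos rfl, if_pos (by omega), zero_smul]; abel
    · rw [if_neg (by omega), if_neg h.ne', if_neg (by omega), zero_smul]; abel

lemma lin_lin {q p : ℕ} (hq : q ≤ 2 * L) (hp : p ≤ 2 * L) :
    lin C.h q * lin C.g p
      = ((if min q p % 2 = 1 then -1 else 0 : ℤ) : ℂ) • 1 - lin C.g p * lin C.h q := by
  induction q with
  | zero => simp
  | succ q ih =>
    rw [lin_succ, add_mul, ih (by omega), C.h_lin (by omega) hp, mul_add]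
    have h : ((if min q p % 2 = 1 then -1 else 0 : ℤ) : ℂ) + (if q < p then (-1 : ℂ) ^ (q + 1) else 0)
        = ((if min (q + 1) p % 2 = 1 then -1 else 0 : ℤ) : ℂ) := by
      rcases lt_or_ge q p with h | h
      · rw [min_eq_left h.le, min_eq_left (by omega), if_pos h, neg_one_pow_eq_pow_mod_two]
        rcases Nat.mod_two_eq_zero_or_one q with h' | h'
        · simp [h', Nat.add_mod]
        · simp [h', Nat.add_mod]
      · rw [min_eq_right h, min_eq_right (by omega), if_neg h.not_gt, add_zero]
    rw [← h, add_smul]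
    abel

lemma h_quad {k m : ℕ} (hk : k < 2 * L) (hm : m ≤ 2 * L) :
    C.h k * quad C.g m = quad C.g m * C.h k +
      (if k < m then (-1 : ℂ) ^ (k + 1) else 0) • (lin C.g m - C.g k - 2 * lin C.g k) := by
  induction m with
  | zero => simp
  | succ m ih =>
    rw [quad_succ, mul_add, ih (by omega), ← mul_assoc, C.h_lin hk (by omega), sub_mul, mul_assoc,
      C.hg_of_lt hk (by omega), lin_succ, add_mul, mul_sub]
    rcases lt_trichotomy k m with h | rfl | h
    · rw [if_pos h, if_neg h.ne, if_pos (by omega)]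
      simp only [smul_add, smul_sub, zero_smul, smul_mul_assoc, one_mul, mul_zero, mul_assoc]
      abel
    · rw [if_neg (lt_irrefl _), if_pos rfl, if_pos (by omega)]
      simp only [smul_add, smul_sub, zero_smul, mul_smul_comm, mul_one,
        mul_assoc, two_mul, zero_mul]
      abel
    · rw [if_neg (by omega), if_neg h.ne', if_neg (by omega)]
      simp only [zero_smul, mul_zero, mul_assoc, zero_mul]
      abel

/-- The Temperley–Lieb generators. -/
def tl (k : ℕ) : 𝔅 := (C.g k + C.g (k + 1)) * (C.h k + C.h (k + 1))

lemma h_lin_all {k : ℕ} (hL : 0 < L) :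
    C.h k * lin C.g (2 * L) = ((-1 : ℂ) ^ (k + 1)) • 1 - lin C.g (2 * L) * C.h k := by
  have e : ∀ m, C.h (k % (2 * L) + m * (2 * L)) = C.h (k % (2 * L)) := fun m => by
    induction m with
    | zero => simp
    | succ m ih => rw [add_mul, one_mul, ← add_assoc, C.h_add, ih]
  have hk : k % (2 * L) < 2 * L := Nat.mod_lt _ (by omega)
  have hp : (-1 : ℂ) ^ (k + 1) = (-1) ^ (k % (2 * L) + 1) := by
    rw [neg_one_pow_eq_pow_mod_two, neg_one_pow_eq_pow_mod_two (n := k % (2 * L) + 1)]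
    congr 1
    have : k % (2 * L) % 2 = k % 2 := Nat.mod_mul_right_mod k 2 L
    omega
  have := e (k / (2 * L))
  rw [Nat.mod_add_div'] at this
  rw [this, C.h_lin hk le_rfl, if_pos hk, hp]

lemma tl_lin (hL : 0 < L) (j : ℕ) : Commute (lin C.g (2 * L)) (C.tl j) := by
  refine (Fock.commute_mul_of_anti (w := lin C.g (2 * L)) ?_ ?_).symm
  · rw [add_mul, mul_lin C.gg, mul_lin C.gg, mul_add]; abel
  · rw [add_mul, C.h_lin_all hL, C.h_lin_all hL, mul_add, pow_succ _ (j + 1), mul_neg_one, neg_smul]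
    abel

lemma g_two_mul : C.g (2 * L) = C.g 0 := by simpa using C.g_add 0

lemma h_two_mul : C.h (2 * L) = C.h 0 := by simpa using C.h_add 0

lemma A_sq (j k : ℕ) : (C.g j + C.g k) * (C.g j + C.g k) = 0 := by
  rw [mul_add, add_mul, add_mul, sq_eq_zero C.gg, sq_eq_zero C.gg, C.gg k j]; abel

lemma lin_tl_quad (hL : 0 < L) {j : ℕ} (hj : j < 2 * L) :
    lin C.g (2 * L) * (C.tl j * quad C.g (2 * L)) = lin C.g (2 * L) * (quad C.g (2 * L) * C.tl j) := by
  have hA : Commute (quad C.g (2 * L)) (C.g j + C.g (j + 1)) :=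
    (quad_v C.gg _ _).add_right (quad_v C.gg _ _)
  have key : ∃ c : ℂ, (C.h j + C.h (j + 1)) * quad C.g (2 * L)
      = quad C.g (2 * L) * (C.h j + C.h (j + 1)) + (-1 : ℂ) ^ (j + 1) • (C.g j + C.g (j + 1))
        + c • lin C.g (2 * L) := by
    rcases (by omega : j + 1 < 2 * L ∨ j + 1 = 2 * L) with h | h
    · refine ⟨0, ?_⟩
      rw [add_mul, C.h_quad hj le_rfl, C.h_quad h le_rfl, if_pos hj, if_pos h, lin_succ, mul_add,
        pow_succ _ (j + 1), mul_neg_one]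
      simp only [smul_add, smul_sub, neg_smul, two_mul (lin _ _), two_mul (C.g _), mul_add, zero_smul]
      abel
    · refine ⟨-2, ?_⟩
      have e : lin C.g j = lin C.g (2 * L) - C.g j := by rw [← h, lin_succ]; abel
      rw [h, h_two_mul, g_two_mul, add_mul, C.h_quad hj le_rfl, C.h_quad (by omega : 0 < 2 * L) le_rfl,
        if_pos hj, if_pos (by omega), e, h, mul_add, (even_two_mul L).neg_one_pow]
      simp only [lin_zero, mul_zero, zero_add, pow_one, one_smul, sub_zero, smul_add, smul_sub,
        neg_smul, two_mul, two_smul]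
      abel
  obtain ⟨c, hc⟩ := key
  have e1 : C.tl j * quad C.g (2 * L) = quad C.g (2 * L) * C.tl j
      + c • ((C.g j + C.g (j + 1)) * lin C.g (2 * L)) := by
    rw [tl, mul_assoc, hc, mul_add, mul_add, mul_smul_comm, A_sq, smul_zero, add_zero, mul_smul_comm,
      ← mul_assoc, ← hA.eq, mul_assoc]
  rw [e1, mul_add, mul_smul_comm, add_mul, mul_lin C.gg, mul_lin C.gg, ← neg_add, ← mul_add, mul_neg,
    ← mul_assoc (lin _ _) (lin _ _), lin_sq C.gg]
  simp

lemma commute_lin_quad_pow (hL : 0 < L) {j : ℕ} (hj : j < 2 * L) (k : ℕ) :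
    Commute (lin C.g (2 * L) * quad C.g (2 * L) ^ k) (C.tl j) := by
  have h1 := (C.tl_lin hL j).eq
  have h2 := (quad_lin C.gg (2 * L) (2 * L)).eq
  induction k with
  | zero => simpa using C.tl_lin hL j
  | succ k ih =>
    have h3 := (((quad_lin C.gg (2 * L) (2 * L)).pow_left k)).eq
    rw [commute_iff_eq] at ih ⊢
    calc lin C.g (2 * L) * quad C.g (2 * L) ^ (k + 1) * C.tl j
        = quad C.g (2 * L) ^ k * (lin C.g (2 * L) * (quad C.g (2 * L) * C.tl j)) := by
          rw [pow_succ, ← mul_assoc, ← h3]; simp only [mul_assoc]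
      _ = (quad C.g (2 * L) ^ k * lin C.g (2 * L)) * C.tl j * quad C.g (2 * L) := by
          rw [← C.lin_tl_quad hL hj]; simp only [mul_assoc]
      _ = _ := by rw [h3, ih, pow_succ]; simp only [mul_assoc]

section Modes

variable {n : ℕ}

/-- End points of the intervals defining the creation operators. -/
def crIdx (n : ℕ) : (Fin n × Bool) ⊕ Bool → ℕ × ℕ
  | .inl (i, false) => (2 * i + 2, 0)
  | .inl (i, true) => (2 * i + 3, 2 * i + 1)
  | .inr false => (2 * n + 2, 0)
  | .inr true => (2 * n + 2, 2 * n + 1)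

/-- End points of the intervals defining the annihilation operators. -/
def anIdx (n : ℕ) : (Fin n × Bool) ⊕ Bool → ℕ × ℕ
  | .inl (i, false) => (2 * i + 3, 2 * i + 1)
  | .inl (i, true) => (2 * i + 2, 0)
  | .inr false => (0, 2 * n + 1)
  | .inr true => (2 * n + 2, 0)

/-- Creation operators of the modes. -/
def cr (C : Chain 𝔅 (n + 1)) (μ : (Fin n × Bool) ⊕ Bool) : 𝔅 :=
  lin C.g (crIdx n μ).1 - lin C.g (crIdx n μ).2

/-- Annihilation operators of the modes. -/
def an (C : Chain 𝔅 (n + 1)) (μ : (Fin n × Bool) ⊕ Bool) : 𝔅 :=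
  lin C.h (anIdx n μ).1 - lin C.h (anIdx n μ).2

lemma crIdx_le (μ : (Fin n × Bool) ⊕ Bool) :
    (crIdx n μ).1 ≤ 2 * (n + 1) ∧ (crIdx n μ).2 ≤ 2 * (n + 1) := by
  rcases μ with ⟨i, _ | _⟩ | _ | _ <;> simp only [crIdx] <;> omega

lemma anIdx_le (μ : (Fin n × Bool) ⊕ Bool) :
    (anIdx n μ).1 ≤ 2 * (n + 1) ∧ (anIdx n μ).2 ≤ 2 * (n + 1) := by
  rcases μ with ⟨i, _ | _⟩ | _ | _ <;> simp only [anIdx] <;> omega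

lemma lin_sub_mul_lin_sub {v : ℕ → 𝔅} (hv : ∀ j k, v j * v k = -(v k * v j)) (p q p' q' : ℕ) :
    (lin v p - lin v q) * (lin v p' - lin v q') = -((lin v p' - lin v q') * (lin v p - lin v q)) := by
  simp only [sub_mul, mul_sub]
  rw [lin_mul_lin hv p p', lin_mul_lin hv q p', lin_mul_lin hv p q', lin_mul_lin hv q q']
  abel

lemma idx_pairing (μ ν : (Fin n × Bool) ⊕ Bool) :
    (if min (anIdx n μ).1 (crIdx n ν).1 % 2 = 1 then -1 else 0 : ℤ)
      - (if min (anIdx n μ).2 (crIdx n ν).1 % 2 = 1 then -1 else 0)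
      - (if min (anIdx n μ).1 (crIdx n ν).2 % 2 = 1 then -1 else 0)
      + (if min (anIdx n μ).2 (crIdx n ν).2 % 2 = 1 then -1 else 0) = if μ = ν then 1 else 0 := by
  have hmin : ∀ a b : ℕ, (if min a b % 2 = 1 then -1 else 0 : ℤ)
      = if a ≤ b then (if a % 2 = 1 then -1 else 0) else (if b % 2 = 1 then -1 else 0) := fun a b => by
    rw [min_def]; split_ifs <;> rfl
  have h1 : ∀ a, ((2 * a + 1) % 2 = 1) = True := fun a => by simp
  have h2 : ∀ a, ((2 * a + 2) % 2 = 1) = False := fun a => by simp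
  have h3 : ∀ a, ((2 * a + 3) % 2 = 1) = True := fun a => by simp [Nat.add_mod]
  have h0 : (0 % 2 = 1) = False := by simp
  simp only [hmin]
  rcases μ with ⟨i, _ | _⟩ | _ | _ <;> rcases ν with ⟨j, _ | _⟩ | _ | _ <;>
    simp only [crIdx, anIdx, Sum.inl.injEq, Sum.inr.injEq, Prod.mk.injEq, Fin.ext_iff, reduceCtorEq,
      and_true, and_false, h0, h1, h2, h3, if_true, if_false, ite_self] <;> (try split_ifs) <;> omega

lemma an_cr (C : Chain 𝔅 (n + 1)) (μ ν : (Fin n × Bool) ⊕ Bool) :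
    C.an μ * C.cr ν = (if μ = ν then 1 else 0) - C.cr ν * C.an μ := by
  have h : (if μ = ν then 1 else 0 : 𝔅) = (((if μ = ν then 1 else 0 : ℤ)) : ℂ) • 1 := by
    split_ifs <;> simp
  obtain ⟨h1, h2⟩ := anIdx_le μ
  obtain ⟨h3, h4⟩ := crIdx_le ν
  rw [h, ← idx_pairing, an, cr]
  simp only [sub_mul, mul_sub]
  rw [C.lin_lin h1 h3, C.lin_lin h1 h4, C.lin_lin h2 h3, C.lin_lin h2 h4]
  simp only [Int.cast_add, Int.cast_sub, add_smul, sub_smul]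
  abel

lemma sum_modes (C : Chain 𝔅 (n + 1)) : ∑ μ, C.cr μ * C.an μ
    = ∑ k ∈ Finset.range (2 * (n + 1)), (-1 : ℂ) ^ (k + 1) • (C.g k * C.h k) := by
  have key : ∀ n, ∑ i ∈ Finset.range n, (lin C.g (2 * i + 2) * (lin C.h (2 * i + 3)
      - lin C.h (2 * i + 1)) + (lin C.g (2 * i + 3) - lin C.g (2 * i + 1)) * lin C.h (2 * i + 2))
      = ∑ k ∈ Finset.range (2 * n + 1), (-1 : ℂ) ^ (k + 1) • (C.g k * C.h k)
        + lin C.g (2 * n + 1) * lin C.h (2 * n + 1) := by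
    intro n
    induction n with
    | zero => simp [lin_succ]
    | succ n ih =>
      rw [Finset.sum_range_succ, ih, show 2 * (n + 1) + 1 = 2 * n + 1 + 1 + 1 by ring,
        Finset.sum_range_succ _ (2 * n + 1 + 1), Finset.sum_range_succ _ (2 * n + 1)]
      have e1 : (-1 : ℂ) ^ (2 * n + 1 + 1) = 1 := by simp [pow_succ]
      have e2 : (-1 : ℂ) ^ (2 * n + 1 + 1 + 1) = -1 := by simp [pow_succ]
      simp only [lin_succ, e1, e2, mul_add, add_mul, mul_sub, sub_mul, neg_smul, one_smul]
      abel
  have e1 : (-1 : ℂ) ^ (2 * n + 1 + 1) = 1 := by simp [pow_succ]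
  simp only [Fintype.sum_sum_type, Fintype.sum_prod_type, Fintype.sum_bool, cr, an, crIdx, anIdx,
    lin_zero, sub_zero, zero_sub]
  have := key n
  rw [Finset.sum_range] at this
  simp_rw [add_comm _ (lin C.g _ * (lin C.h _ - lin C.h _))]
  rw [this, show 2 * (n + 1) = 2 * n + 1 + 1 by ring, Finset.sum_range_succ _ (2 * n + 1), e1]
  simp only [lin_succ, mul_add, add_mul, mul_neg, sub_mul, one_smul]
  abel

/-- The Fock data of a chain with given spectral projections of the particle number. -/
def toFock (C : Chain 𝔅 (n + 1)) (proj : ℤ → 𝔅)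
    (proj_mul : ∀ p q, proj p * proj q = if p = q then proj p else 0)
    (sum_proj : ∑ p ∈ Finset.range (2 * n + 3), proj p = 1)
    (num_eq : ∑ k ∈ Finset.range (2 * (n + 1)), (-1 : ℂ) ^ (k + 1) • (C.g k * C.h k)
      = ∑ p ∈ Finset.range (2 * n + 3), (p : ℂ) • proj p)
    (vac : ∀ S : 𝔅, ∃ c : ℂ, proj 0 * S * proj 0 = c • proj 0) : Fock 𝔅 (Fin n × Bool) where
  bar i := (i.1, !i.2)
  sgn i := if i.2 then -1 else 1
  bar_bar i := by simp
  sgn_bar i := by rcases i with ⟨i, _ | _⟩ <;> simp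
  sgn_mul_self i := by rcases i with ⟨i, _ | _⟩ <;> simp
  cr := C.cr
  an := C.an
  cr_cr _ _ := lin_sub_mul_lin_sub C.gg _ _ _ _
  an_an _ _ := lin_sub_mul_lin_sub C.hh _ _ _ _
  an_cr := C.an_cr
  proj := proj
  proj_mul := proj_mul
  sum_proj := by
    rw [Fintype.card_prod, Fintype.card_fin, Fintype.card_bool, mul_comm n]; exact sum_proj
  num_eq := by
    rw [Fintype.card_prod, Fintype.card_fin, Fintype.card_bool, mul_comm n, ← num_eq, sum_modes]
  vac := vac

end Modes

end Chain

/-- Commutation with the symmetric bilinear expressions attached to a space of pairs of operators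
implies commutation with all quadratic operators. -/
lemma Fock.commQuad_of_pairs {𝔅 : Type*} [Ring 𝔅] [Algebra ℂ 𝔅] {ι : Type*} [Fintype ι]
    [DecidableEq ι] {K : Fock 𝔅 ι} {W : Submodule ℂ (𝔅 × 𝔅)} {T : 𝔅}
    (hW : ∀ x ∈ W, ∀ y ∈ W, Commute (x.1 * y.2 + y.1 * x.2) T)
    (hz : ∀ i, (K.z i, K.sgn i • K.d (K.bar i)) ∈ W) (ha : (K.a, K.dt) ∈ W)
    (ha' : (K.a, -K.dt) ∈ W) : K.CommQuad T where
  gen i j := by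
    have h := (hW _ (hz i) _ (hz (K.bar j))).smul_left (K.sgn (K.bar j))
    simp only [K.bar_bar, K.sgn_bar, mul_smul_comm, smul_add, smul_smul, neg_mul, mul_neg, neg_neg,
      K.sgn_mul_self, one_smul] at h
    rw [Fock.gen, sub_eq_add_neg, ← neg_smul, mul_comm (K.sgn i)]
    exact h
  z_dt i := by
    have h := ((hW _ (hz i) _ ha).sub_left (hW _ (hz i) _ ha')).smul_left (1 / 2 : ℂ)
    have e : (1 / 2 : ℂ) • (K.z i * K.dt + K.a * K.sgn i • K.d (K.bar i)
        - (K.z i * -K.dt + K.a * K.sgn i • K.d (K.bar i))) = K.z i * K.dt := by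
      rw [mul_neg]; module
    rwa [e] at h
  a_d i := by
    have h := ((hW _ (hz (K.bar i)) _ ha).add_left (hW _ (hz (K.bar i)) _ ha')).smul_left
      (K.sgn (K.bar i) / 2)
    have e : (K.sgn (K.bar i) / 2) • (K.z (K.bar i) * K.dt + K.a * K.sgn (K.bar i) •
        K.d (K.bar (K.bar i)) + (K.z (K.bar i) * -K.dt + K.a * K.sgn (K.bar i) •
        K.d (K.bar (K.bar i)))) = (K.sgn (K.bar i) * K.sgn (K.bar i)) • (K.a * K.d i) := by
      rw [mul_neg, K.bar_bar, mul_smul_comm]; module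
    rwa [e, K.sgn_mul_self, one_smul] at h
  a_dt := by
    have h := (hW _ ha _ ha).smul_left (1 / 2 : ℂ)
    have e : (1 / 2 : ℂ) • (K.a * K.dt + K.a * K.dt) = K.a * K.dt := by module
    rwa [e] at h

namespace Chain
variable {𝔅 : Type*} [Ring 𝔅] [Algebra ℂ 𝔅] {L : ℕ}

section Pairs

variable (C : Chain 𝔅 L)

/-- Sums of neighbouring fermions. -/
def A (k : ℕ) : 𝔅 := C.g k + C.g (k + 1)
/-- Alternating sums of neighbouring dual fermions. -/
def B (k : ℕ) : 𝔅 := (-1 : ℂ) ^ k • (C.h k + C.h (k + 1))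
/-- The antisymmetric form on neighbouring sums. -/
def form (L j k : ℕ) : ℂ :=
  (if (k + 1) % (2 * L) = j % (2 * L) then 1 else 0)
    - (if k % (2 * L) = (j + 1) % (2 * L) then 1 else 0)

lemma form_antisymm (j k : ℕ) : form L j k = -form L k j := by
  simp only [form, eq_comm (a := j % (2 * L)), eq_comm (a := (j + 1) % (2 * L)), neg_sub]

lemma B_A (j k : ℕ) : C.B k * C.A j = form L j k • 1 - C.A j * C.B k := by
  have h : (k + 1) % (2 * L) = (j + 1) % (2 * L) ↔ k % (2 * L) = j % (2 * L) :=
    ⟨fun h => Nat.ModEq.add_right_cancel' 1 h, fun h => Nat.ModEq.add_right 1 h⟩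
  have e : (-1 : ℂ) ^ k * (-1) ^ k = 1 := by rw [← mul_pow]; simp
  rw [A, B, smul_mul_assoc, add_mul, mul_add, mul_add, C.hg, C.hg, C.hg, C.hg, mul_smul_comm,
    mul_add (C.g j + _), add_mul, add_mul]
  have e2 : form L j k = (-1) ^ k * ((if k % (2 * L) = j % (2 * L) then (-1 : ℂ) ^ (k + 1) else 0)
      + (if k % (2 * L) = (j + 1) % (2 * L) then (-1 : ℂ) ^ (k + 1) else 0)
      + (if (k + 1) % (2 * L) = j % (2 * L) then (-1 : ℂ) ^ (k + 1 + 1) else 0)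
      + (if (k + 1) % (2 * L) = (j + 1) % (2 * L) then (-1 : ℂ) ^ (k + 1 + 1) else 0)) := by
    simp only [form, h, pow_succ]
    split_ifs <;> first | ring1 | linear_combination e | linear_combination -e
  rw [e2]
  module

lemma A_A (j k : ℕ) : C.A j * C.A k = -(C.A k * C.A j) := by
  simp only [A, add_mul, mul_add, C.gg j, C.gg (j + 1)]; abel

lemma B_B (j k : ℕ) : C.B j * C.B k = -(C.B k * C.B j) := by
  simp only [B, smul_mul_assoc, mul_smul_comm, add_mul, mul_add, C.hh j, C.hh (j + 1)]
  module

/-- The symmetric quadratic expressions in neighbouring sums. -/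
def sym (j k : ℕ) : 𝔅 := C.A j * C.B k + C.A k * C.B j

lemma sym_comm (j k : ℕ) : C.sym j k = C.sym k j := add_comm _ _

lemma AB_commutator (x y z w : ℕ) : C.A x * C.B y * (C.A z * C.B w) - C.A z * C.B w * (C.A x * C.B y)
    = form L z y • (C.A x * C.B w) - form L x w • (C.A z * C.B y) := by
  have h1 : C.A x * C.B y * (C.A z * C.B w)
      = form L z y • (C.A x * C.B w) - C.A x * C.A z * (C.B y * C.B w) := by
    rw [mul_assoc, ← mul_assoc (C.B y), B_A, sub_mul, mul_sub, smul_mul_assoc, one_mul,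
      mul_smul_comm]
    simp only [mul_assoc]
  have h2 : C.A z * C.B w * (C.A x * C.B y)
      = form L x w • (C.A z * C.B y) - C.A z * C.A x * (C.B w * C.B y) := by
    rw [mul_assoc, ← mul_assoc (C.B w), B_A, sub_mul, mul_sub, smul_mul_assoc, one_mul,
      mul_smul_comm]
    simp only [mul_assoc]
  rw [h1, h2, C.A_A z x, C.B_B w y, neg_mul_neg]
  abel

lemma sym_commutator (x y z : ℕ) : C.sym x y * C.sym z z - C.sym z z * C.sym x y
    = (2 : ℂ) • (form L z y • C.sym x z + form L z x • C.sym y z) := by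
  have h1 := C.AB_commutator x y z z
  have h2 := C.AB_commutator y x z z
  rw [form_antisymm x z] at h1
  rw [form_antisymm y z] at h2
  have e : C.sym x y * C.sym z z - C.sym z z * C.sym x y
      = (2 : ℂ) • ((C.A x * C.B y * (C.A z * C.B z) - C.A z * C.B z * (C.A x * C.B y))
        + (C.A y * C.B x * (C.A z * C.B z) - C.A z * C.B z * (C.A y * C.B x))) := by
    simp only [sym, add_mul, mul_add, two_smul]
    abel
  rw [e, h1, h2]
  simp only [sym]
  module

variable {C} {T : 𝔅}

lemma commute_sym_self {k : ℕ} (h : Commute (C.tl k) T) : Commute (C.sym k k) T := by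
  rw [sym, B, A, mul_smul_comm]
  exact (h.smul_left _).add_left (h.smul_left _)

lemma form_succ (hL : 2 ≤ L) {k : ℕ} (hk : k + 1 < 2 * L) : form L (k + 1) k = 1 := by
  have h : ¬ k % (2 * L) = (k + 1 + 1) % (2 * L) := by
    rw [Nat.mod_eq_of_lt (by omega : k < 2 * L)]
    rcases (by omega : k + 1 + 1 < 2 * L ∨ k + 1 + 1 = 2 * L) with h | h
    · rw [Nat.mod_eq_of_lt h]; omega
    · rw [h, Nat.mod_self]; omega
  simp [form, h]

lemma commute_sym_commutator {x y z : ℕ} (h1 : Commute (C.sym x y) T) (h2 : Commute (C.sym z z) T) :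
    Commute (form L z y • C.sym x z + form L z x • C.sym y z) T := by
  have h := (((h1.mul_left h2).sub_left (h2.mul_left h1))).smul_left (1 / 2 : ℂ)
  rwa [sym_commutator, smul_smul, one_div, inv_mul_cancel₀ two_ne_zero, one_smul] at h

lemma commute_sym (hL : 2 ≤ L) (hT : ∀ k < 2 * L, Commute (C.tl k) T) {j k : ℕ} (hj : j ≤ k)
    (hk : k < 2 * L) : Commute (C.sym j k) T := by
  induction k, hj using Nat.le_induction with
  | base => exact commute_sym_self (hT j hk)
  | succ k hjk ih =>
    have h0 := commute_sym_self (hT (k + 1) hk)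
    have h1 : Commute (C.sym k (k + 1)) T := by
      have h := (commute_sym_commutator (commute_sym_self (hT k (by omega))) h0).smul_left (1 / 2 : ℂ)
      rw [form_succ hL hk, one_smul, smul_add, ← add_smul, add_halves, one_smul] at h
      exact h
    have h := (commute_sym_commutator (ih (by omega)) h0).sub_left
      (h1.smul_left (form L (k + 1) j))
    rwa [form_succ hL hk, one_smul, add_sub_cancel_right] at h

variable (C) in
/-- The space spanned by the pairs of neighbouring sums and their duals. -/
def pairs : Submodule ℂ (𝔅 × 𝔅) :=
  Submodule.span ℂ {x | ∃ k < 2 * L, x = (C.A k, C.B k)}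

lemma commute_pairs (hL : 2 ≤ L) (hT : ∀ k < 2 * L, Commute (C.tl k) T) :
    ∀ x ∈ C.pairs, ∀ y ∈ C.pairs, Commute (x.1 * y.2 + y.1 * x.2) T := by
  intro x hx y hy
  induction hx, hy using Submodule.span_induction₂ with
  | mem_mem x y hx hy =>
    obtain ⟨j, hj, rfl⟩ := hx
    obtain ⟨k, hk, rfl⟩ := hy
    change Commute (C.sym j k) T
    rcases le_total j k with h | h
    · exact commute_sym hL hT h hk
    · rw [sym_comm]; exact commute_sym hL hT h hj
  | zero_left y _ => simp
  | zero_right x _ => simp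
  | add_left x y z _ _ _ h1 h2 =>
    convert h1.add_left h2 using 1
    simp only [Prod.fst_add, Prod.snd_add, add_mul, mul_add]; abel
  | add_right x y z _ _ _ h1 h2 =>
    convert h1.add_left h2 using 1
    simp only [Prod.fst_add, Prod.snd_add, add_mul, mul_add]; abel
  | smul_left r x y _ _ h =>
    convert h.smul_left r using 1
    simp only [Prod.smul_fst, Prod.smul_snd, smul_mul_assoc, mul_smul_comm, smul_add]
  | smul_right r x y _ _ h =>
    convert h.smul_left r using 1
    simp only [Prod.smul_fst, Prod.smul_snd, smul_mul_assoc, mul_smul_comm, smul_add]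

variable (C)

lemma lin_even_mem_pairs {m : ℕ} (hm : m ≤ L) : (lin C.g (2 * m), lin C.h (2 * m)) ∈ C.pairs := by
  induction m with
  | zero => exact C.pairs.zero_mem
  | succ m ih =>
    have h : (C.A (2 * m), C.B (2 * m)) ∈ C.pairs := Submodule.subset_span ⟨_, by omega, rfl⟩
    convert C.pairs.add_mem (ih (by omega)) h using 1
    rw [show 2 * (m + 1) = 2 * m + 1 + 1 by ring, Prod.mk_add_mk, B, A, (even_two_mul m).neg_one_pow,
      one_smul, lin_succ, lin_succ, lin_succ, lin_succ, add_assoc, add_assoc]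

lemma odd_mem_pairs {m : ℕ} (hm : m < L) :
    (lin C.g (2 * m + 3) - lin C.g (2 * m + 1), -(lin C.h (2 * m + 3) - lin C.h (2 * m + 1)))
      ∈ C.pairs := by
  have h : (C.A (2 * m + 1), C.B (2 * m + 1)) ∈ C.pairs := Submodule.subset_span ⟨_, by omega, rfl⟩
  convert h using 2
  · rw [lin_succ _ (2 * m + 2), lin_succ _ (2 * m + 1), A]; abel
  · rw [lin_succ _ (2 * m + 2), lin_succ _ (2 * m + 1), B, pow_succ, (even_two_mul m).neg_one_pow,
      one_mul, neg_smul, one_smul]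
    abel

lemma lin_neg_mem_pairs : (lin C.g (2 * L), -lin C.h (2 * L)) ∈ C.pairs := by
  have key : ∀ m ≤ L, (lin C.g (2 * m + 1) - C.g 0, -(lin C.h (2 * m + 1) - C.h 0)) ∈ C.pairs := by
    intro m hm
    induction m with
    | zero =>
      rw [mul_zero, zero_add, lin_succ, lin_succ, lin_zero, lin_zero, zero_add, zero_add, sub_self,
        sub_self, neg_zero]
      exact C.pairs.zero_mem
    | succ m ih =>
      convert C.pairs.add_mem (ih (by omega)) (C.odd_mem_pairs (m := m) (by omega)) using 1
      rw [Prod.mk_add_mk, show 2 * (m + 1) + 1 = 2 * m + 3 by ring]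
      congr 1 <;> abel
  have h := key L le_rfl
  rwa [lin_succ, lin_succ, g_two_mul, h_two_mul, add_sub_cancel_right, add_sub_cancel_right] at h

end Pairs
end Chain

namespace Chain

variable {𝔅 : Type*} [Ring 𝔅] [Algebra ℂ 𝔅] {L : ℕ}

section Symmetry

lemma lin_mul_quad {v : ℕ → 𝔅} (hv : ∀ j k, v j * v k = -(v k * v j)) (m : ℕ) :
    lin v (m + 1) * quad v m = lin v (m + 1) * quad v (m + 1) := by
  have h : lin v (m + 1) * (lin v m * v m) = 0 := by
    rw [lin_succ, add_mul, ← mul_assoc, lin_sq hv, ← mul_assoc, mul_lin hv, neg_mul, mul_assoc,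
      sq_eq_zero hv]
    simp
  rw [quad_succ, mul_add, h, add_zero]

lemma lin_mul_quad_pow {v : ℕ → 𝔅} (hv : ∀ j k, v j * v k = -(v k * v j)) (m k : ℕ) :
    lin v (m + 1) * quad v m ^ k = lin v (m + 1) * quad v (m + 1) ^ k :=
  lin_mul_quad_pow_eq (quad_lin hv _ _) (lin_mul_quad hv m) k

lemma swap_tl (C : Chain 𝔅 L) (j : ℕ) : C.swap.tl j = -C.tl j := by
  have h := congrArg ((-1 : ℂ) ^ j • ·) (C.B_A j j)
  have h0 : form L j j = 0 := by simp [form, eq_comm]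
  have h1 : (-1 : ℂ) ^ j * (-1) ^ j = 1 := by rw [← mul_pow]; simp
  simp only [h0, B, smul_mul_assoc, mul_smul_comm, smul_smul, h1, one_smul, zero_smul,
    zero_sub, smul_neg] at h
  exact h

lemma commute_lin_quad_pow_h (C : Chain 𝔅 L) (hL : 0 < L) {j : ℕ} (hj : j < 2 * L) (k : ℕ) :
    Commute (lin C.h (2 * L) * quad C.h (2 * L) ^ k) (C.tl j) := by
  have h := C.swap.commute_lin_quad_pow hL hj k
  rw [swap_tl] at h
  have h' := h.neg_right
  rwa [neg_neg] at h'

variable {n : ℕ} (C : Chain 𝔅 (n + 1)) {proj : ℤ → 𝔅}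
    {h1 : ∀ p q, proj p * proj q = if p = q then proj p else 0}
    {h2 : ∑ p ∈ Finset.range (2 * n + 3), proj p = 1}
    {h3 : ∑ k ∈ Finset.range (2 * (n + 1)), (-1 : ℂ) ^ (k + 1) • (C.g k * C.h k)
      = ∑ p ∈ Finset.range (2 * n + 3), (p : ℂ) • proj p}
    {h4 : ∀ S : 𝔅, ∃ c : ℂ, proj 0 * S * proj 0 = c • proj 0}

lemma toFock_E : (C.toFock proj h1 h2 h3 h4).E = quad C.g (2 * n + 1) := by
  rw [← sum_pairs C.gg, Finset.sum_range]
  simp only [Fock.E, Fintype.sum_prod_type, Fintype.sum_bool, Fock.z, toFock, cr, crIdx, lin_zero,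
    sub_zero, Bool.not_true, Bool.not_false, if_true, Bool.false_eq_true, if_false, Finset.smul_sum]
  refine Finset.sum_congr rfl fun i _ => ?_
  have h := lin_sub_mul_lin_sub C.gg (2 * i + 3) (2 * i + 1) (2 * i + 2) 0
  rw [lin_zero, sub_zero] at h
  rw [h]
  module

lemma toFock_F : (C.toFock proj h1 h2 h3 h4).F = quad C.h (2 * n + 1) := by
  rw [← sum_pairs C.hh, Finset.sum_range]
  simp only [Fock.F, Fintype.sum_prod_type, Fintype.sum_bool, Fock.d, toFock, an, anIdx, lin_zero,
    sub_zero, Bool.not_true, Bool.not_false, if_true, Bool.false_eq_true, if_false, Finset.smul_sum]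
  refine Finset.sum_congr rfl fun i _ => ?_
  have h := lin_sub_mul_lin_sub C.hh (2 * i + 3) (2 * i + 1) (2 * i + 2) 0
  rw [lin_zero, sub_zero] at h
  rw [h]
  module

lemma toFock_a : (C.toFock proj h1 h2 h3 h4).a = lin C.g (2 * (n + 1)) := by
  simp [Fock.a, toFock, cr, crIdx, mul_add]

lemma toFock_dt : (C.toFock proj h1 h2 h3 h4).dt = lin C.h (2 * (n + 1)) := by
  simp [Fock.dt, toFock, an, anIdx, mul_add]

lemma toFock_a_E (k : ℕ) : (C.toFock proj h1 h2 h3 h4).a * (C.toFock proj h1 h2 h3 h4).E ^ k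
    = lin C.g (2 * (n + 1)) * quad C.g (2 * (n + 1)) ^ k := by
  rw [toFock_E, toFock_a]
  exact lin_mul_quad_pow C.gg (2 * n + 1) k

lemma toFock_F_dt (k : ℕ) : (C.toFock proj h1 h2 h3 h4).F ^ k * (C.toFock proj h1 h2 h3 h4).dt
    = lin C.h (2 * (n + 1)) * quad C.h (2 * (n + 1)) ^ k := by
  rw [toFock_F, toFock_dt, ((quad_lin C.hh _ _).pow_left k).eq]
  exact lin_mul_quad_pow C.hh (2 * n + 1) k

lemma toFock_commQuad {T : 𝔅} (hT : ∀ k < 2 * (n + 1), Commute (C.tl k) T) :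
    (C.toFock proj h1 h2 h3 h4).CommQuad T := by
  rcases Nat.eq_zero_or_pos n with rfl | hn
  · have : Commute ((C.toFock proj h1 h2 h3 h4).a * (C.toFock proj h1 h2 h3 h4).dt) T := by
      have h := hT 0 (by norm_num)
      rw [toFock_a, toFock_dt]
      simpa [tl, lin, Finset.sum_range_succ] using h
    exact ⟨fun i => i.1.elim0, fun i => i.1.elim0, fun i => i.1.elim0, this⟩
  · refine Fock.commQuad_of_pairs (commute_pairs (by omega) hT) ?_ ?_ ?_
    · rintro ⟨i, _ | _⟩
      · have h := C.lin_even_mem_pairs (m := i + 1) (by omega)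
        simpa [Fock.z, Fock.d, toFock, cr, an, crIdx, anIdx, mul_add] using h
      · have h := C.odd_mem_pairs (m := i) (by omega)
        simpa [Fock.z, Fock.d, toFock, cr, an, crIdx, anIdx, mul_add] using h
    · rw [toFock_a, toFock_dt]; exact C.lin_even_mem_pairs le_rfl
    · rw [toFock_a, toFock_dt]; exact C.lin_neg_mem_pairs

end Symmetry

end Chain

section OrderedSums

variable {𝔅 : Type*} [Ring 𝔅] [Algebra ℂ 𝔅] {α : Type*} [LinearOrder α]

/-- The sum of the ordered products of `v` over the subsets of `s` of cardinality `m`. -/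
def ordSum (v : α → 𝔅) (m : ℕ) (s : Finset α) : 𝔅 :=
  ∑ t ∈ s.powersetCard m, ((t.sort (· ≤ ·)).map v).prod

variable {v : α → 𝔅}

@[simp] lemma ordSum_zero (s : Finset α) : ordSum v 0 s = 1 := by simp [ordSum]

@[simp] lemma ordSum_succ_empty (m : ℕ) : ordSum v (m + 1) ∅ = 0 := by
  rw [ordSum, Finset.powersetCard_eq_empty.2 (by simp), Finset.sum_empty]

lemma ordSum_insert {x : α} {s : Finset α} (hx : ∀ y ∈ s, x < y) (m : ℕ) :
    ordSum v (m + 1) (insert x s) = ordSum v (m + 1) s + v x * ordSum v m s := by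
  have hxs : x ∉ s := fun h => lt_irrefl _ (hx x h)
  have hn : ∀ t ∈ s.powersetCard m, x ∉ t := fun t ht h => hxs ((Finset.mem_powersetCard.1 ht).1 h)
  rw [ordSum, Finset.powersetCard_succ_insert hxs, Finset.sum_union, Finset.sum_image, ordSum, ordSum,
    Finset.mul_sum]
  · congr 1
    refine Finset.sum_congr rfl fun t ht => ?_
    rw [Finset.sort_insert _ (fun y hy => (hx y ((Finset.mem_powersetCard.1 ht).1 hy)).le) (hn t ht),
      List.map_cons, List.prod_cons]
  · intro t ht t' ht' h
    rw [← Finset.erase_insert (hn t ht), ← Finset.erase_insert (hn t' ht'), h]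
  · rw [Finset.disjoint_left]
    intro t ht ht'
    obtain ⟨t', _, rfl⟩ := Finset.mem_image.1 ht'
    exact hxs ((Finset.mem_powersetCard.1 ht).1 (Finset.mem_insert_self x t'))

lemma ordSum_one (s : Finset α) : ordSum v 1 s = ∑ i ∈ s, v i := by
  induction s using Finset.induction_on_min with
  | empty => simp
  | insert x s hx ih =>
    rw [ordSum_insert hx, ih, Finset.sum_insert fun h => lt_irrefl _ (hx x h), ordSum_zero, mul_one,
      add_comm]

lemma ordSum_two (s : Finset α) :
    ordSum v 2 s = ∑ j ∈ s, ∑ i ∈ s, if i < j then v i * v j else 0 := by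
  induction s using Finset.induction_on_min with
  | empty => simp
  | insert x s hx ih =>
    have hxs : x ∉ s := fun h => lt_irrefl _ (hx x h)
    rw [ordSum_insert hx, ih, Finset.sum_insert hxs, Finset.sum_insert hxs, if_neg (lt_irrefl _),
      Finset.sum_eq_zero fun i hi => if_neg (hx i hi).asymm, ordSum_one, Finset.mul_sum]
    simp only [Finset.sum_insert hxs, Finset.sum_add_distrib, zero_add]
    rw [add_comm, Finset.sum_congr rfl fun i hi => if_pos (hx i hi)]

lemma sum_anti {w : 𝔅} (hw : ∀ i, v i * w = -(w * v i)) (s : Finset α) :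
    (∑ i ∈ s, v i) * w = -(w * ∑ i ∈ s, v i) := by
  simp only [Finset.mul_sum, Finset.sum_mul, ← Finset.sum_neg_distrib, hw]

lemma commute_ordSum_two (hv : ∀ i j, v i * v j = -(v j * v i)) (s : Finset α) (k : α) :
    Commute (ordSum v 2 s) (v k) := by
  rw [ordSum_two]
  refine Commute.sum_left _ _ _ fun j _ => Commute.sum_left _ _ _ fun i _ => ?_
  split_ifs
  · exact Fock.commute_mul_of_anti (hv _ _) (hv _ _)
  · exact Commute.zero_left _

lemma add_pow_of_sq_eq_zero {q r : 𝔅} (h : Commute q r) (hr : r * r = 0) (k : ℕ) :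
    (q + r) ^ (k + 1) = q ^ (k + 1) + (k + 1 : ℂ) • (r * q ^ k) := by
  induction k with
  | zero => simp
  | succ k ih =>
    rw [pow_succ', ih, add_mul, mul_add, mul_add, mul_smul_comm, mul_smul_comm, ← mul_assoc r r, hr,
      ← mul_assoc q r, h.eq, ← pow_succ' q (k + 1), mul_assoc, ← pow_succ' q k, zero_mul, smul_zero]
    push_cast
    module

/-- Ordered sums of anticommuting elements are divided powers of the quadratic sum. -/
lemma factorial_smul_ordSum (hv : ∀ i j, v i * v j = -(v j * v i)) (s : Finset α) (k : ℕ) :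
    (k.factorial : ℂ) • ordSum v (2 * k) s = ordSum v 2 s ^ k ∧
    (k.factorial : ℂ) • ordSum v (2 * k + 1) s = ordSum v 1 s * ordSum v 2 s ^ k := by
  induction s using Finset.induction_on_min generalizing k with
  | empty =>
    constructor
    · cases k with
      | zero => simp
      | succ k => rw [mul_add, mul_one, ordSum_succ_empty, ordSum_succ_empty, smul_zero, zero_pow (by omega)]
    · simp
  | insert x s hx ih =>
    have hq := commute_ordSum_two hv s x
    have ha : ordSum v 1 s * v x = -(v x * ordSum v 1 s) := by rw [ordSum_one]; exact sum_anti (fun i => hv i x) s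
    have hx2 : v x * v x = 0 := Fock.eq_zero_of_eq_neg (hv x x)
    have ha2 : ordSum v 1 s * ordSum v 1 s = 0 := by
      rw [ordSum_one]
      exact Fock.eq_zero_of_eq_neg (sum_anti (fun i => by rw [sum_anti (fun j => hv j i), neg_neg]) s)
    have hqa : Commute (ordSum v 2 s) (ordSum v 1 s) := by
      rw [ordSum_one]; exact Commute.sum_right _ _ _ fun i _ => commute_ordSum_two hv s i
    have hr : v x * ordSum v 1 s * (v x * ordSum v 1 s) = 0 := by
      rw [mul_assoc, ← mul_assoc (ordSum v 1 s), ha, neg_mul, mul_assoc, ha2]; simp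
    have hpow := add_pow_of_sq_eq_zero (hq.mul_right hqa) hr
    have h2 : ordSum v 2 (insert x s) = ordSum v 2 s + v x * ordSum v 1 s := ordSum_insert hx 1
    have h1 : ordSum v 1 (insert x s) = ordSum v 1 s + v x := by
      have := ordSum_insert (v := v) hx 0; simpa using this
    rw [h1, h2, ordSum_insert hx]
    constructor
    · cases k with
      | zero => simp
      | succ k =>
        have h3 : ordSum v (2 * (k + 1)) (insert x s)
            = ordSum v (2 * (k + 1)) s + v x * ordSum v (2 * k + 1) s := ordSum_insert hx (2 * k + 1)
        rw [hpow, h3, smul_add, (ih (k + 1)).1, ← mul_smul_comm, Nat.factorial_succ, Nat.cast_mul,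
          mul_smul, (ih k).2, mul_smul_comm, mul_assoc]
        push_cast
        rfl
    · rw [smul_add, ← mul_smul_comm, (ih k).1, (ih k).2]
      cases k with
      | zero => simp
      | succ k =>
        rw [hpow, add_mul, mul_add, mul_add, mul_smul_comm, mul_smul_comm]
        have e1 : ordSum v 1 s * (v x * ordSum v 1 s * ordSum v 2 s ^ k) = 0 := by
          rw [← mul_assoc, ← mul_assoc, ha, neg_mul, mul_assoc (v x), ha2]; simp
        have e2 : v x * (v x * ordSum v 1 s * ordSum v 2 s ^ k) = 0 := by
          rw [← mul_assoc, ← mul_assoc, hx2]; simp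
        rw [e1, e2]; simp

end OrderedSums

namespace Chain

variable {𝔅 : Type*} [Ring 𝔅] [Algebra ℂ 𝔅] {L : ℕ}

section Top

variable (v : ℕ → 𝔅)

/-- The ordered product of `v k` over `k < m`. -/
def top (m : ℕ) : 𝔅 := ((List.range m).map v).prod

@[simp] lemma top_zero : top v 0 = 1 := rfl

lemma top_succ (m : ℕ) : top v (m + 1) = top v m * v m := by simp [top, List.range_succ]

lemma top_succ' (m : ℕ) : top v (m + 1) = v 0 * top (fun k => v (k + 1)) m := by
  simp [top, List.range_succ_eq_map, Function.comp_def]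

variable {v}

lemma mul_top_of_anti {w : 𝔅} {m : ℕ} (hw : ∀ k < m, w * v k = -(v k * w)) :
    w * top v m = (-1 : ℂ) ^ m • (top v m * w) := by
  induction m with
  | zero => simp
  | succ m ih =>
    rw [top_succ, ← mul_assoc, ih fun k hk => hw k (by omega), smul_mul_assoc, mul_assoc, hw m (by omega),
      pow_succ, mul_neg_one, neg_smul, mul_neg, smul_neg, mul_assoc]

lemma top_mul (hv : ∀ j k, v j * v k = -(v k * v j)) {m k : ℕ} (hk : k < m) : top v m * v k = 0 := by
  induction m with
  | zero => omega
  | succ m ih =>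
    rw [top_succ, mul_assoc]
    rcases (by omega : k = m ∨ k < m) with rfl | h
    · rw [sq_eq_zero hv, mul_zero]
    · rw [hv, mul_neg, ← mul_assoc, ih h, zero_mul, neg_zero]

lemma mul_top (hv : ∀ j k, v j * v k = -(v k * v j)) {m k : ℕ} (hk : k < m) : v k * top v m = 0 := by
  rw [mul_top_of_anti fun j _ => hv k j, top_mul hv hk, smul_zero]

variable {N : ℕ}

lemma lin_shift (hN : ∀ k, v (k + N) = v k) : lin (fun k => v (k + 1)) N = lin v N := by
  have h := (lin_succ' v N).symm.trans (lin_succ v N)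
  rw [← zero_add N, hN 0, zero_add, add_comm] at h
  exact add_right_cancel h

lemma lin_shift_two (hN : ∀ k, v (k + N) = v k) : lin (fun k => v (k + 2)) N = lin v N := by
  rw [← lin_shift hN]
  exact lin_shift (v := fun k => v (k + 1)) fun k => by rw [add_right_comm, hN]

lemma lin_quad_pow_shift (hv : ∀ j k, v j * v k = -(v k * v j)) (hN : ∀ k, v (k + N) = v k) (k : ℕ) :
    lin (fun k => v (k + 1)) N * quad (fun k => v (k + 1)) N ^ k = lin v N * quad v N ^ k := by
  rw [lin_shift hN]
  have h := (quad_succ' v N).symm.trans (quad_succ v N)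
  have h0 : v N = v 0 := by simpa using hN 0
  rw [lin_shift hN, h0, ← eq_sub_iff_add_eq, mul_lin hv, sub_neg_eq_add] at h
  refine lin_mul_quad_pow_eq ?_ ?_ k
  · exact commute_quad (fun k => mul_lin hv _ _) _
  · rw [h, mul_add, mul_add, ← mul_assoc, lin_sq hv]; simp

lemma lin_quad_pow_shift_two (hv : ∀ j k, v j * v k = -(v k * v j)) (hN : ∀ k, v (k + N) = v k)
    (k : ℕ) : lin (fun k => v (k + 2)) N * quad (fun k => v (k + 2)) N ^ k = lin v N * quad v N ^ k := by
  rw [← lin_quad_pow_shift hv hN]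
  exact lin_quad_pow_shift (v := fun k => v (k + 1)) (fun _ _ => hv _ _)
    (fun k => by rw [add_right_comm, hN]) k

lemma top_shift (hv : ∀ j k, v j * v k = -(v k * v j)) {M : ℕ} (hN : ∀ k, v (k + (M + 1)) = v k) :
    top (fun k => v (k + 1)) (M + 1) = (-1 : ℂ) ^ M • top v (M + 1) := by
  have h0 : v (M + 1) = v 0 := by simpa using hN 0
  rw [top_succ, top_succ', h0, mul_top_of_anti fun k _ => hv 0 (k + 1), smul_smul, ← mul_pow]
  simp

lemma top_shift_two (hv : ∀ j k, v j * v k = -(v k * v j)) (hN : ∀ k, v (k + N) = v k) :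
    top (fun k => v (k + 2)) N = top v N := by
  cases N with
  | zero => rfl
  | succ M =>
    have h := top_shift (v := fun k => v (k + 1)) (fun _ _ => hv _ _)
      (M := M) (fun k => by rw [add_right_comm, hN])
    rw [top_shift hv hN, smul_smul, ← mul_pow] at h
    simpa using h

end Top

section Generators

variable (C : Chain 𝔅 L)

/-- The particle number operator. -/
def num : 𝔅 := lin (fun k => (-1 : ℂ) ^ (k + 1) • (C.g k * C.h k)) (2 * L)

lemma num_swap : C.swap.num = (2 * L : ℂ) • 1 - C.num := by
  have key : ∀ m, lin (fun k => (-1 : ℂ) ^ (k + 1) • (C.h k * C.g k)) m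
      = (m : ℂ) • 1 - lin (fun k => (-1 : ℂ) ^ (k + 1) • (C.g k * C.h k)) m := by
    intro m
    induction m with
    | zero => simp
    | succ m ih =>
      have e : (-1 : ℂ) ^ (m + 1) * (-1) ^ (m + 1) = 1 := by rw [← mul_pow]; simp
      rw [lin_succ, ih, C.hg, if_pos rfl, smul_sub, smul_smul, e, lin_succ]
      push_cast
      module
  have h := key (2 * L)
  push_cast at h
  exact h

lemma num_g {k : ℕ} (hk : k < 2 * L) : C.num * C.g k = C.g k * C.num + C.g k := by
  have key : ∀ m ≤ 2 * L, lin (fun k => (-1 : ℂ) ^ (k + 1) • (C.g k * C.h k)) m * C.g k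
      = C.g k * lin (fun k => (-1 : ℂ) ^ (k + 1) • (C.g k * C.h k)) m
        + if k < m then C.g k else 0 := by
    intro m hm
    induction m with
    | zero => simp
    | succ m ih =>
      rw [lin_succ, add_mul, ih (by omega), smul_mul_assoc, mul_assoc, C.hg_of_lt (by omega) hk, mul_add,
        mul_sub, ← mul_assoc (C.g m), C.gg m k]
      rcases lt_trichotomy k m with h | rfl | h
      · rw [if_pos h, if_neg h.ne', if_pos (by omega)]
        simp only [zero_smul, mul_zero, neg_mul, mul_assoc, mul_smul_comm]; module
      · have e : (-1 : ℂ) ^ (k + 1) * (-1) ^ (k + 1) = 1 := by rw [← mul_pow]; simp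
        rw [if_neg (lt_irrefl _), if_pos rfl, if_pos (by omega), mul_smul_comm, smul_sub, smul_smul, e]
        simp only [neg_mul, mul_assoc, mul_smul_comm, mul_one]; module
      · rw [if_neg h.not_gt, if_neg h.ne, if_neg (by omega)]
        simp only [zero_smul, mul_zero, neg_mul, mul_assoc, mul_smul_comm]; module
  simpa [num, hk] using key (2 * L) le_rfl

lemma num_h {k : ℕ} (hk : k < 2 * L) : C.num * C.h k = C.h k * C.num - C.h k := by
  have h := C.swap.num_g hk
  rw [num_swap, sub_mul, mul_sub, smul_mul_assoc, one_mul, mul_smul_comm, mul_one] at h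
  change _ - C.num * C.h k = _ - C.h k * C.num + C.h k at h
  rw [sub_add, sub_right_inj] at h
  exact h

lemma g_mod (k : ℕ) : C.g k = C.g (k % (2 * L)) := by
  conv_lhs => rw [← Nat.mod_add_div' k (2 * L)]
  induction k / (2 * L) with
  | zero => simp
  | succ m ih => rw [add_mul, one_mul, ← add_assoc, C.g_add, ih]

lemma h_mod (k : ℕ) : C.h k = C.h (k % (2 * L)) := C.swap.g_mod k

lemma commute_num_tl (hL : 0 < L) (k : ℕ) : Commute C.num (C.tl k) := by
  have hg : ∀ k, C.num * C.g k = C.g k * C.num + C.g k := fun k => by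
    rw [g_mod]; exact C.num_g (Nat.mod_lt _ (by omega))
  have hh : ∀ k, C.num * C.h k = C.h k * C.num - C.h k := fun k => by
    rw [h_mod]; exact C.num_h (Nat.mod_lt _ (by omega))
  have hA : C.num * (C.g k + C.g (k + 1)) = (C.g k + C.g (k + 1)) * (C.num + 1) := by
    rw [mul_add, hg, hg, add_mul, mul_add, mul_add, mul_one, mul_one]
  have hB : C.num * (C.h k + C.h (k + 1)) = (C.h k + C.h (k + 1)) * (C.num - 1) := by
    rw [mul_add, hh, hh, add_mul, mul_sub, mul_sub, mul_one, mul_one]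
  rw [commute_iff_eq, tl, ← mul_assoc, hA, mul_assoc, add_mul C.num, hB, mul_assoc, mul_sub, mul_one, one_mul,
    sub_add_cancel]

lemma top_tl (hL : 0 < L) (k : ℕ) : top C.g (2 * L) * C.tl k = 0 := by
  rw [tl, ← mul_assoc, mul_add _ (C.g k), C.g_mod k, C.g_mod (k + 1), top_mul C.gg (Nat.mod_lt _ (by omega)),
    top_mul C.gg (Nat.mod_lt _ (by omega)), add_zero, zero_mul]

lemma tl_top (hL : 0 < L) (k : ℕ) : C.tl k * top C.g (2 * L) = 0 := by
  have h := C.swap_tl k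
  rw [tl] at h
  change (C.h k + C.h (k + 1)) * (C.g k + C.g (k + 1)) = _ at h
  rw [← neg_eq_zero, ← neg_mul, ← h, mul_assoc, add_mul (C.g k), C.g_mod k, C.g_mod (k + 1),
    mul_top C.gg (Nat.mod_lt _ (by omega)), mul_top C.gg (Nat.mod_lt _ (by omega)), add_zero, mul_zero]

lemma commute_top (hL : 0 < L) (k : ℕ) : Commute (top C.g (2 * L)) (C.tl k) :=
  (C.top_tl hL k).trans (C.tl_top hL k).symm

/-- The generators of the symmetry algebra of the chain. -/
def symGens : Set 𝔅 :=
  {T | (∃ k : ℕ, T = lin C.g (2 * L) * quad C.g (2 * L) ^ k) ∨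
    (∃ k : ℕ, T = lin C.h (2 * L) * quad C.h (2 * L) ^ k) ∨
    T = top C.g (2 * L) ∨ T = top C.h (2 * L) ∨ T = C.num}

lemma commute_symGens (hL : 0 < L) {T : 𝔅} (hT : T ∈ C.symGens) {k : ℕ} (hk : k < 2 * L) :
    Commute T (C.tl k) := by
  rcases hT with ⟨m, rfl⟩ | ⟨m, rfl⟩ | rfl | rfl | rfl
  · exact C.commute_lin_quad_pow hL hk m
  · exact C.commute_lin_quad_pow_h hL hk m
  · exact C.commute_top hL k
  · have h := (C.swap.commute_top hL k).neg_right
    rwa [swap_tl, neg_neg] at h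
  · exact C.commute_num_tl hL k

section Translation

variable (φ : 𝔅 →ₐ[ℂ] 𝔅)

lemma map_lin (v : ℕ → 𝔅) (m : ℕ) : φ (lin v m) = lin (fun k => φ (v k)) m := map_sum _ _ _

lemma map_quad (v : ℕ → 𝔅) (m : ℕ) : φ (quad v m) = quad (fun k => φ (v k)) m := by
  simp only [quad, map_sum, map_mul, map_lin]

lemma map_top (v : ℕ → 𝔅) (m : ℕ) : φ (top v m) = top (fun k => φ (v k)) m := by
  simp only [top, map_list_prod, List.map_map, Function.comp_def]

/-- The symmetry generators are invariant under translation by two sites. -/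
lemma map_symGens (hg : ∀ k, φ (C.g k) = C.g (k + 2)) (hh : ∀ k, φ (C.h k) = C.h (k + 2)) {T : 𝔅}
    (hT : T ∈ C.symGens) : φ T = T := by
  rcases hT with ⟨m, rfl⟩ | ⟨m, rfl⟩ | rfl | rfl | rfl
  · simp only [map_mul, map_pow, map_lin, map_quad, hg]
    exact lin_quad_pow_shift_two C.gg C.g_add m
  · simp only [map_mul, map_pow, map_lin, map_quad, hh]
    exact lin_quad_pow_shift_two C.hh C.h_add m
  · simp only [map_top, hg]; exact top_shift_two C.gg C.g_add
  · simp only [map_top, hh]; exact top_shift_two C.hh C.h_add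
  · simp only [num, map_lin, map_smul, map_mul, hg, hh]
    refine Eq.trans ?_ (lin_shift_two (v := fun k => (-1 : ℂ) ^ (k + 1) • (C.g k * C.h k)) ?_)
    · simp only [pow_add, mul_one, even_two, Even.neg_pow, one_pow]
    · intro k
      rw [C.g_add, C.h_add, add_right_comm, pow_add _ (k + 1), (even_two_mul L).neg_one_pow, mul_one]

end Translation

end Generators

end Chain

/-- The spectral projections are polynomials in the particle number. -/
lemma Fock.proj_mem_adjoin_num {𝔅 : Type*} [Ring 𝔅] [Algebra ℂ 𝔅] {ι : Type*} [Fintype ι]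
    [DecidableEq ι] (K : Fock 𝔅 ι) (p : ℤ) : K.proj p ∈ Algebra.adjoin ℂ {K.num} := by
  by_cases hp : p < 0 ∨ (Fintype.card ι + 2 : ℤ) < p
  · rw [K.proj_eq_zero hp]; exact Subalgebra.zero_mem _
  lift p to ℕ using by omega
  let s := (Finset.range (Fintype.card ι + 3)).erase p
  let Q : Polynomial ℂ := ∏ q ∈ s, (Polynomial.X - Polynomial.C (q : ℂ))
  have hQ : ∀ (R : Polynomial ℂ) (r : ℕ),
      Polynomial.aeval K.num R * K.proj r = R.eval (r : ℂ) • K.proj r := by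
    intro R r
    induction R using Polynomial.induction_on' with
    | add P Q hP hQ => rw [map_add, add_mul, hP, hQ, Polynomial.eval_add, add_smul]
    | monomial m c =>
      have : ∀ m : ℕ, K.num ^ m * K.proj r = (r : ℂ) ^ m • K.proj r := by
        intro m
        induction m with
        | zero => simp
        | succ m ih =>
          rw [pow_succ, mul_assoc, K.num_proj, Int.cast_natCast, mul_smul_comm, ih, smul_smul,
            pow_succ, mul_comm]
      rw [Polynomial.aeval_monomial, mul_assoc, this, Polynomial.eval_monomial, mul_smul,
        Algebra.algebraMap_eq_smul_one, smul_mul_assoc, one_mul]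
  have h0 : Q.eval (p : ℂ) ≠ 0 := by
    rw [Polynomial.eval_prod, Finset.prod_ne_zero_iff]
    intro q hq
    simp only [Polynomial.eval_sub, Polynomial.eval_X, Polynomial.eval_C, sub_ne_zero]
    exact_mod_cast (Finset.ne_of_mem_erase hq).symm
  have h1 : Polynomial.aeval K.num Q = Q.eval (p : ℂ) • K.proj p := by
    rw [← mul_one (Polynomial.aeval K.num Q), ← K.sum_proj, Finset.mul_sum,
      Finset.sum_eq_single p, hQ]
    · intro r hr hrp
      rw [hQ, Polynomial.eval_prod, Finset.prod_eq_zero (Finset.mem_erase.2 ⟨hrp, hr⟩), zero_smul]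
      simp
    · intro h; simp at h; omega
  have h2 : K.proj p = (Q.eval (p : ℂ))⁻¹ • Polynomial.aeval K.num Q := by
    rw [h1, smul_smul, inv_mul_cancel₀ h0, one_smul]
  rw [h2]
  exact Subalgebra.smul_mem _ (Polynomial.aeval_mem_adjoin_singleton ℂ K.num) _

namespace Chain

variable {𝔅 : Type*} [Ring 𝔅] [Algebra ℂ 𝔅]

lemma top_mul_top {L : ℕ} (C : Chain 𝔅 L) {p : 𝔅} (hp : ∀ k < 2 * L, C.h k * p = 0) {m : ℕ}
    (hm : m ≤ 2 * L) : ∃ s : ℂ, s ≠ 0 ∧ top C.h m * top C.g m * p = s • p := by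
  induction m with
  | zero => exact ⟨1, one_ne_zero, by simp⟩
  | succ m ih =>
    obtain ⟨s, hs, h⟩ := ih (by omega)
    refine ⟨(-1) ^ m * ((-1) ^ (m + 1) * s), by simp [hs], ?_⟩
    have e : C.h m * C.g m * p = (-1 : ℂ) ^ (m + 1) • p := by
      rw [C.hg, if_pos rfl, sub_mul, mul_assoc, hp m (by omega), mul_zero, sub_zero, smul_mul_assoc,
        one_mul]
    have e2 : C.h m * top C.g m = (-1 : ℂ) ^ m • (top C.g m * C.h m) :=
      mul_top_of_anti fun k hk => by
        rw [C.hg_of_lt (by omega) (by omega), if_neg (by omega), zero_smul, zero_sub]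
    calc top C.h (m + 1) * top C.g (m + 1) * p
        = top C.h m * (C.h m * top C.g m) * (C.g m * p) := by
          rw [top_succ, top_succ]; simp only [mul_assoc]
      _ = (-1 : ℂ) ^ m • (top C.h m * top C.g m * (C.h m * C.g m * p)) := by
          rw [e2, mul_smul_comm, smul_mul_assoc]; simp only [mul_assoc]
      _ = _ := by rw [e, mul_smul_comm, h, smul_smul, smul_smul, mul_assoc]

lemma top_mul_num {L : ℕ} (C : Chain 𝔅 L) : top C.g (2 * L) * C.num = 0 := by
  rw [num, lin, Finset.mul_sum]
  refine Finset.sum_eq_zero fun k hk => ?_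
  rw [mul_smul_comm, ← mul_assoc, top_mul C.gg (Finset.mem_range.1 hk), zero_mul, smul_zero]

/-- The commutant of the Temperley–Lieb generators and the translation is generated by the symmetry
generators. -/
theorem centralizer_eq {n : ℕ} (C : Chain 𝔅 (n + 1)) (proj : ℤ → 𝔅)
    (h1 : ∀ p q, proj p * proj q = if p = q then proj p else 0)
    (h2 : ∑ p ∈ Finset.range (2 * n + 3), proj p = 1)
    (h3 : C.num = ∑ p ∈ Finset.range (2 * n + 3), (p : ℂ) • proj p)
    (h4 : ∀ S : 𝔅, ∃ c : ℂ, proj 0 * S * proj 0 = c • proj 0) (u : 𝔅ˣ)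
    (hg : ∀ k, u * C.g k * ↑u⁻¹ = C.g (k + 2)) (hh : ∀ k, u * C.h k * ↑u⁻¹ = C.h (k + 2)) :
    Subalgebra.centralizer ℂ ({T | ∃ k < 2 * (n + 1), T = C.tl k} ∪ {(u : 𝔅), ((u⁻¹ : 𝔅ˣ) : 𝔅)})
      = Algebra.adjoin ℂ C.symGens := by
  have hu : ∀ T ∈ C.symGens, Commute (u : 𝔅) T := by
    intro T hT
    let φ : 𝔅 →ₐ[ℂ] 𝔅 := AlgHom.ofLinearMap
      ((LinearMap.mulRight ℂ ((u⁻¹ : 𝔅ˣ) : 𝔅)).comp (LinearMap.mulLeft ℂ (u : 𝔅)))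
      (by simp) (fun x y => by simp [mul_assoc])
    have h : u * T * ↑u⁻¹ = T := C.map_symGens φ hg hh hT
    rw [commute_iff_eq]
    nth_rewrite 2 [← h]
    simp [mul_assoc]
  apply le_antisymm
  · intro T hT
    rw [Subalgebra.mem_centralizer_iff] at hT
    have h3' : ∑ k ∈ Finset.range (2 * (n + 1)), (-1 : ℂ) ^ (k + 1) • (C.g k * C.h k)
        = ∑ p ∈ Finset.range (2 * n + 3), (p : ℂ) • proj p := h3
    set K := C.toFock proj h1 h2 h3' h4 with hK
    have hnum : K.num = C.num := C.sum_modes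
    have hN : (Fintype.card (Fin n × Bool) + 2 : ℤ) = 2 * (n + 1) := by simp; ring
    have hsym : K.IsSymm (Algebra.adjoin ℂ C.symGens) :=
      { comm := fun X hX => C.toFock_commQuad fun k hk => by
          have : Algebra.adjoin ℂ C.symGens ≤ Subalgebra.centralizer ℂ {C.tl k} :=
            Algebra.adjoin_le fun Y hY => by
              rw [SetLike.mem_coe, Subalgebra.mem_centralizer_iff]
              rintro _ rfl
              exact (C.commute_symGens (by omega) hY hk).symm
          exact Subalgebra.mem_centralizer_iff ℂ |>.1 (this hX) _ rfl
        proj_mem := fun p => by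
          refine Algebra.adjoin_mono ?_ (K.proj_mem_adjoin_num p)
          rw [hnum, Set.singleton_subset_iff]
          simp [symGens]
        a_E_mem := fun k => by
          rw [hK, toFock_a_E]; exact Algebra.subset_adjoin (.inl ⟨k, rfl⟩)
        F_dt_mem := fun k => by
          rw [hK, toFock_F_dt]; exact Algebra.subset_adjoin (.inr (.inl ⟨k, rfl⟩)) }
    have hdg : ∀ k < 2 * (n + 1), K.Deg 1 (C.g k) := fun k hk => by
      rw [Fock.Deg, hnum, C.num_g hk]; simp
    have hdh : ∀ k < 2 * (n + 1), K.Deg (-1) (C.h k) := fun k hk => by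
      rw [Fock.Deg, hnum, C.num_h hk]; simp [sub_eq_add_neg]
    have e0 : ∀ k < 2 * (n + 1), C.h k * K.proj 0 = 0 := fun k hk => by
      rw [(hdh k hk).mul_proj, K.proj_eq_zero (by omega), zero_mul]
    have e1 : ∀ k < 2 * (n + 1), C.g k * K.proj (Fintype.card (Fin n × Bool) + 2) = 0 := fun k hk => by
      rw [(hdg k hk).mul_proj, K.proj_eq_zero (by omega), zero_mul]
    obtain ⟨s, hs, hs'⟩ := C.top_mul_top e0 le_rfl
    obtain ⟨r, hr, hr'⟩ := C.swap.top_mul_top e1 le_rfl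
    have t0 : top C.g (2 * (n + 1)) * K.proj 0 = top C.g (2 * (n + 1)) := by
      rw [K.mul_proj_of_mul_num (q := 0), if_pos rfl]
      rw [hnum, C.top_mul_num]; simp
    have t1 : top C.h (2 * (n + 1)) * K.proj (Fintype.card (Fin n × Bool) + 2)
        = top C.h (2 * (n + 1)) := by
      rw [K.mul_proj_of_mul_num (q := Fintype.card (Fin n × Bool) + 2), if_pos rfl]
      have h := C.swap.top_mul_num
      rw [num_swap, mul_sub, sub_eq_zero, mul_smul_comm, mul_one] at h
      rw [hnum, hN]
      push_cast at h ⊢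
      exact h.symm
    rw [mul_assoc, t0] at hs'
    change top C.g _ * top C.h _ * _ = _ at hr'
    rw [mul_assoc, t1] at hr'
    have hrs : top C.g (2 * (n + 1)) * top C.h (2 * (n + 1))
        = s • K.proj (Fintype.card (Fin n × Bool) + 2) := by
      have h : (r * s) • K.proj (Fintype.card (Fin n × Bool) + 2)
          = (r * r) • K.proj (Fintype.card (Fin n × Bool) + 2) := by
        have h5 : top C.g (2 * (n + 1)) * (top C.h (2 * (n + 1)) * top C.g (2 * (n + 1)))
            * top C.h (2 * (n + 1)) = (r * s) • K.proj (Fintype.card (Fin n × Bool) + 2) := by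
          rw [hs', mul_smul_comm, t0, smul_mul_assoc, hr', smul_smul, mul_comm]
        rw [← h5, ← mul_assoc, hr', mul_assoc, hr', smul_mul_smul_comm, K.proj_mul, if_pos rfl]
      rw [mul_smul, mul_smul] at h
      rw [hr']
      exact ((smul_right_injective 𝔅 hr) h).symm
    refine hsym.mem (U := s⁻¹ • top C.g (2 * (n + 1))) (U' := top C.h (2 * (n + 1)))
      (Subalgebra.smul_mem _ (Algebra.subset_adjoin (by simp [symGens])) _)
      (Algebra.subset_adjoin (by simp [symGens])) ?_ ?_ ?_
    · rw [mul_smul_comm, hs', smul_smul, inv_mul_cancel₀ hs, one_smul]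
    · rw [smul_mul_assoc, hrs, smul_smul, inv_mul_cancel₀ hs, one_smul]
    · exact C.toFock_commQuad fun k hk => hT _ (.inl ⟨k, hk, rfl⟩)
  · refine Algebra.adjoin_le fun T hT => ?_
    rw [SetLike.mem_coe, Subalgebra.mem_centralizer_iff]
    rintro _ (⟨k, hk, rfl⟩ | rfl | rfl)
    · exact (C.commute_symGens (by omega) hT hk).symm
    · exact hu T hT
    · exact ((hu T hT).units_inv_left)

end Chain

namespace Chain

section Permutations

variable {𝔅 : Type*} [Ring 𝔅] [Algebra ℂ 𝔅] {L : ℕ} (C : Chain 𝔅 L)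

/-- Two sites of equal parity are exchanged by conjugation with an invertible operator. -/
lemma exists_swap {j k : ℕ} (hj : j < 2 * L) (hk : k < 2 * L) (hjk : j ≠ k) (hp : j % 2 = k % 2) :
    ∃ u : 𝔅ˣ, ∀ l < 2 * L, u * C.g l = C.g (Equiv.swap j k l) * u ∧
      u * C.h l = C.h (Equiv.swap j k l) * u := by
  have hκ : (-1 : ℂ) ^ (j + 1) * (-1) ^ (j + 1) = 1 := by rw [← mul_pow]; simp
  have hκ' : (-1 : ℂ) ^ (k + 1) = (-1) ^ (j + 1) := by
    rw [neg_one_pow_eq_pow_mod_two, neg_one_pow_eq_pow_mod_two (n := j + 1)]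
    congr 1; omega
  obtain ⟨κ, hκe⟩ : ∃ κ : ℂ, κ = (-1) ^ (j + 1) := ⟨_, rfl⟩
  rw [← hκe] at hκ hκ'
  obtain ⟨A, hA⟩ : ∃ A, A = C.g j - C.g k := ⟨_, rfl⟩
  obtain ⟨B, hB⟩ : ∃ B, B = κ • (C.h j - C.h k) := ⟨_, rfl⟩
  have gA : ∀ l, A * C.g l = -(C.g l * A) := fun l => by
    rw [hA, sub_mul, mul_sub, C.gg j, C.gg k]; abel
  have hBh : ∀ l, C.h l * B = -(B * C.h l) := fun l => by
    rw [hB, smul_mul_assoc, mul_smul_comm, sub_mul, mul_sub, C.hh l j, C.hh l k, ← smul_neg]; congr 1; abel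
  have hBg : ∀ l < 2 * L, B * C.g l
      = ((if j = l then 1 else 0) - (if k = l then 1 else 0) : ℂ) • 1 - C.g l * B := fun l hl => by
    have e : ((if j = l then 1 else 0) - (if k = l then 1 else 0) : ℂ)
        = κ * ((if j = l then κ else 0) - (if k = l then κ else 0)) := by
      rw [mul_sub, mul_ite, mul_ite, hκ, mul_zero]
    rw [hB, smul_mul_assoc, sub_mul, C.hg_of_lt hj hl, C.hg_of_lt hk hl, hκ', ← hκe, mul_smul_comm,
      mul_sub, e]
    module
  have hhA : ∀ l < 2 * L, C.h l * A
      = ((if l = j then κ else 0) - (if l = k then κ else 0) : ℂ) • 1 - A * C.h l := fun l hl => by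
    have e1 : (if l = j then (-1 : ℂ) ^ (l + 1) else 0) = if l = j then κ else 0 := by
      split_ifs with h
      · rw [h, hκe]
      · rfl
    have e2 : (if l = k then (-1 : ℂ) ^ (l + 1) else 0) = if l = k then κ else 0 := by
      split_ifs with h
      · rw [h, hκ']
      · rfl
    rw [hA, mul_sub, C.hg_of_lt hl hj, C.hg_of_lt hl hk, sub_mul, e1, e2]
    module
  have hAA : A * A = 0 := by
    nth_rewrite 2 [hA]
    rw [mul_sub, gA, gA, hA, mul_sub, mul_sub, sq_eq_zero C.gg, sq_eq_zero C.gg, C.gg k j]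
    abel
  have hBA : B * A = (2 : ℂ) • 1 - A * B := by
    nth_rewrite 1 [hA]
    rw [mul_sub, hBg j hj, hBg k hk, if_pos rfl, if_neg hjk.symm, if_neg hjk, if_pos rfl, hA, sub_mul]
    module
  have hBB : B * B = 0 := by
    nth_rewrite 1 [hB]
    rw [smul_mul_assoc, sub_mul, hBh, hBh, hB, smul_mul_assoc, smul_mul_assoc, sub_mul, sub_mul,
      sq_eq_zero C.hh, sq_eq_zero C.hh, C.hh k j]
    module
  have hBAB : B * (A * B) = (2 : ℂ) • B := by
    rw [← mul_assoc, hBA, sub_mul, mul_assoc, hBB, mul_zero, sub_zero, smul_mul_assoc, one_mul]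
  have hs : (1 - A * B) * (1 - A * B) = 1 := by
    rw [mul_sub, mul_one, sub_mul, one_mul, mul_assoc, hBAB, mul_smul_comm]
    module
  have sg : ∀ l < 2 * L, (1 - A * B) * C.g l = C.g l * (1 - A * B)
      - ((if j = l then 1 else 0) - (if k = l then 1 else 0) : ℂ) • A := fun l hl => by
    rw [sub_mul, mul_assoc, hBg l hl, mul_sub, ← mul_assoc A, gA, mul_sub, mul_smul_comm]
    simp only [one_mul, mul_one, neg_mul, mul_assoc]
    abel
  have sh : ∀ l < 2 * L, (1 - A * B) * C.h l = C.h l * (1 - A * B)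
      + ((if l = j then κ else 0) - (if l = k then κ else 0) : ℂ) • B := fun l hl => by
    rw [sub_mul, mul_sub, ← mul_assoc (C.h l), hhA l hl, sub_mul, mul_assoc A, mul_assoc A (C.h l),
      hBh, smul_mul_assoc]
    simp only [one_mul, mul_one, mul_neg]
    abel
  have g_eq : (C.g j - C.g k) * (1 - A * B) = A := by
    rw [← hA, mul_sub, ← mul_assoc, hAA]; simp
  have h_eq : (C.h j - C.h k) * (1 - A * B) = -(κ • B) := by
    have e : C.h j - C.h k = κ • B := by rw [hB, smul_smul, hκ, one_smul]
    rw [e, smul_mul_assoc, mul_sub, mul_one, hBAB]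
    module
  rw [sub_mul, sub_eq_iff_eq_add] at g_eq h_eq
  refine ⟨⟨1 - A * B, 1 - A * B, hs, hs⟩, fun l hl => ⟨?_, ?_⟩⟩
  · change (1 - A * B) * C.g l = C.g _ * (1 - A * B)
    rw [sg l hl]
    by_cases h1 : j = l
    · subst h1
      rw [Equiv.swap_apply_left, if_pos rfl, if_neg hjk.symm, g_eq]
      module
    by_cases h2 : k = l
    · subst h2
      rw [Equiv.swap_apply_right, if_neg hjk, if_pos rfl, g_eq]
      module
    rw [Equiv.swap_apply_of_ne_of_ne (Ne.symm h1) (Ne.symm h2), if_neg h1, if_neg h2]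
    simp
  · change (1 - A * B) * C.h l = C.h _ * (1 - A * B)
    rw [sh l hl]
    by_cases h1 : l = j
    · subst h1
      rw [Equiv.swap_apply_left, if_pos rfl, if_neg hjk, h_eq]
      module
    by_cases h2 : l = k
    · subst h2
      rw [Equiv.swap_apply_right, if_neg hjk.symm, if_pos rfl, h_eq]
      module
    rw [Equiv.swap_apply_of_ne_of_ne h1 h2, if_neg h1, if_neg h2]
    simp

/-- Permutations of the unit cells are implemented by conjugation with invertible operators. -/
lemma exists_perm (σ : Equiv.Perm (Fin L)) : ∃ u : 𝔅ˣ, ∀ (i : Fin L) (r : ℕ), r < 2 →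
    u * C.g (2 * i + r) = C.g (2 * σ i + r) * u ∧ u * C.h (2 * i + r) = C.h (2 * σ i + r) * u := by
  induction σ using Equiv.Perm.swap_induction_on with
  | one => exact ⟨1, fun i r _ => by simp⟩
  | swap_mul σ x y hxy ih =>
    obtain ⟨u, hu⟩ := ih
    have hxy' : (x : ℕ) ≠ y := fun h => hxy (Fin.ext h)
    obtain ⟨v, hv⟩ := C.exists_swap (j := 2 * x) (k := 2 * y) (by omega) (by omega) (by omega) (by omega)
    obtain ⟨w, hw⟩ := C.exists_swap (j := 2 * x + 1) (k := 2 * y + 1) (by omega) (by omega) (by omega)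
      (by omega)
    refine ⟨w * v * u, fun i r hr => ?_⟩
    obtain ⟨l, hl⟩ : ∃ l, l = σ i := ⟨_, rfl⟩
    have h0 : Equiv.swap (2 * x + 1 : ℕ) (2 * y + 1) (Equiv.swap (2 * x : ℕ) (2 * y) (2 * l + r))
        = 2 * (Equiv.swap x y l : Fin L) + r := by
      simp only [Equiv.swap_apply_def, Fin.ext_iff]
      split_ifs <;> omega
    have h1 : Equiv.swap (2 * x : ℕ) (2 * y) (2 * l + r) < 2 * L := by
      rw [Equiv.swap_apply_def]; split_ifs <;> omega
    obtain ⟨a1, a2⟩ := hu i r hr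
    rw [← hl] at a1 a2
    obtain ⟨b1, b2⟩ := hv (2 * l + r) (by omega)
    obtain ⟨c1, c2⟩ := hw _ h1
    rw [h0] at c1 c2
    rw [Equiv.Perm.mul_apply, ← hl]
    constructor
    · simp only [Units.val_mul]
      rw [mul_assoc, a1, ← mul_assoc, mul_assoc (w : 𝔅), b1, ← mul_assoc, c1]; simp only [mul_assoc]
    · simp only [Units.val_mul]
      rw [mul_assoc, a2, ← mul_assoc, mul_assoc (w : 𝔅), b2, ← mul_assoc, c2]; simp only [mul_assoc]

/-- Translation by two sites is implemented by conjugation with an invertible operator. -/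
lemma exists_translation (hL : 0 < L) : ∃ u : 𝔅ˣ, ∀ k,
    u * C.g k * ↑u⁻¹ = C.g (k + 2) ∧ u * C.h k * ↑u⁻¹ = C.h (k + 2) := by
  obtain ⟨n, rfl⟩ : ∃ n, L = n + 1 := ⟨L - 1, by omega⟩
  obtain ⟨u, hu⟩ := C.exists_perm (finRotate (n + 1))
  refine ⟨u, fun k => ?_⟩
  have hk : k % (2 * (n + 1)) < 2 * (n + 1) := Nat.mod_lt _ (by omega)
  obtain ⟨m, hm⟩ : ∃ m, m = k % (2 * (n + 1)) := ⟨_, rfl⟩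
  have hm2 : (2 * ((finRotate (n + 1) ⟨m / 2, by omega⟩ : Fin (n + 1)) : ℕ) + m % 2)
      = (k + 2) % (2 * (n + 1)) := by
    have h1 : (k + 2) % (2 * (n + 1)) = (m + 2) % (2 * (n + 1)) := by rw [hm, Nat.mod_add_mod]
    rw [h1, coe_finRotate]
    by_cases h : m / 2 = n
    · rw [if_pos (Fin.ext h), Nat.mod_eq_sub_mod (a := m + 2) (by omega),
        Nat.mod_eq_of_lt (a := m + 2 - _) (by omega)]
      omega
    · rw [if_neg (fun h' => h (congrArg Fin.val h')), Nat.mod_eq_of_lt (a := m + 2) (by omega)]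
      change 2 * (m / 2 + 1) + m % 2 = m + 2
      omega
  obtain ⟨h1, h2⟩ := hu ⟨m / 2, by omega⟩ (m % 2) (Nat.mod_lt _ two_pos)
  rw [hm2, Nat.div_add_mod] at h1 h2
  rw [C.g_mod k, C.h_mod k, C.g_mod (k + 2), C.h_mod (k + 2), ← hm, h1, h2]
  simp [mul_assoc]

end Permutations
end Chain

section OrderedSumsFin

variable {𝔅 : Type*} [Ring 𝔅] [Algebra ℂ 𝔅] (v : ℕ → 𝔅) (m : ℕ)

lemma ordSum_one_univ : ordSum (fun j : Fin m => v j) 1 Finset.univ = Chain.lin v m := by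
  rw [ordSum_one, Chain.lin, Fin.sum_univ_eq_sum_range (fun k => v k)]

lemma ordSum_two_univ : ordSum (fun j : Fin m => v j) 2 Finset.univ = Chain.quad v m := by
  have h : ∀ j : Fin m, ∑ i : Fin m, (if i < j then v i * v j else 0) = Chain.lin v j * v j := by
    intro j
    have := Fin.sum_univ_eq_sum_range (fun k => if k < (j : ℕ) then v k * v j else 0) m
    simp only [Fin.lt_def]
    rw [this, ← Finset.sum_filter, Chain.lin, Finset.sum_mul]
    refine Finset.sum_congr ?_ fun _ _ => rfl
    ext k
    simp only [Finset.mem_filter, Finset.mem_range]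
    omega
  rw [ordSum_two, Finset.sum_congr rfl fun j _ => h j, Chain.quad,
    Fin.sum_univ_eq_sum_range (fun k => Chain.lin v k * v k)]

lemma ordSum_card_univ : ordSum (fun j : Fin m => v j) m Finset.univ = Chain.top v m := by
  have h : (Finset.univ : Finset (Fin m)).powersetCard m = {Finset.univ} := by
    have := Finset.powersetCard_self (Finset.univ : Finset (Fin m))
    rwa [Finset.card_fin] at this
  rw [ordSum, h, Finset.sum_singleton, Fin.sort_univ, Chain.top]
  congr 1
  rw [← List.map_coe_finRange_eq_range, List.map_map]
  rfl

/-- Odd ordered sums of anticommuting elements, in terms of the linear and the quadratic one. -/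
lemma factorial_smul_ordSum_univ (hv : ∀ j k, v j * v k = -(v k * v j)) (k : ℕ) :
    (k.factorial : ℂ) • ordSum (fun j : Fin m => v j) (2 * k + 1) Finset.univ
      = Chain.lin v m * Chain.quad v m ^ k := by
  rw [(factorial_smul_ordSum (v := fun j : Fin m => v j) (fun i j => hv i j) _ k).2, ordSum_one_univ,
    ordSum_two_univ]

lemma lin_mul_quad_pow_eq_zero (hv : ∀ j k, v j * v k = -(v k * v j)) {k : ℕ} (hk : m < 2 * k + 1) :
    Chain.lin v m * Chain.quad v m ^ k = 0 := by
  rw [← factorial_smul_ordSum_univ v m hv, ordSum, Finset.powersetCard_eq_empty.2 (by simpa using hk),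
    Finset.sum_empty, smul_zero]

end OrderedSumsFin

namespace SpinChain

section JordanWigner

variable {N : ℕ}

lemma site_apply (a : Matrix (Fin 2) (Fin 2) ℂ) (j : Fin N) (x y : Fin N → Fin 2) :
    site N a j x y = a (x j) (y j) * if ∀ k, k ≠ j → x k = y k then 1 else 0 := by
  rw [site, Matrix.of_apply, Finset.prod_ite_zero]
  simp

lemma site_apply_mul (a : Matrix (Fin 2) (Fin 2) ℂ) (j : Fin N) (M : Op N) (x y : Fin N → Fin 2) :
    (site N a j * M) x y = ∑ t, a (x j) t * M (Function.update x j t) y := by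
  rw [Matrix.mul_apply, ← Finset.sum_subset (Finset.subset_univ
    (Finset.univ.map ⟨Function.update x j, Function.update_injective x j⟩)), Finset.sum_map]
  · refine Finset.sum_congr rfl fun t _ => ?_
    rw [site_apply, if_pos fun k hk => by simp [hk]]
    simp
  · intro z _ hz
    rw [site_apply, if_neg, mul_zero, zero_mul]
    intro h
    refine hz (Finset.mem_map.2 ⟨z j, Finset.mem_univ _, ?_⟩)
    funext k
    by_cases hk : k = j
    · subst hk; simp
    · simp [hk, h k hk]

lemma site_mul_site (a b : Matrix (Fin 2) (Fin 2) ℂ) (j : Fin N) :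
    site N a j * site N b j = site N (a * b) j := by
  ext x y
  rw [site_apply_mul, site_apply, Matrix.mul_apply, Finset.sum_mul]
  refine Finset.sum_congr rfl fun t _ => ?_
  rw [site_apply, mul_assoc, Function.update_self]
  congr 3
  refine propext (forall₂_congr fun k hk => ?_)
  rw [Function.update_of_ne hk]

lemma site_add (a b : Matrix (Fin 2) (Fin 2) ℂ) (j : Fin N) :
    site N (a + b) j = site N a j + site N b j := by
  ext x y
  simp only [site_apply, Matrix.add_apply, add_mul]

lemma site_neg (a : Matrix (Fin 2) (Fin 2) ℂ) (j : Fin N) : site N (-a) j = -site N a j := by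
  ext x y
  simp only [site_apply, Matrix.neg_apply, neg_mul]

lemma site_zero (j : Fin N) : site N 0 j = 0 := by
  ext x y
  simp only [site_apply, Matrix.zero_apply, zero_mul]

lemma site_diagonal (d : Fin 2 → ℂ) (j : Fin N) :
    site N (Matrix.diagonal d) j = Matrix.diagonal fun x => d (x j) := by
  have h := fun x y => congrFun (congrFun (mul_one (site N (Matrix.diagonal d) j)).symm x) y
  ext x y
  rw [h, site_apply_mul, Finset.sum_eq_single (x j), Function.update_eq_self, Matrix.one_apply,
    Matrix.diagonal_apply_eq, Matrix.diagonal_apply]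
  · simp
  · intro t _ ht
    rw [Matrix.diagonal_apply_ne _ ht.symm, zero_mul]
  · simp

lemma site_one (j : Fin N) : site N 1 j = 1 := by
  rw [← Matrix.diagonal_one, site_diagonal, Matrix.diagonal_one]

lemma commute_site (a b : Matrix (Fin 2) (Fin 2) ℂ) {j k : Fin N} (hjk : j ≠ k) :
    Commute (site N a j) (site N b k) := by
  have h : site N a j * (site N b k * 1) = site N b k * (site N a j * 1) := by
    ext x y
    simp only [site_apply_mul, Finset.mul_sum]
    rw [Finset.sum_comm]
    refine Finset.sum_congr rfl fun s _ => Finset.sum_congr rfl fun t _ => ?_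
    rw [Function.update_of_ne hjk.symm, Function.update_of_ne hjk, Function.update_comm hjk]
    ring
  rwa [mul_one, mul_one] at h

variable {z w : Fin 2 → ℂ} {a b : Matrix (Fin 2) (Fin 2) ℂ}

lemma commute_site_diagonal (z w : Fin 2 → ℂ) (j k : Fin N) :
    Commute (site N (Matrix.diagonal z) j) (site N (Matrix.diagonal w) k) := by
  rw [site_diagonal, site_diagonal]
  exact Matrix.commute_diagonal _ _

lemma commute_string (z w : Fin 2 → ℂ) (j k : Fin N) : Commute (string N z j) (string N w k) := by
  refine Commute.list_prod_left _ _ fun A hA => Commute.list_prod_right _ _ fun B hB => ?_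
  obtain ⟨i, -, rfl⟩ := List.mem_map.1 hA
  obtain ⟨l, -, rfl⟩ := List.mem_map.1 hB
  exact commute_site_diagonal z w i l

lemma commute_string_site (z : Fin 2 → ℂ) (a : Matrix (Fin 2) (Fin 2) ℂ) {j k : Fin N} (h : j ≤ k) :
    Commute (string N z j) (site N a k) := by
  refine Commute.list_prod_left _ _ fun A hA => ?_
  obtain ⟨i, hi, rfl⟩ := List.mem_map.1 hA
  have hi' : i < j := by simpa using hi
  exact commute_site _ _ (hi'.trans_le h).ne

/-- A Jordan–Wigner string anticommutes with the off-diagonal operators on the sites it covers. -/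
lemma string_mul_site (h : Matrix.diagonal z * a = -(a * Matrix.diagonal z)) {j k : Fin N}
    (hkj : k < j) : string N z j * site N a k = -(site N a k * string N z j) := by
  have key : ∀ l : List (Fin N), l.Nodup → k ∈ l →
      (l.map fun i => site N (Matrix.diagonal z) i).prod * site N a k
        = -(site N a k * (l.map fun i => site N (Matrix.diagonal z) i).prod) := by
    intro l
    induction l with
    | nil => simp
    | cons i l ih =>
      intro hl hk
      rw [List.nodup_cons] at hl
      rw [List.map_cons, List.prod_cons, mul_assoc]
      by_cases hik : k = i
      · subst hik
        have : Commute (l.map fun i => site N (Matrix.diagonal z) i).prod (site N a k) := by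
          refine Commute.list_prod_left _ _ fun A hA => ?_
          obtain ⟨i, hi, rfl⟩ := List.mem_map.1 hA
          exact commute_site _ _ fun h => hl.1 (h ▸ hi)
        rw [this.eq, ← mul_assoc, site_mul_site, h, site_neg, ← site_mul_site, neg_mul, mul_assoc]
      · rw [ih hl.2 ((List.mem_cons.1 hk).resolve_left hik), mul_neg, ← mul_assoc,
          (commute_site _ _ (Ne.symm hik)).eq, mul_assoc]
  exact key _ ((List.nodup_finRange N).filter _) (by simpa using hkj)

lemma string_mul_string (hzw : ∀ i, z i * w i = 1) (j : Fin N) : string N z j * string N w j = 1 := by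
  have key : ∀ l : List (Fin N), (l.map fun i => site N (Matrix.diagonal z) i).prod
      * (l.map fun i => site N (Matrix.diagonal w) i).prod = 1 := by
    intro l
    induction l with
    | nil => simp
    | cons i l ih =>
      have h1 : Commute (l.map fun i => site N (Matrix.diagonal z) i).prod
          (site N (Matrix.diagonal w) i) := by
        refine Commute.list_prod_left _ _ fun A hA => ?_
        obtain ⟨k, -, rfl⟩ := List.mem_map.1 hA
        exact commute_site_diagonal z w k i
      have h2 : Matrix.diagonal z * Matrix.diagonal w = (1 : Matrix (Fin 2) (Fin 2) ℂ) := by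
        rw [Matrix.diagonal_mul_diagonal, funext hzw]; exact Matrix.diagonal_one
      rw [List.map_cons, List.prod_cons, List.map_cons, List.prod_cons, mul_assoc, ← mul_assoc _ (site _ _ _),
        h1.eq, mul_assoc (site _ _ _) _, ih, mul_one, site_mul_site, h2, site_one]
  exact key _

lemma jordanWigner_anticomm_of_lt (h : Matrix.diagonal w * a = -(a * Matrix.diagonal w)) {j k : Fin N}
    (hjk : j < k) : string N z j * site N a j * (string N w k * site N b k)
      = -(string N w k * site N b k * (string N z j * site N a j)) := by
  have h1 : site N a j * string N w k = -(string N w k * site N a j) := by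
    rw [string_mul_site h hjk, neg_neg]
  calc _ = string N z j * (site N a j * string N w k) * site N b k := by simp only [mul_assoc]
    _ = -(string N z j * string N w k * (site N a j * site N b k)) := by
      rw [h1]; simp only [mul_neg, neg_mul, mul_assoc]
    _ = -(string N w k * (string N z j * site N b k) * site N a j) := by
      rw [(commute_string z w j k).eq, (commute_site a b hjk.ne).eq]; simp only [mul_assoc]
    _ = _ := by rw [(commute_string_site z b hjk.le).eq]; simp only [mul_assoc]

lemma jordanWigner_mul_self (z w : Fin 2 → ℂ) (a b : Matrix (Fin 2) (Fin 2) ℂ) (j : Fin N) :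
    string N z j * site N a j * (string N w j * site N b j)
      = string N z j * string N w j * site N (a * b) j := by
  rw [← site_mul_site, mul_assoc, ← mul_assoc (site _ _ _), ← (commute_string_site w a le_rfl).eq]
  simp only [mul_assoc]

end JordanWigner

end SpinChain

namespace SpinChain

section Fermions

variable {N : ℕ}

lemma sigmaMinus_eq : sigmaMinus = !![0, 0; 1, 0] := by
  ext i j
  fin_cases i <;> fin_cases j <;> simp [sigmaMinus, sigmaX, sigmaY, one_add_one_eq_two]

lemma sigmaPlus_eq : sigmaPlus = !![0, 1; 0, 0] := by
  ext i j
  fin_cases i <;> fin_cases j <;> simp [sigmaPlus, sigmaX, sigmaY, one_add_one_eq_two]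

lemma f_eq (j : Fin N) : f N j = I • (string N ![-I, I] j * site N sigmaMinus j) := by
  rw [f, c, smul_smul]
  congr 1
  rw [_root_.zpow_neg, zpow_natCast, pow_succ', mul_assoc, mul_inv_cancel₀ (pow_ne_zero _ I_ne_zero), mul_one]

lemma fd_eq (j : Fin N) :
    fd N j = (I * (-1) ^ (j : ℕ)) • (string N ![I, -I] j * site N sigmaPlus j) := by
  rw [fd, cd, smul_smul]
  congr 1
  rw [pow_succ', mul_assoc, ← mul_pow, I_mul_I]

lemma diagonal_mul_sigma (s : ℂ) (a : Matrix (Fin 2) (Fin 2) ℂ) (ha : a = sigmaMinus ∨ a = sigmaPlus) :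
    Matrix.diagonal ![s, -s] * a = -(a * Matrix.diagonal ![s, -s]) := by
  rcases ha with rfl | rfl <;> ext i j <;> fin_cases i <;> fin_cases j <;>
    simp [Matrix.vecMul_diagonal, sigmaMinus_eq, sigmaPlus_eq]

lemma jordanWigner_anticomm (s t : ℂ) {a b : Matrix (Fin 2) (Fin 2) ℂ} (ha : a = sigmaMinus ∨ a = sigmaPlus)
    (hb : b = sigmaMinus ∨ b = sigmaPlus) {j k : Fin N} (hjk : j ≠ k) :
    string N ![s, -s] j * site N a j * (string N ![t, -t] k * site N b k)
      = -(string N ![t, -t] k * site N b k * (string N ![s, -s] j * site N a j)) := by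
  rcases lt_or_gt_of_ne hjk with h | h
  · exact jordanWigner_anticomm_of_lt (diagonal_mul_sigma t a ha) h
  · rw [jordanWigner_anticomm_of_lt (diagonal_mul_sigma s b hb) h, neg_neg]

lemma f_eq' (j : Fin N) : f N j = I • (string N ![-I, -(-I)] j * site N sigmaMinus j) := by
  rw [f_eq, neg_neg]

lemma f_mul_f (j k : Fin N) : f N j * f N k = -(f N k * f N j) := by
  by_cases h : j = k
  · subst h
    have h0 : sigmaMinus * sigmaMinus = 0 := by
      rw [sigmaMinus_eq]
      ext i j
      fin_cases i <;> fin_cases j <;> simp [Matrix.mul_apply]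
    rw [f_eq, smul_mul_smul_comm, jordanWigner_mul_self, h0, site_zero]
    simp
  · rw [f_eq', f_eq', smul_mul_smul_comm, smul_mul_smul_comm,
      jordanWigner_anticomm _ _ (.inl rfl) (.inl rfl) h, smul_neg]

lemma fd_mul_fd (j k : Fin N) : fd N j * fd N k = -(fd N k * fd N j) := by
  by_cases h : j = k
  · subst h
    have h0 : sigmaPlus * sigmaPlus = 0 := by
      rw [sigmaPlus_eq]
      ext i j
      fin_cases i <;> fin_cases j <;> simp [Matrix.mul_apply]
    rw [fd_eq, smul_mul_smul_comm, jordanWigner_mul_self, h0, site_zero]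
    simp
  · rw [fd_eq, fd_eq, smul_mul_smul_comm, smul_mul_smul_comm,
      jordanWigner_anticomm _ _ (.inr rfl) (.inr rfl) h, smul_neg, mul_comm]

lemma f_mul_fd_self (j : Fin N) :
    f N j * fd N j = (-1 : ℂ) ^ ((j : ℕ) + 1) • site N (Matrix.diagonal ![0, 1]) j := by
  have h0 : sigmaMinus * sigmaPlus = Matrix.diagonal ![0, 1] := by
    rw [sigmaMinus_eq, sigmaPlus_eq]
    ext i j
    fin_cases i <;> fin_cases j <;> simp [Matrix.mul_apply]
  have h1 : string N ![-I, I] j * string N ![I, -I] j = 1 :=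
    string_mul_string (fun i => by fin_cases i <;> simp) j
  rw [f_eq, fd_eq, smul_mul_smul_comm, jordanWigner_mul_self, h0, h1, one_mul, ← mul_assoc, I_mul_I, pow_succ']

lemma fd_mul_f_self (j : Fin N) :
    fd N j * f N j = (-1 : ℂ) ^ ((j : ℕ) + 1) • site N (Matrix.diagonal ![1, 0]) j := by
  have h0 : sigmaPlus * sigmaMinus = Matrix.diagonal ![1, 0] := by
    rw [sigmaMinus_eq, sigmaPlus_eq]
    ext i j
    fin_cases i <;> fin_cases j <;> simp [Matrix.mul_apply]
  have h1 : string N ![I, -I] j * string N ![-I, I] j = 1 :=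
    string_mul_string (fun i => by fin_cases i <;> simp) j
  rw [f_eq, fd_eq, smul_mul_smul_comm, jordanWigner_mul_self, h0, h1, one_mul, mul_right_comm, I_mul_I, pow_succ']

lemma fd_mul_f (j k : Fin N) :
    fd N j * f N k = (if j = k then (-1 : ℂ) ^ ((j : ℕ) + 1) else 0) • 1 - f N k * fd N j := by
  by_cases h : j = k
  · subst h
    have h0 : Matrix.diagonal ![1, 0] + Matrix.diagonal ![0, 1] = (1 : Matrix (Fin 2) (Fin 2) ℂ) := by
      ext i j
      fin_cases i <;> fin_cases j <;> simp
    rw [if_pos rfl, eq_sub_iff_add_eq, fd_mul_f_self, f_mul_fd_self, ← smul_add, ← site_add, h0, site_one]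
  · rw [if_neg h, zero_smul, zero_sub, f_eq', fd_eq, smul_mul_smul_comm, smul_mul_smul_comm,
      jordanWigner_anticomm _ _ (.inr rfl) (.inl rfl) h, smul_neg, mul_comm]

end Fermions

end SpinChain

namespace SpinChain

section Centralizer

/-- The fermions of the periodic spin chain, indexed by the natural numbers modulo its length. -/
def chain (L : ℕ) (hL : 0 < L) : Chain (Op (2 * L)) L where
  g k := f (2 * L) ⟨k % (2 * L), Nat.mod_lt _ (by omega)⟩
  h k := fd (2 * L) ⟨k % (2 * L), Nat.mod_lt _ (by omega)⟩
  g_add k := by simp only [Nat.add_mod_right]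
  h_add k := by simp only [Nat.add_mod_right]
  gg j k := f_mul_f _ _
  hh j k := fd_mul_fd _ _
  hg j k := by
    have h : (-1 : ℂ) ^ (j % (2 * L) + 1) = (-1) ^ (j + 1) := by
      rw [neg_one_pow_eq_pow_mod_two, neg_one_pow_eq_pow_mod_two (n := j + 1), Nat.add_mod,
        Nat.mod_mul_right_mod, ← Nat.add_mod]
    rw [fd_mul_f]
    simp only [Fin.mk.injEq, h]

variable {L : ℕ} (hL : 0 < L)

lemma chain_g (j : Fin (2 * L)) : (chain L hL).g j = f (2 * L) j := by
  change f (2 * L) ⟨(j : ℕ) % (2 * L), _⟩ = _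
  congr 1
  exact Fin.ext (Nat.mod_eq_of_lt j.2)

lemma chain_h (j : Fin (2 * L)) : (chain L hL).h j = fd (2 * L) j := by
  change fd (2 * L) ⟨(j : ℕ) % (2 * L), _⟩ = _
  congr 1
  exact Fin.ext (Nat.mod_eq_of_lt j.2)

lemma chain_tl (j : Fin (2 * L)) : (chain L hL).tl j = e (2 * L) j := by
  rw [Chain.tl, chain_g, chain_h]
  rfl

/-- The number of sites in the state `1`. -/
def count (x : Fin (2 * L) → Fin 2) : ℕ := ∑ j, (x j : ℕ)

lemma count_le (x : Fin (2 * L) → Fin 2) : count x ≤ 2 * L := by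
  have h := Finset.sum_le_card_nsmul Finset.univ (fun j => (x j : ℕ)) 1 fun j _ => by omega
  simpa [count] using h

lemma count_eq_zero_iff (x : Fin (2 * L) → Fin 2) : count x = 0 ↔ x = 0 := by
  simp only [count, Finset.sum_eq_zero_iff, Finset.mem_univ, true_implies, funext_iff, Fin.ext_iff]
  rfl

lemma diagonal_sum {ι : Type*} (s : Finset ι) (d : ι → (Fin (2 * L) → Fin 2) → ℂ) :
    ∑ i ∈ s, Matrix.diagonal (d i) = Matrix.diagonal fun x => ∑ i ∈ s, d i x := by
  rw [← Matrix.diagonalAddMonoidHom_apply, ← Finset.sum_fn, map_sum]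
  rfl

lemma chain_num : (chain L hL).num = Matrix.diagonal fun x => (count x : ℂ) := by
  have h : ∀ j : Fin (2 * L), (-1 : ℂ) ^ ((j : ℕ) + 1) • ((chain L hL).g j * (chain L hL).h j)
      = Matrix.diagonal fun x => ((x j : ℕ) : ℂ) := by
    intro j
    rw [chain_g, chain_h, f_mul_fd_self, smul_smul, ← mul_pow, neg_one_mul, neg_neg, one_pow, one_smul,
      site_diagonal]
    congr 1
    funext x
    generalize x j = t
    fin_cases t <;> simp
  rw [Chain.num, Chain.lin, ← Fin.sum_univ_eq_sum_range
    (fun k => (-1 : ℂ) ^ (k + 1) • ((chain L hL).g k * (chain L hL).h k)),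
    Finset.sum_congr rfl fun j _ => h j, diagonal_sum]
  simp only [count, Nat.cast_sum]

lemma Sz_eq : Sz (2 * L) = (L : ℂ) • 1 - (chain L hL).num := by
  have h : ∀ j : Fin (2 * L), site (2 * L) sigmaZ j = Matrix.diagonal fun x => 1 - 2 * ((x j : ℕ) : ℂ) := by
    intro j
    have hz : sigmaZ = Matrix.diagonal ![1, -1] := by
      ext i j
      fin_cases i <;> fin_cases j <;> simp [sigmaZ]
    rw [hz, site_diagonal]
    congr 1
    funext x
    generalize x j = t
    fin_cases t <;> norm_num
  rw [Sz, Finset.sum_congr rfl fun j _ => h j, diagonal_sum, chain_num, ← Matrix.diagonal_one,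
    ← Matrix.diagonal_smul, ← Matrix.diagonal_smul, Matrix.diagonal_sub]
  congr 1
  funext x
  simp only [Pi.smul_apply, smul_eq_mul, Finset.sum_sub_distrib, ← Finset.mul_sum, count, Nat.cast_sum,
    Finset.sum_const, Finset.card_univ, Fintype.card_fin, nsmul_eq_mul, Nat.cast_mul, Nat.cast_ofNat]
  ring

/-- The projection to the configurations with `p` sites in the state `1`. -/
def sector (p : ℤ) : Op (2 * L) := Matrix.diagonal fun x => if (count x : ℤ) = p then 1 else 0

lemma sector_mul_sector (p q : ℤ) :
    (sector p * sector q : Op (2 * L)) = if p = q then sector p else 0 := by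
  rw [sector, sector, Matrix.diagonal_mul_diagonal]
  split_ifs with h
  · subst h
    congr 1; funext x; simp
  · rw [← Matrix.diagonal_zero]
    congr 1; funext x
    by_cases h1 : (count x : ℤ) = p
    · simp [h1, h]
    · simp [h1]

lemma sum_smul_sector (d : ℕ → ℂ) :
    ∑ p ∈ Finset.range (2 * L + 1), d p • (sector p : Op (2 * L))
      = Matrix.diagonal fun x => d (count x) := by
  simp only [sector, ← Matrix.diagonal_smul]
  rw [diagonal_sum]
  congr 1
  funext x
  rw [Finset.sum_eq_single (count x)]
  · simp
  · intro p _ hp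
    simp [hp.symm]
  · intro h
    exact absurd (Finset.mem_range.2 (Nat.lt_succ_of_le (count_le x))) h

lemma sector_zero_mul_mul (S : Op (2 * L)) :
    ∃ s : ℂ, sector 0 * S * sector 0 = s • (sector 0 : Op (2 * L)) := by
  refine ⟨S 0 0, ?_⟩
  ext x y
  simp only [sector, Matrix.mul_diagonal, Matrix.diagonal_mul, Matrix.smul_apply, Matrix.diagonal_apply,
    Nat.cast_eq_zero, count_eq_zero_iff, smul_eq_mul]
  by_cases hx : x = 0 <;> by_cases hy : y = 0
  · simp [hx, hy]
  · simp [hx, hy, Ne.symm hy]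
  · simp [hx, hy]
  · simp [hx, hy]

lemma Fg_eq (m : ℕ) : Fg (2 * L) m = ordSum (fun j : Fin (2 * L) => (chain L hL).g j) m Finset.univ := by
  simp only [chain_g]
  rfl

lemma Fdg_eq (m : ℕ) : Fdg (2 * L) m = ordSum (fun j : Fin (2 * L) => (chain L hL).h j) m Finset.univ := by
  simp only [chain_h]
  rfl

lemma adjoin_centGens : Algebra.adjoin ℂ (centGens L) = Algebra.adjoin ℂ (chain L hL).symGens := by
  have hk : ∀ k : ℕ, (k.factorial : ℂ) ≠ 0 := fun k => Nat.cast_ne_zero.2 k.factorial_ne_zero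
  apply le_antisymm <;> refine Algebra.adjoin_le ?_
  · rintro T (⟨k, -, rfl⟩ | ⟨k, -, rfl⟩ | rfl | rfl | rfl)
    · rw [Fg_eq hL, ← inv_smul_smul₀ (hk k) (ordSum _ _ _),
        factorial_smul_ordSum_univ _ _ (chain L hL).gg]
      exact Subalgebra.smul_mem _ (Algebra.subset_adjoin (.inl ⟨k, rfl⟩)) _
    · rw [Fdg_eq hL, ← inv_smul_smul₀ (hk k) (ordSum _ _ _),
        factorial_smul_ordSum_univ _ _ (chain L hL).hh]
      exact Subalgebra.smul_mem _ (Algebra.subset_adjoin (.inr (.inl ⟨k, rfl⟩))) _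
    · rw [Fg_eq hL, ordSum_card_univ]
      exact Algebra.subset_adjoin (.inr (.inr (.inl rfl)))
    · rw [Fdg_eq hL, ordSum_card_univ]
      exact Algebra.subset_adjoin (.inr (.inr (.inr (.inl rfl))))
    · rw [Sz_eq hL]
      exact Subalgebra.sub_mem _ (Subalgebra.smul_mem _ (Subalgebra.one_mem _) _)
        (Algebra.subset_adjoin (.inr (.inr (.inr (.inr rfl)))))
  · rintro T (⟨k, rfl⟩ | ⟨k, rfl⟩ | rfl | rfl | rfl)
    · by_cases hkL : k < L
      · rw [← factorial_smul_ordSum_univ _ _ (chain L hL).gg, ← Fg_eq hL]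
        exact Subalgebra.smul_mem _ (Algebra.subset_adjoin (.inl ⟨k, hkL, rfl⟩)) _
      · rw [lin_mul_quad_pow_eq_zero _ _ (chain L hL).gg (by omega)]
        exact Subalgebra.zero_mem _
    · by_cases hkL : k < L
      · rw [← factorial_smul_ordSum_univ _ _ (chain L hL).hh, ← Fdg_eq hL]
        exact Subalgebra.smul_mem _ (Algebra.subset_adjoin (.inr (.inl ⟨k, hkL, rfl⟩))) _
      · rw [lin_mul_quad_pow_eq_zero _ _ (chain L hL).hh (by omega)]
        exact Subalgebra.zero_mem _
    · rw [← ordSum_card_univ, ← Fg_eq hL]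
      exact Algebra.subset_adjoin (.inr (.inr (.inl rfl)))
    · rw [← ordSum_card_univ, ← Fdg_eq hL]
      exact Algebra.subset_adjoin (.inr (.inr (.inr (.inl rfl))))
    · rw [← sub_sub_cancel ((L : ℂ) • (1 : Op (2 * L))) (chain L hL).num, ← Sz_eq hL]
      exact Subalgebra.sub_mem _ (Subalgebra.smul_mem _ (Subalgebra.one_mem _) _)
        (Algebra.subset_adjoin (.inr (.inr (.inr (.inr rfl)))))

lemma implementsTranslation_iff (u : (Op (2 * L))ˣ) : ImplementsTranslation L u ↔
    ∀ k, u * (chain L hL).g k * ((u⁻¹ : (Op (2 * L))ˣ) : Op (2 * L)) = (chain L hL).g (k + 2) ∧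
      u * (chain L hL).h k * ((u⁻¹ : (Op (2 * L))ˣ) : Op (2 * L)) = (chain L hL).h (k + 2) := by
  constructor
  · intro h k
    obtain ⟨h1, h2⟩ := h ⟨k % (2 * L), Nat.mod_lt _ (by omega)⟩
    simp only [fshift2, Nat.mod_add_mod] at h1 h2
    exact ⟨h1, h2⟩
  · intro h j
    obtain ⟨h1, h2⟩ := h j
    rw [chain_g] at h1
    rw [chain_h] at h2
    exact ⟨h1, h2⟩

lemma range_e : Set.range (e (2 * L)) = {T | ∃ k < 2 * L, T = (chain L hL).tl k} := by
  ext T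
  constructor
  · rintro ⟨j, rfl⟩
    exact ⟨j, j.2, (chain_tl hL j).symm⟩
  · rintro ⟨k, hk, rfl⟩
    exact ⟨⟨k, hk⟩, (chain_tl hL ⟨k, hk⟩).symm⟩

lemma centralizer_adjoin (S : Set (Op (2 * L))) :
    Subalgebra.centralizer ℂ ((Algebra.adjoin ℂ S : Subalgebra ℂ (Op (2 * L))) : Set (Op (2 * L)))
      = Subalgebra.centralizer ℂ S := by
  refine le_antisymm (Subalgebra.centralizer_le _ _ _ Algebra.subset_adjoin) fun x hx => ?_
  rw [Subalgebra.mem_centralizer_iff]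
  exact fun y hy => ((Subalgebra.mem_centralizer_iff _).1
    (Algebra.adjoin_le_centralizer_centralizer ℂ S hy) x hx).symm

end Centralizer

/-- **Theorem (centralizer of the Jones–Temperley–Lieb algebra).**  An invertible
operator implementing translation by two sites exists, and for any such `u` the
commutant of the unital subalgebra generated by `{e_1, …, e_N, u, u⁻¹}` (the
spin-chain representation of `JTL_N` at `m = 0`) equals the unital subalgebra
generated by `{F_(2k+1), F†_(2k+1) : 0 ≤ k ≤ L−1} ∪ {F_(N), F†_(N), S^z}`. -/
theorem gl11_JTL_centralizer (L : ℕ) (hL : 0 < L) :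
    (∃ u : (Op (2 * L))ˣ, ImplementsTranslation L u) ∧
    (∀ u : (Op (2 * L))ˣ, ImplementsTranslation L u →
      Subalgebra.centralizer ℂ
        ((Algebra.adjoin ℂ
          (Set.range (e (2 * L)) ∪ {(u : Op (2 * L)), ((u⁻¹ : (Op (2 * L))ˣ) : Op (2 * L))})
          : Subalgebra ℂ (Op (2 * L))) : Set (Op (2 * L))) =
        Algebra.adjoin ℂ (centGens L)) := by
  refine ⟨?_, fun u hu => ?_⟩
  · obtain ⟨u, hu⟩ := (chain L hL).exists_translation hL
    exact ⟨u, (implementsTranslation_iff hL u).2 hu⟩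
  · obtain ⟨n, rfl⟩ : ∃ n, L = n + 1 := ⟨L - 1, by omega⟩
    rw [implementsTranslation_iff hL] at hu
    rw [centralizer_adjoin, range_e hL, adjoin_centGens hL]
    refine (chain (n + 1) hL).centralizer_eq sector sector_mul_sector ?_ ?_ sector_zero_mul_mul u
      (fun k => (hu k).1) fun k => (hu k).2
    · have := sum_smul_sector (L := n + 1) fun _ => 1
      simp only [one_smul, Matrix.diagonal_one] at this
      exact this
    · rw [chain_num]
      exact (sum_smul_sector (L := n + 1) fun p => (p : ℂ)).symm

end SpinChain

end
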